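/- arXiv:1211.4184 — 2 statements merged into one kernel-verified Lean document; each statement's English description precedes it below -/
import Mathlib

section
/- Fix positive integers k_1, k_2 and ε > 0. Then there exists a constant c(k_1,k_2,ε) > 0 such that for all positive integers N_1, N_2 and every real number ξ with |ξ| > N_1 N_2 one has |∑_{N_1 ≤ n_1 < 2N_1} ∑_{N_2 ≤ n_2 < 2N_2} exp(i·ξ/(n_1 n_2))| ≤ c(k_1,k_2,ε)·γ·(N_1 N_2)^{1+ε}, where γ = [ ( (|ξ|/(N_1N_2))·N_1^{−2k_1} + (N_1N_2/|ξ|)·N_1^{2(k_1−1)} ) · ( (|ξ|/(N_1N_2))·N_2^{−2k_2} + (N_1N_2/|ξ|)·N_2^{2(k_2−1)} ) ]^{1/(4k_1k_2)}. -/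
open Finset

lemma add_one_le_mul_rpow (ε : ℝ) (hε : 0 < ε) (p v : ℕ) (hp : 2 ≤ p) :
    (v : ℝ) + 1 ≤ (1 + 1 / (ε * Real.log 2)) * (p : ℝ) ^ (ε * v) := by
  have hl : 0 < ε * Real.log 2 := mul_pos hε (Real.log_pos one_lt_two)
  have h1 : (2 : ℝ) ^ (ε * v) ≤ (p : ℝ) ^ (ε * v) :=
    Real.rpow_le_rpow (by norm_num) (by exact_mod_cast hp) (by positivity)
  have h2 : ε * Real.log 2 * v + 1 ≤ (2 : ℝ) ^ (ε * v) := by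
    rw [Real.rpow_def_of_pos two_pos]
    convert Real.add_one_le_exp _ using 2
    ring
  calc (v : ℝ) + 1 ≤ (1 + 1 / (ε * Real.log 2)) * (ε * Real.log 2 * v + 1) := by
        have : (1 + 1 / (ε * Real.log 2)) * (ε * Real.log 2 * v + 1)
          = v + 1 + (ε * Real.log 2 * v + 1 / (ε * Real.log 2)) := by field_simp; ring
        rw [this]
        have : 0 ≤ ε * Real.log 2 * v + 1 / (ε * Real.log 2) := by positivity
        linarith
    _ ≤ _ := by gcongr; linarith

lemma add_one_le_rpow_of_large (ε : ℝ) (p v : ℕ) (hp : (2 : ℝ) ≤ (p : ℝ) ^ ε) :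
    (v : ℝ) + 1 ≤ (p : ℝ) ^ (ε * v) := by
  rw [Real.rpow_mul (Nat.cast_nonneg p), Real.rpow_natCast]
  calc (v : ℝ) + 1 ≤ 2 ^ v := by exact_mod_cast Nat.lt_two_pow_self (n := v)
    _ ≤ _ := by gcongr

/-- The divisor bound `d(n) ≪_ε n ^ ε`. -/
theorem exists_card_divisors_le_rpow (ε : ℝ) (hε : 0 < ε) :
    ∃ C : ℝ, 1 ≤ C ∧ ∀ n : ℕ, n ≠ 0 → (#n.divisors : ℝ) ≤ C * (n : ℝ) ^ ε := by
  set K : ℝ := 1 + 1 / (ε * Real.log 2) with hK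
  have hl : 0 < ε * Real.log 2 := mul_pos hε (Real.log_pos one_lt_two)
  have hK1 : 1 ≤ K := by rw [hK]; have : 0 < 1 / (ε * Real.log 2) := by positivity
                         linarith
  set P : ℕ := ⌈(2 : ℝ) ^ (1 / ε)⌉₊ with hP
  refine ⟨K ^ P, one_le_pow₀ hK1, fun n hn => ?_⟩
  have hfac : (n : ℝ) ^ ε = ∏ p ∈ n.primeFactors, (p : ℝ) ^ (ε * n.factorization p) := by
    conv_lhs => rw [← Nat.prod_factorization_pow_eq_self hn]
    rw [Finsupp.prod, Nat.support_factorization]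
    push_cast
    rw [← Real.finsetProd_rpow _ _ (fun i _ => by positivity)]
    refine prod_congr rfl fun p _ => ?_
    rw [← Real.rpow_natCast, ← Real.rpow_mul (Nat.cast_nonneg p), mul_comm]
  rw [Nat.card_divisors hn, hfac]
  push_cast
  calc ∏ p ∈ n.primeFactors, ((n.factorization p : ℝ) + 1)
      ≤ ∏ p ∈ n.primeFactors, ((if p < P then K else 1) * (p : ℝ) ^ (ε * n.factorization p)) := by
        refine prod_le_prod (fun i _ => by positivity) fun p hp => ?_
        have hp2 := (Nat.prime_of_mem_primeFactors hp).two_le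
        split_ifs with h
        · exact add_one_le_mul_rpow ε hε p _ hp2
        · rw [one_mul]
          refine add_one_le_rpow_of_large ε p _ ?_
          have : (2 : ℝ) ^ (1 / ε) ≤ p := (Nat.le_ceil _).trans (by exact_mod_cast not_lt.1 h)
          calc (2 : ℝ) = ((2 : ℝ) ^ (1 / ε)) ^ ε := by
                rw [← Real.rpow_mul (by norm_num), one_div_mul_cancel hε.ne', Real.rpow_one]
            _ ≤ _ := Real.rpow_le_rpow (by positivity) this hε.le
    _ = (∏ p ∈ n.primeFactors, if p < P then K else 1) * _ := prod_mul_distrib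
    _ ≤ _ := by
        gcongr
        rw [prod_ite, prod_const, prod_const_one, mul_one]
        refine pow_le_pow_right₀ hK1 ?_
        calc _ ≤ #(range P) := card_le_card fun p hp => by simpa using (mem_filter.1 hp).2
          _ = P := card_range P

/-- In a vanishing signed sum of unit fractions every prime power dividing a denominator
divides two of them, so the square of the lcm divides the product. -/
theorem lcm_sq_dvd_prod_of_sum_inv_eq_zero {ι : Type*} [Fintype ι] (x : ι → ℕ) (s : ι → ℚ)
    (hs : ∀ i, |s i| = 1) (hx : ∀ i, x i ≠ 0) (h : ∑ i, s i / x i = 0) :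
    (univ.lcm x) ^ 2 ∣ ∏ i, x i := by
  classical
  have hL : univ.lcm x ≠ 0 := by
    rw [Ne, Finset.lcm_eq_zero_iff]
    rintro ⟨i, -, hi⟩
    exact hx i hi
  rw [← Nat.factorization_le_iff_dvd (pow_ne_zero _ hL) (prod_ne_zero_iff.2 fun i _ => hx i)]
  intro p
  by_cases hp : p.Prime
  swap
  · simp [Nat.factorization_eq_zero_of_not_prime _ hp]
  have : Fact p.Prime := ⟨hp⟩
  rw [Nat.factorization_pow, Finsupp.smul_apply, Finset.factorization_lcm fun i _ => hx i,
    Nat.factorization_prod fun i _ => hx i, Finsupp.finsetSum_apply, smul_eq_mul]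
  rcases isEmpty_or_nonempty ι with hι | hι
  · simp
  obtain ⟨i, -, hi⟩ := exists_mem_eq_sup univ univ_nonempty fun i => (x i).factorization p
  rw [hi]
  obtain ⟨j, hj, hij⟩ : ∃ j, j ≠ i ∧ (x i).factorization p ≤ (x j).factorization p := by
    by_contra! hcon
    have hnorm : ∀ j, padicNorm p (s j / x j) = (p : ℚ) ^ ((x j).factorization p) := by
      intro j
      have hsj : padicNorm p (s j) = 1 := by
        rcases abs_eq (zero_le_one' ℚ) |>.1 (hs j) with h | h <;> simp [h]
      have hxj : (x j : ℚ) ≠ 0 := by exact_mod_cast hx j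
      rw [padicNorm.div, hsj, padicNorm.eq_zpow_of_nonzero hxj, padicValRat.of_nat,
        Nat.factorization_def _ hp]
      simp
    have hlt : padicNorm p (∑ j ∈ univ.erase i, s j / x j) < padicNorm p (s i / x i) := by
      refine padicNorm.sum_lt' (fun j hj => ?_) ?_
      · rw [hnorm, hnorm]
        exact pow_lt_pow_right₀ (by exact_mod_cast hp.one_lt) (hcon j (ne_of_mem_erase hj))
      · rw [hnorm]
        exact pow_pos (by exact_mod_cast hp.pos) _
    rw [← add_sum_erase univ _ (mem_univ i)] at h
    rw [eq_neg_of_add_eq_zero_right h, padicNorm.neg] at hlt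
    exact lt_irrefl _ hlt
  calc 2 * (x i).factorization p ≤ (x i).factorization p + (x j).factorization p := by omega
    _ = ∑ l ∈ {i, j}, (x l).factorization p := by rw [sum_pair hj.symm]
    _ ≤ _ := sum_le_sum_of_subset (subset_univ _)

/-- The mean value of the `2k`-th moment of reciprocals in a dyadic interval. -/
theorem exists_card_sum_inv_eq_le (k : ℕ) (ε : ℝ) (hε : 0 < ε) :
    ∃ C : ℝ, 1 ≤ C ∧ ∀ N : ℕ, 0 < N →
      (#{q ∈ Fintype.piFinset (fun _ : Fin k => Ico N (2 * N)) ×ˢ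
          Fintype.piFinset (fun _ : Fin k => Ico N (2 * N)) |
          ∑ i, (1 : ℝ) / q.1 i = ∑ i, (1 : ℝ) / q.2 i} : ℝ) ≤ C * (N : ℝ) ^ ((k : ℝ) + ε) := by
  set δ : ℝ := ε / (2 * k ^ 2 + 1) with hδ
  have hδ0 : 0 < δ := by positivity
  have hδε : δ * (2 * k ^ 2) ≤ ε := by
    rw [hδ, div_mul_eq_mul_div, div_le_iff₀ (by positivity)]
    nlinarith
  obtain ⟨C, hC1, hC⟩ := exists_card_divisors_le_rpow δ hδ0
  refine ⟨C ^ (2 * k) * 2 ^ ((k : ℝ) + ε), ?_, fun N hN => ?_⟩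
  · exact one_le_mul_of_one_le_of_one_le (one_le_pow₀ hC1)
      (Real.one_le_rpow one_le_two (by positivity))
  set M : ℕ := (2 * N) ^ k with hM
  have hMpos : 0 < M := by positivity
  set S := {q ∈ Fintype.piFinset (fun _ : Fin k => Ico N (2 * N)) ×ˢ
          Fintype.piFinset (fun _ : Fin k => Ico N (2 * N)) |
          ∑ i, (1 : ℝ) / q.1 i = ∑ i, (1 : ℝ) / q.2 i} with hS
  have hsub : S ⊆ (Icc 1 M).biUnion fun L =>
      Fintype.piFinset (fun _ : Fin k => L.divisors) ×ˢ
        Fintype.piFinset (fun _ : Fin k => L.divisors) := by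
    rintro ⟨n, m⟩ hq
    simp only [hS, mem_filter, mem_product, Fintype.mem_piFinset, mem_Ico] at hq
    obtain ⟨⟨hn, hm⟩, he⟩ := hq
    set x : Fin k ⊕ Fin k → ℕ := Sum.elim n m with hx
    have hx0 : ∀ i, x i ≠ 0 := by
      rintro (i | i)
      · have := hn i; simp only [hx, Sum.elim_inl]; omega
      · have := hm i; simp only [hx, Sum.elim_inr]; omega
    have hxle : ∀ i, x i ≤ 2 * N := by
      rintro (i | i)
      · exact (hn i).2.le
      · exact (hm i).2.le
    have hdvd := lcm_sq_dvd_prod_of_sum_inv_eq_zero x (Sum.elim (fun _ => 1) fun _ => -1)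
      (by rintro (i | i) <;> simp) hx0 (by
        have he' : ∑ i, (1 : ℚ) / n i = ∑ i, (1 : ℚ) / m i := by
          apply Rat.cast_injective (α := ℝ)
          push_cast
          exact he
        simp only [Fintype.sum_sum_type, hx, Sum.elim_inl, Sum.elim_inr, he', ← sum_add_distrib]
        exact sum_eq_zero fun i _ => by ring)
    have hL0 : univ.lcm x ≠ 0 := by
      rw [Ne, Finset.lcm_eq_zero_iff]
      rintro ⟨i, -, hi⟩
      exact hx0 i hi
    have hLM : univ.lcm x ≤ M := by
      have h1 : (univ.lcm x) ^ 2 ≤ M ^ 2 :=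
        (Nat.le_of_dvd (prod_pos fun i _ => Nat.pos_of_ne_zero (hx0 i)) hdvd).trans <|
          (prod_le_pow_card _ _ _ fun i _ => hxle i).trans_eq (by
            rw [hM, ← pow_mul]; congr 1; simp; ring)
      exact (Nat.pow_le_pow_iff_left two_ne_zero).1 h1
    have hmem : ∀ i, x i ∈ (univ.lcm x).divisors := fun i =>
      Nat.mem_divisors.2 ⟨dvd_lcm (mem_univ i), hL0⟩
    rw [mem_biUnion]
    refine ⟨univ.lcm x, mem_Icc.2 ⟨Nat.pos_of_ne_zero hL0, hLM⟩, ?_⟩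
    rw [mem_product, Fintype.mem_piFinset, Fintype.mem_piFinset]
    exact ⟨fun i => hmem (Sum.inl i), fun i => hmem (Sum.inr i)⟩
  have hcard : (#S : ℝ) ≤ ∑ L ∈ Icc 1 M, (#L.divisors : ℝ) ^ (2 * k) := by
    have := (card_le_card hsub).trans card_biUnion_le
    simp only [card_product, Fintype.card_piFinset_const] at this
    have h2 : (#S : ℝ) ≤ _ := Nat.cast_le.2 this
    refine h2.trans_eq ?_
    push_cast
    exact sum_congr rfl fun L _ => by ring
  calc (#S : ℝ) ≤ ∑ L ∈ Icc 1 M, (#L.divisors : ℝ) ^ (2 * k) := hcard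
    _ ≤ ∑ L ∈ Icc 1 M, (C * (M : ℝ) ^ δ) ^ (2 * k) := by
        refine sum_le_sum fun L hL => ?_
        rw [mem_Icc] at hL
        refine pow_le_pow_left₀ (by positivity) ((hC L (by omega)).trans ?_) _
        have : (L : ℝ) ≤ M := by exact_mod_cast hL.2
        gcongr
    _ = C ^ (2 * k) * ((M : ℝ) * ((M : ℝ) ^ δ) ^ (2 * k)) := by
        rw [sum_const, Nat.card_Icc, nsmul_eq_mul, mul_pow]; simp; ring
    _ ≤ C ^ (2 * k) * (2 * N : ℝ) ^ ((k : ℝ) + ε) := by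
        gcongr
        have h2N : (1 : ℝ) ≤ 2 * N := by
          have : (1 : ℝ) ≤ N := by exact_mod_cast hN
          linarith
        rw [Real.rpow_add (by linarith), hM]
        push_cast
        rw [Real.rpow_natCast]
        gcongr
        rw [← Real.rpow_natCast (2 * N : ℝ) k, ← Real.rpow_mul (by linarith),
          ← Real.rpow_natCast, ← Real.rpow_mul (by linarith)]
        refine Real.rpow_le_rpow_of_exponent_le h2N (le_trans (le_of_eq ?_) hδε)
        push_cast; ring
    _ = _ := by rw [Real.mul_rpow (by norm_num) (by positivity)]; ring

lemma sum_range_one_div_one_add_sq_le (c : ℝ) (hc : 0 < c) (M : ℕ) :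
    ∑ j ∈ range M, 1 / (1 + (c * j) ^ 2) ≤ 1 + 2 / c := by
  have key : ∀ M : ℕ, ∑ j ∈ range (M + 1), 1 / (1 + (c * j) ^ 2)
      ≤ 1 + 2 / c - 2 / c / (1 + c * M) := by
    intro M
    induction M with
    | zero => simp
    | succ M ih =>
      rw [sum_range_succ]
      have hM : (0 : ℝ) ≤ c * M := by positivity
      have h1 : 1 / (1 + (c * ((M + 1 : ℕ) : ℝ)) ^ 2) ≤
          2 / ((1 + c * M) * (1 + c * ((M + 1 : ℕ) : ℝ))) := by
        rw [div_le_div_iff₀ (by positivity) (by positivity)]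
        push_cast
        nlinarith [sq_nonneg (c * M + c - 1), mul_nonneg hM hc.le]
      have h2 : 2 / ((1 + c * M) * (1 + c * ((M + 1 : ℕ) : ℝ))) =
          2 / c / (1 + c * M) - 2 / c / (1 + c * ((M + 1 : ℕ) : ℝ)) := by
        push_cast
        field_simp
        ring
      linarith
  cases M with
  | zero => simp; positivity
  | succ M =>
    refine (key M).trans ?_
    have : 0 ≤ 2 / c / (1 + c * M) := by positivity
    linarith

lemma sum_one_div_one_add_sq_le_of_nonneg {ι : Type*} (s : Finset ι) (d : ι → ℝ) (δ L : ℝ)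
    (hδ : 0 < δ) (hL : 0 < L) (hd : ∀ i ∈ s, 0 ≤ d i)
    (hsep : ∀ i ∈ s, ∀ j ∈ s, i ≠ j → δ ≤ |d i - d j|) :
    ∑ i ∈ s, 1 / (1 + (L * d i) ^ 2) ≤ 1 + 2 / (L * δ) := by
  classical
  have hinj : Set.InjOn (fun i => ⌊d i / δ⌋₊) s := by
    intro i hi j hj hij
    by_contra hne
    have h := hsep i hi j hj hne
    have h1 := Nat.floor_le (div_nonneg (hd i hi) hδ.le)
    have h2 := Nat.lt_floor_add_one (d i / δ)
    have h3 := Nat.floor_le (div_nonneg (hd j hj) hδ.le)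
    have h4 := Nat.lt_floor_add_one (d j / δ)
    simp only at hij
    rw [hij] at h1 h2
    have h5 : |d i / δ - d j / δ| < 1 := by rw [abs_lt]; constructor <;> linarith
    rw [← sub_div, abs_div, abs_of_pos hδ, div_lt_one hδ] at h5
    linarith
  obtain ⟨M, hM⟩ := (s.image fun i => ⌊d i / δ⌋₊).exists_nat_subset_range
  calc ∑ i ∈ s, 1 / (1 + (L * d i) ^ 2)
      ≤ ∑ i ∈ s, 1 / (1 + (L * δ * (⌊d i / δ⌋₊ : ℝ)) ^ 2) := by
        refine sum_le_sum fun i hi => ?_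
        have h1 := Nat.floor_le (div_nonneg (hd i hi) hδ.le)
        rw [le_div_iff₀ hδ] at h1
        have : L * δ * (⌊d i / δ⌋₊ : ℝ) ≤ L * d i := by
          rw [mul_assoc]; gcongr; linarith
        gcongr
    _ = ∑ j ∈ s.image fun i => ⌊d i / δ⌋₊, 1 / (1 + (L * δ * (j : ℝ)) ^ 2) := by
        rw [sum_image hinj]
    _ ≤ ∑ j ∈ range M, 1 / (1 + (L * δ * (j : ℝ)) ^ 2) :=
        sum_le_sum_of_subset_of_nonneg hM fun j _ _ => by positivity
    _ ≤ _ := sum_range_one_div_one_add_sq_le _ (by positivity) M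

lemma sum_one_div_one_add_sq_le (V : Finset ℝ) (δ L : ℝ) (hδ : 0 < δ) (hL : 0 < L)
    (hsep : ∀ x ∈ V, ∀ y ∈ V, x ≠ y → δ ≤ |x - y|) (t : ℝ) :
    ∑ x ∈ V, 1 / (1 + (L * (x - t)) ^ 2) ≤ 2 + 4 / (L * δ) := by
  rw [← sum_filter_add_sum_filter_not V (fun x => t ≤ x)]
  have h1 := sum_one_div_one_add_sq_le_of_nonneg {x ∈ V | t ≤ x} (fun x => x - t) δ L hδ hL
    (fun x hx => by have := (mem_filter.1 hx).2; linarith) (fun x hx y hy hne => by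
      simpa using hsep x (mem_filter.1 hx).1 y (mem_filter.1 hy).1 hne)
  have h2 := sum_one_div_one_add_sq_le_of_nonneg {x ∈ V | ¬ t ≤ x} (fun x => t - x) δ L hδ hL
    (fun x hx => by have := not_le.1 (mem_filter.1 hx).2; linarith) (fun x hx y hy hne => by
      have := hsep x (mem_filter.1 hx).1 y (mem_filter.1 hy).1 hne
      rw [abs_sub_comm] at this
      simpa using this)
  have h3 : ∀ x, (L * (t - x)) ^ 2 = (L * (x - t)) ^ 2 := fun x => by ring
  simp only [h3] at h2
  have : 4 / (L * δ) = 2 / (L * δ) + 2 / (L * δ) := by ring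
  linarith

open MeasureTheory

lemma norm_sq_sum_mul_gaussian (V : Finset ℝ) (a : ℝ → ℂ) (b t : ℝ) :
    ((‖∑ x ∈ V, a x * Complex.exp (Complex.I * x * t)‖ ^ 2 * Real.exp (-b * t ^ 2) : ℝ) : ℂ) =
      ∑ x ∈ V, ∑ y ∈ V, a x * (starRingEnd ℂ) (a y) *
        (Complex.exp (Complex.I * ((x - y : ℝ) : ℂ) * t) * Complex.exp (-(b : ℂ) * t ^ 2)) := by
  push_cast
  rw [← Complex.mul_conj', map_sum, sum_mul_sum, sum_mul]
  refine sum_congr rfl fun x _ => ?_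
  rw [sum_mul]
  refine sum_congr rfl fun y _ => ?_
  rw [map_mul, ← Complex.exp_conj]
  simp only [map_mul, Complex.conj_I, Complex.conj_ofReal]
  rw [mul_sub, sub_mul, Complex.exp_sub, neg_mul, neg_mul, Complex.exp_neg]
  field_simp

lemma integrable_exp_mul_gaussian (b u : ℝ) (hb : 0 < b) :
    Integrable fun t : ℝ =>
      Complex.exp (Complex.I * (u : ℂ) * t) * Complex.exp (-(b : ℂ) * t ^ 2) := by
  have := integrable_cexp_quadratic (b := (b : ℂ)) (by simpa using hb) (Complex.I * u) 0
  refine this.congr (Filter.Eventually.of_forall fun t => ?_)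
  simp only
  rw [← Complex.exp_add]
  congr 1
  ring

lemma integrable_norm_sq_sum_mul_gaussian (V : Finset ℝ) (a : ℝ → ℂ) (b : ℝ) (hb : 0 < b) :
    Integrable fun t : ℝ =>
      ‖∑ x ∈ V, a x * Complex.exp (Complex.I * x * t)‖ ^ 2 * Real.exp (-b * t ^ 2) := by
  have h : Integrable fun t : ℝ => ((‖∑ x ∈ V, a x * Complex.exp (Complex.I * x * t)‖ ^ 2 *
      Real.exp (-b * t ^ 2) : ℝ) : ℂ) := by
    simp only [norm_sq_sum_mul_gaussian]
    exact integrable_finsetSum _ fun x _ => integrable_finsetSum _ fun y _ =>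
      (integrable_exp_mul_gaussian b _ hb).const_mul _
  exact h.re

lemma norm_integral_exp_mul_gaussian_le (L u : ℝ) (hL : 0 < L) :
    ‖∫ t : ℝ, Complex.exp (Complex.I * (u : ℂ) * t) *
      Complex.exp (-((1 / L ^ 2 : ℝ) : ℂ) * t ^ 2)‖ ≤
      L * √Real.pi * (1 / (1 + (L / 2 * u) ^ 2)) := by
  have hb : (0 : ℝ) < 1 / L ^ 2 := by positivity
  rw [fourierIntegral_gaussian (by rwa [Complex.ofReal_re]), norm_mul]
  have h1 : (Real.pi / ((1 / L ^ 2 : ℝ) : ℂ)) ^ (1 / 2 : ℂ) = ((L * √Real.pi : ℝ) : ℂ) := by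
    have : (Real.pi / ((1 / L ^ 2 : ℝ) : ℂ)) = ((Real.pi * L ^ 2 : ℝ) : ℂ) := by
      push_cast; field_simp
    rw [this, show (1 / 2 : ℂ) = ((1 / 2 : ℝ) : ℂ) by push_cast; rfl,
      ← Complex.ofReal_cpow (by positivity), ← Real.sqrt_eq_rpow,
      Real.sqrt_mul Real.pi_pos.le, Real.sqrt_sq hL.le, mul_comm]
  have h2 : -(u : ℂ) ^ 2 / (4 * ((1 / L ^ 2 : ℝ) : ℂ)) = ((-(L / 2 * u) ^ 2 : ℝ) : ℂ) := by
    push_cast; field_simp; ring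
  rw [h1, h2, Complex.norm_real, ← Complex.ofReal_exp, Complex.norm_real,
    Real.norm_of_nonneg (by positivity), Real.norm_of_nonneg (Real.exp_pos _).le, Real.exp_neg,
    ← one_div]
  gcongr
  linarith [Real.add_one_le_exp ((L / 2 * u) ^ 2)]

/-- Gaussian mean value of an exponential sum with separated frequencies. -/
theorem integral_norm_sq_sum_mul_gaussian_le (V : Finset ℝ) (δ L : ℝ) (hδ : 0 < δ) (hL : 0 < L)
    (hsep : ∀ x ∈ V, ∀ y ∈ V, x ≠ y → δ ≤ |x - y|) (a : ℝ → ℂ) :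
    ∫ t : ℝ, ‖∑ x ∈ V, a x * Complex.exp (Complex.I * x * t)‖ ^ 2 *
      Real.exp (-(1 / L ^ 2) * t ^ 2) ≤
      √Real.pi * (2 * L + 8 / δ) * ∑ x ∈ V, ‖a x‖ ^ 2 := by
  set k : ℝ → ℝ := fun u => 1 / (1 + (L / 2 * u) ^ 2) with hk
  have hb : (0 : ℝ) < 1 / L ^ 2 := by positivity
  have hks : ∀ x y, k (x - y) = k (y - x) := fun x y => by simp only [hk]; ring_nf
  have hk0 : ∀ u, 0 ≤ k u := fun u => by simp only [hk]; positivity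
  have hsum : ∀ y, ∑ x ∈ V, k (x - y) ≤ 2 + 8 / (L * δ) := fun y => by
    refine (sum_one_div_one_add_sq_le V δ (L / 2) hδ (by positivity) hsep y).trans_eq ?_
    congr 1
    field_simp
    norm_num
  have hschur : ∑ x ∈ V, ∑ y ∈ V, ‖a x‖ * ‖a y‖ * k (x - y) ≤
      (2 + 8 / (L * δ)) * ∑ x ∈ V, ‖a x‖ ^ 2 := by
    calc ∑ x ∈ V, ∑ y ∈ V, ‖a x‖ * ‖a y‖ * k (x - y)
        ≤ ∑ x ∈ V, ∑ y ∈ V, (‖a x‖ ^ 2 * k (x - y) / 2 + ‖a y‖ ^ 2 * k (x - y) / 2) := by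
          refine sum_le_sum fun x _ => sum_le_sum fun y _ => ?_
          nlinarith [mul_nonneg (sq_nonneg (‖a x‖ - ‖a y‖)) (hk0 (x - y))]
      _ = ∑ y ∈ V, ∑ x ∈ V, ‖a y‖ ^ 2 * k (x - y) := by
          simp only [sum_add_distrib]
          rw [sum_comm (f := fun x y => ‖a y‖ ^ 2 * k (x - y) / 2), ← sum_add_distrib]
          refine sum_congr rfl fun y _ => ?_
          rw [← sum_add_distrib]
          refine sum_congr rfl fun x _ => ?_
          rw [hks y x]; ring
      _ ≤ ∑ y ∈ V, ‖a y‖ ^ 2 * (2 + 8 / (L * δ)) := by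
          refine sum_le_sum fun y _ => ?_
          rw [← mul_sum]
          gcongr
          exact hsum y
      _ = _ := by rw [← sum_mul, mul_comm]
  set f : ℝ → ℝ := fun t => ‖∑ x ∈ V, a x * Complex.exp (Complex.I * x * t)‖ ^ 2 *
      Real.exp (-(1 / L ^ 2) * t ^ 2) with hf
  calc ∫ t, f t ≤ ‖((∫ t, f t : ℝ) : ℂ)‖ := by
        rw [Complex.norm_real]; exact Real.le_norm_self _
    _ = ‖∑ x ∈ V, ∑ y ∈ V, a x * (starRingEnd ℂ) (a y) * ∫ t : ℝ,
        (Complex.exp (Complex.I * ((x - y : ℝ) : ℂ) * t) *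
          Complex.exp (-((1 / L ^ 2 : ℝ) : ℂ) * t ^ 2))‖ := by
        rw [← integral_complex_ofReal]
        simp only [hf, norm_sq_sum_mul_gaussian]
        rw [integral_finsetSum _ fun x _ => integrable_finsetSum _ fun y _ =>
          (integrable_exp_mul_gaussian _ _ hb).const_mul _]
        congr 1
        refine sum_congr rfl fun x _ => ?_
        rw [integral_finsetSum _ fun y _ =>
          (integrable_exp_mul_gaussian _ _ hb).const_mul _]
        refine sum_congr rfl fun y _ => ?_
        rw [integral_const_mul]
    _ ≤ ∑ x ∈ V, ∑ y ∈ V, ‖a x‖ * ‖a y‖ * (L * √Real.pi * k (x - y)) := by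
        refine norm_sum_le_of_le _ fun x _ => norm_sum_le_of_le _ fun y _ => ?_
        rw [norm_mul, norm_mul, RCLike.norm_conj]
        gcongr
        exact norm_integral_exp_mul_gaussian_le L (x - y) hL
    _ = L * √Real.pi * ∑ x ∈ V, ∑ y ∈ V, ‖a x‖ * ‖a y‖ * k (x - y) := by
        simp only [mul_sum]
        exact sum_congr rfl fun x _ => sum_congr rfl fun y _ => by ring
    _ ≤ L * √Real.pi * ((2 + 8 / (L * δ)) * ∑ x ∈ V, ‖a x‖ ^ 2) := by gcongr
    _ = _ := by field_simp

lemma sq_integral_le {f : ℝ → ℝ} (hf : Continuous f) (u h : ℝ) (hh : 0 < h) :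
    (∫ t in u..u + h, f t) ^ 2 ≤ h * ∫ t in u..u + h, f t ^ 2 := by
  set A := ∫ t in u..u + h, f t with hA
  have h0 : 0 ≤ ∫ t in u..u + h, (f t - A / h) ^ 2 :=
    intervalIntegral.integral_nonneg (by linarith) fun t _ => sq_nonneg _
  have h1 : ∫ t in u..u + h, (f t - A / h) ^ 2 =
      (∫ t in u..u + h, f t ^ 2) - 2 * (A / h) * A + (A / h) ^ 2 * h := by
    have : ∀ t, (f t - A / h) ^ 2 = f t ^ 2 - 2 * (A / h) * f t + (A / h) ^ 2 := fun t => by ring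
    simp only [this]
    have c1 : Continuous fun t => f t ^ 2 := by fun_prop
    have c2 : Continuous fun t => 2 * (A / h) * f t := by fun_prop
    have c3 : Continuous fun t => f t ^ 2 - 2 * (A / h) * f t := by fun_prop
    rw [intervalIntegral.integral_add (c3.intervalIntegrable _ _)
        (continuous_const.intervalIntegrable _ _),
      intervalIntegral.integral_sub (c1.intervalIntegrable _ _) (c2.intervalIntegrable _ _),
      intervalIntegral.integral_const_mul, intervalIntegral.integral_const, ← hA]
    simp [mul_comm]
  rw [h1] at h0
  have h2 : h * ((∫ t in u..u + h, f t ^ 2) - 2 * (A / h) * A + (A / h) ^ 2 * h) =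
      h * (∫ t in u..u + h, f t ^ 2) - A ^ 2 := by field_simp; ring
  nlinarith [mul_nonneg hh.le h0]

lemma half_le_norm_integral_exp (X x : ℝ) (hX : 0 < X) (hx : |x| ≤ X) :
    1 / 2 ≤ ‖X * ∫ t in (0 : ℝ)..1 / X, Complex.exp (Complex.I * x * t)‖ := by
  have hcont : Continuous fun t : ℝ => Complex.exp (Complex.I * x * t) := by fun_prop
  have hre : (∫ t in (0 : ℝ)..1 / X, Complex.exp (Complex.I * x * t)).re =
      ∫ t in (0 : ℝ)..1 / X, Real.cos (x * t) := by
    have := (Complex.reCLM).intervalIntegral_comp_comm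
      (hcont.intervalIntegrable (μ := volume) 0 (1 / X))
    rw [Complex.reCLM_apply] at this
    rw [← this]
    refine intervalIntegral.integral_congr fun t _ => ?_
    simp only [Complex.reCLM_apply]
    rw [show Complex.I * x * t = ((x * t : ℝ) : ℂ) * Complex.I by push_cast; ring,
      Complex.exp_ofReal_mul_I_re]
  have hlow : ∫ _ in (0 : ℝ)..1 / X, (1 / 2 : ℝ) ≤ ∫ t in (0 : ℝ)..1 / X, Real.cos (x * t) := by
    refine intervalIntegral.integral_mono_on (by positivity)
      (continuous_const.intervalIntegrable _ _)
      (Continuous.intervalIntegrable (by fun_prop) _ _) fun t ht => ?_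
    have h1 : |x * t| ≤ 1 := by
      rw [abs_mul, abs_of_nonneg ht.1]
      calc |x| * t ≤ X * (1 / X) := mul_le_mul hx ht.2 ht.1 hX.le
        _ = 1 := by field_simp
    have h2 := Real.one_sub_sq_div_two_le_cos (x := x * t)
    have h3 : (x * t) ^ 2 ≤ 1 := by rw [← sq_abs]; exact pow_le_one₀ (abs_nonneg _) h1
    linarith
  rw [intervalIntegral.integral_const, smul_eq_mul, sub_zero] at hlow
  rw [norm_mul, Complex.norm_real, Real.norm_of_nonneg hX.le]
  calc (1 / 2 : ℝ) = X * (1 / X * (1 / 2)) := by field_simp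
    _ ≤ X * _ := by
      gcongr
      exact (hlow.trans_eq hre.symm).trans (Complex.re_le_norm _)

/-- Dual form of the bilinear large sieve for separated frequencies and separated points. -/
theorem sum_norm_sq_sum_exp_le (V W : Finset ℝ) (δ₁ δ₂ X Y : ℝ) (hδ₁ : 0 < δ₁) (hδ₂ : 0 < δ₂)
    (hX : 0 < X) (hY : 0 < Y) (hXY : 1 ≤ X * Y)
    (hV : ∀ x ∈ V, ∀ y ∈ V, x ≠ y → δ₁ ≤ |x - y|) (hW : ∀ x ∈ W, ∀ y ∈ W, x ≠ y → δ₂ ≤ |x - y|)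
    (hVX : ∀ x ∈ V, |x| ≤ X) (hW0 : ∀ y ∈ W, 0 ≤ y) (hWY : ∀ y ∈ W, y ≤ Y) (a : ℝ → ℂ) :
    ∑ y ∈ W, ‖∑ x ∈ V, a x * Complex.exp (Complex.I * x * y)‖ ^ 2 ≤
      256 * Real.exp 4 * √Real.pi * ((X + 1 / δ₂) * (Y + 1 / δ₁)) * ∑ x ∈ V, ‖a x‖ ^ 2 := by
  set h := 1 / X with hh
  have hh0 : 0 < h := by positivity
  have hhY : h ≤ Y := by rw [hh, div_le_iff₀ hX]; linarith
  set c : ℝ → ℂ := fun x => X * ∫ t in (0 : ℝ)..h, Complex.exp (Complex.I * x * t) with hc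
  have hchalf : ∀ x ∈ V, 1 / 2 ≤ ‖c x‖ := fun x hx =>
    half_le_norm_integral_exp X x hX (hVX x hx)
  have hc0 : ∀ x ∈ V, c x ≠ 0 := fun x hx h0 => by
    have := hchalf x hx
    rw [h0, norm_zero] at this
    linarith
  set F : ℝ → ℂ := fun t => ∑ x ∈ V, a x / c x * Complex.exp (Complex.I * x * t) with hF
  have hFc : Continuous F := by
    rw [hF]
    exact continuous_finsetSum _ fun x _ => by fun_prop
  have hG : ∀ y : ℝ, ∑ x ∈ V, a x * Complex.exp (Complex.I * x * y) =
      X * ∫ t in y..y + h, F t := by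
    intro y
    simp only [hF]
    rw [intervalIntegral.integral_finsetSum fun x _ =>
      Continuous.intervalIntegrable (by fun_prop) _ _, mul_sum]
    refine sum_congr rfl fun x hx => ?_
    have hshift : ∫ t in y..y + h, Complex.exp (Complex.I * x * t) =
        Complex.exp (Complex.I * x * y) * ∫ t in (0 : ℝ)..h, Complex.exp (Complex.I * x * t) := by
      rw [← intervalIntegral.integral_const_mul]
      have := intervalIntegral.integral_comp_add_left
        (fun t : ℝ => Complex.exp (Complex.I * x * t)) y (a := 0) (b := h)
      rw [add_zero] at this
      rw [← this]
      refine intervalIntegral.integral_congr fun t _ => ?_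
      rw [← Complex.exp_add]
      congr 1
      push_cast
      ring
    rw [intervalIntegral.integral_const_mul, hshift]
    have := hc0 x hx
    calc a x * Complex.exp (Complex.I * x * y)
        = a x / c x * Complex.exp (Complex.I * x * y) * c x := by field_simp
      _ = _ := by simp only [hc]; ring
  have hcs : ∀ y : ℝ, ‖∑ x ∈ V, a x * Complex.exp (Complex.I * x * y)‖ ^ 2 ≤
      X * ∫ t, (Set.Ioc y (y + h)).indicator (fun t => ‖F t‖ ^ 2) t := by
    intro y
    rw [hG y, norm_mul, Complex.norm_real, Real.norm_of_nonneg hX.le, mul_pow]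
    have h1 : ‖∫ t in y..y + h, F t‖ ^ 2 ≤ (∫ t in y..y + h, ‖F t‖) ^ 2 := by
      gcongr
      exact intervalIntegral.norm_integral_le_integral_norm (by linarith)
    have h2 := sq_integral_le hFc.norm y h hh0
    rw [integral_indicator measurableSet_Ioc,
      ← intervalIntegral.integral_of_le (by linarith : y ≤ y + h)]
    calc X ^ 2 * ‖∫ t in y..y + h, F t‖ ^ 2
        ≤ X ^ 2 * (h * ∫ t in y..y + h, ‖F t‖ ^ 2) := by gcongr; exact h1.trans h2
      _ = _ := by rw [hh]; field_simp
  set B : ℝ := 2 * (2 + 4 / (X * δ₂)) * Real.exp 4 with hB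
  have hpt : ∀ t : ℝ, ∑ y ∈ W, (Set.Ioc y (y + h)).indicator (fun t => ‖F t‖ ^ 2) t ≤
      B * (‖F t‖ ^ 2 * Real.exp (-(1 / Y ^ 2) * t ^ 2)) := by
    intro t
    by_cases ht : 0 ≤ t ∧ t ≤ 2 * Y
    · have hw : 1 ≤ Real.exp 4 * Real.exp (-(1 / Y ^ 2) * t ^ 2) := by
        rw [← Real.exp_add, Real.one_le_exp_iff]
        have : t ^ 2 ≤ (2 * Y) ^ 2 := pow_le_pow_left₀ ht.1 ht.2 2
        have : 1 / Y ^ 2 * t ^ 2 ≤ 1 / Y ^ 2 * (2 * Y) ^ 2 := by gcongr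
        have h4 : 1 / Y ^ 2 * (2 * Y) ^ 2 = 4 := by field_simp; norm_num
        linarith
      have hcount := sum_one_div_one_add_sq_le W δ₂ X hδ₂ hX hW t
      calc ∑ y ∈ W, (Set.Ioc y (y + h)).indicator (fun t => ‖F t‖ ^ 2) t
          ≤ ∑ y ∈ W, 2 * (1 / (1 + (X * (y - t)) ^ 2)) * ‖F t‖ ^ 2 := by
            refine sum_le_sum fun y _ => ?_
            by_cases hy : t ∈ Set.Ioc y (y + h)
            · rw [Set.indicator_of_mem hy]
              have h1 : |X * (y - t)| ≤ 1 := by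
                rw [abs_mul, abs_of_pos hX, abs_sub_comm, abs_of_nonneg (by linarith [hy.1])]
                calc X * (t - y) ≤ X * h := by gcongr; linarith [hy.2]
                  _ = 1 := by rw [hh]; field_simp
              have h2 : (X * (y - t)) ^ 2 ≤ 1 := by
                rw [← sq_abs]; exact pow_le_one₀ (abs_nonneg _) h1
              have h3 : 1 ≤ 2 * (1 / (1 + (X * (y - t)) ^ 2)) := by
                rw [mul_one_div, le_div_iff₀ (by positivity)]; linarith
              exact le_mul_of_one_le_left (by positivity) h3
            · rw [Set.indicator_of_notMem hy]; positivity
        _ = 2 * (∑ y ∈ W, 1 / (1 + (X * (y - t)) ^ 2)) * ‖F t‖ ^ 2 := by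
            rw [mul_sum, sum_mul]
        _ ≤ 2 * (2 + 4 / (X * δ₂)) * ‖F t‖ ^ 2 := by gcongr
        _ ≤ 2 * (2 + 4 / (X * δ₂)) * ‖F t‖ ^ 2 *
            (Real.exp 4 * Real.exp (-(1 / Y ^ 2) * t ^ 2)) :=
            le_mul_of_one_le_right (by positivity) hw
        _ = _ := by rw [hB]; ring
    · rw [sum_eq_zero fun y hy => Set.indicator_of_notMem (fun hyt => ht
        ⟨(hW0 y hy).trans hyt.1.le, by linarith [hyt.2, hWY y hy]⟩) _]
      positivity
  have hFint : ∀ y ∈ W, Integrable ((Set.Ioc y (y + h)).indicator fun t => ‖F t‖ ^ 2) :=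
    fun y _ => (integrable_indicator_iff measurableSet_Ioc).2
      ((hFc.norm.pow 2).integrableOn_Ioc)
  calc ∑ y ∈ W, ‖∑ x ∈ V, a x * Complex.exp (Complex.I * x * y)‖ ^ 2
      ≤ ∑ y ∈ W, X * ∫ t, (Set.Ioc y (y + h)).indicator (fun t => ‖F t‖ ^ 2) t :=
        sum_le_sum fun y _ => hcs y
    _ = X * ∫ t, ∑ y ∈ W, (Set.Ioc y (y + h)).indicator (fun t => ‖F t‖ ^ 2) t := by
        rw [integral_finsetSum _ hFint, mul_sum]
    _ ≤ X * ∫ t, B * (‖F t‖ ^ 2 * Real.exp (-(1 / Y ^ 2) * t ^ 2)) := by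
        refine mul_le_mul_of_nonneg_left (integral_mono (integrable_finsetSum _ hFint) ?_ hpt) hX.le
        exact (integrable_norm_sq_sum_mul_gaussian V _ _ (by positivity)).const_mul _
    _ ≤ X * (B * (√Real.pi * (2 * Y + 8 / δ₁) * ∑ x ∈ V, ‖a x / c x‖ ^ 2)) := by
        rw [integral_const_mul]
        gcongr
        exact integral_norm_sq_sum_mul_gaussian_le V δ₁ Y hδ₁ hY hV _
    _ ≤ X * (B * (√Real.pi * (2 * Y + 8 / δ₁) * ∑ x ∈ V, 4 * ‖a x‖ ^ 2)) := by
        gcongr with x hx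
        rw [norm_div, div_pow, div_le_iff₀ (by have := hchalf x hx; positivity)]
        have h1 : (1 / 2 : ℝ) ^ 2 ≤ ‖c x‖ ^ 2 := pow_le_pow_left₀ (by norm_num) (hchalf x hx) 2
        nlinarith [sq_nonneg ‖a x‖]
    _ = Real.exp 4 * √Real.pi * ((16 * X + 32 / δ₂) * (2 * Y + 8 / δ₁)) *
          ∑ x ∈ V, ‖a x‖ ^ 2 := by
        rw [← mul_sum, hB]; field_simp; ring
    _ ≤ Real.exp 4 * √Real.pi * ((32 * (X + 1 / δ₂)) * (8 * (Y + 1 / δ₁))) *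
          ∑ x ∈ V, ‖a x‖ ^ 2 := by
        gcongr
        · rw [mul_add, mul_one_div]; linarith
        · rw [mul_add, mul_one_div]; linarith
    _ = _ := by ring

theorem norm_sq_bilinear_exp_le (V W : Finset ℝ) (δ₁ δ₂ X Y : ℝ) (hδ₁ : 0 < δ₁) (hδ₂ : 0 < δ₂)
    (hX : 0 < X) (hY : 0 < Y) (hXY : 1 ≤ X * Y)
    (hV : ∀ x ∈ V, ∀ y ∈ V, x ≠ y → δ₁ ≤ |x - y|) (hW : ∀ x ∈ W, ∀ y ∈ W, x ≠ y → δ₂ ≤ |x - y|)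
    (hVX : ∀ x ∈ V, |x| ≤ X) (hW0 : ∀ y ∈ W, 0 ≤ y) (hWY : ∀ y ∈ W, y ≤ Y) (a b : ℝ → ℂ) :
    ‖∑ x ∈ V, ∑ y ∈ W, a x * b y * Complex.exp (Complex.I * x * y)‖ ^ 2 ≤
      256 * Real.exp 4 * √Real.pi * ((X + 1 / δ₂) * (Y + 1 / δ₁)) * (∑ x ∈ V, ‖a x‖ ^ 2) *
        ∑ y ∈ W, ‖b y‖ ^ 2 := by
  have h1 : ∑ x ∈ V, ∑ y ∈ W, a x * b y * Complex.exp (Complex.I * x * y) =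
      ∑ y ∈ W, b y * ∑ x ∈ V, a x * Complex.exp (Complex.I * x * y) := by
    rw [sum_comm]
    refine sum_congr rfl fun y _ => ?_
    rw [mul_sum]
    exact sum_congr rfl fun x _ => by ring
  rw [h1]
  calc _ ≤ (∑ y ∈ W, ‖b y‖ * ‖∑ x ∈ V, a x * Complex.exp (Complex.I * x * y)‖) ^ 2 := by
        gcongr
        exact norm_sum_le_of_le _ fun y _ => (norm_mul _ _).le
    _ ≤ (∑ y ∈ W, ‖b y‖ ^ 2) *
        ∑ y ∈ W, ‖∑ x ∈ V, a x * Complex.exp (Complex.I * x * y)‖ ^ 2 :=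
        sum_mul_sq_le_sq_mul_sq _ _ _
    _ ≤ _ := by
        rw [mul_comm]
        gcongr
        exact sum_norm_sq_sum_exp_le V W δ₁ δ₂ X Y hδ₁ hδ₂ hX hY hXY hV hW hVX hW0 hWY a

lemma sum_image_card_fiber_sq {ι : Type*} (s : Finset ι) (f : ι → ℝ) :
    ∑ v ∈ s.image f, (#{i ∈ s | f i = v} : ℝ) ^ 2 = #{q ∈ s ×ˢ s | f q.1 = f q.2} := by
  rw [card_eq_sum_card_fiberwise (f := fun q => f q.1) (t := s.image f) fun q hq => by
    have hq' := mem_filter.1 (mem_coe.1 hq)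
    exact mem_coe.2 (mem_image_of_mem f (mem_product.1 hq'.1).1)]
  push_cast
  refine sum_congr rfl fun v _ => ?_
  rw [sq, ← Nat.cast_mul, ← card_product]
  congr 2
  ext ⟨i, j⟩
  simp only [mem_product, mem_filter]
  constructor
  · rintro ⟨⟨hi, rfl⟩, hj, h⟩
    exact ⟨⟨⟨hi, hj⟩, h.symm⟩, rfl⟩
  · rintro ⟨⟨⟨hi, hj⟩, h⟩, rfl⟩
    exact ⟨⟨hi, rfl⟩, hj, h.symm⟩

lemma sum_image_norm_sq_sum_fiber_le {ι : Type*} (s : Finset ι) (f : ι → ℝ) (η : ι → ℂ)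
    (hη : ∀ i, ‖η i‖ ≤ 1) :
    ∑ v ∈ s.image f, ‖∑ i ∈ s with f i = v, η i‖ ^ 2 ≤ #{q ∈ s ×ˢ s | f q.1 = f q.2} := by
  rw [← sum_image_card_fiber_sq]
  gcongr with v _
  refine (norm_sum_le_of_le _ fun i _ => hη i).trans_eq ?_
  simp

/-- The double large sieve for families whose distinct values are separated. -/
theorem norm_sq_bilinear_exp_le_card {ι κ : Type*} (s : Finset ι) (t : Finset κ) (f : ι → ℝ)
    (g : κ → ℝ) (η : ι → ℂ) (θ : κ → ℂ) (hη : ∀ i, ‖η i‖ ≤ 1) (hθ : ∀ j, ‖θ j‖ ≤ 1)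
    (δ₁ δ₂ X Y : ℝ) (hδ₁ : 0 < δ₁) (hδ₂ : 0 < δ₂) (hX : 0 < X) (hY : 0 < Y) (hXY : 1 ≤ X * Y)
    (hf : ∀ i ∈ s, ∀ j ∈ s, f i ≠ f j → δ₁ ≤ |f i - f j|)
    (hg : ∀ i ∈ t, ∀ j ∈ t, g i ≠ g j → δ₂ ≤ |g i - g j|)
    (hfX : ∀ i ∈ s, |f i| ≤ X) (hg0 : ∀ j ∈ t, 0 ≤ g j) (hgY : ∀ j ∈ t, g j ≤ Y) :
    ‖∑ i ∈ s, ∑ j ∈ t, η i * θ j * Complex.exp (Complex.I * f i * g j)‖ ^ 2 ≤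
      256 * Real.exp 4 * √Real.pi * ((X + 1 / δ₂) * (Y + 1 / δ₁)) *
        #{q ∈ s ×ˢ s | f q.1 = f q.2} * #{q ∈ t ×ˢ t | g q.1 = g q.2} := by
  have hgroup : ∑ i ∈ s, ∑ j ∈ t, η i * θ j * Complex.exp (Complex.I * f i * g j) =
      ∑ x ∈ s.image f, ∑ y ∈ t.image g, (∑ i ∈ s with f i = x, η i) *
        (∑ j ∈ t with g j = y, θ j) * Complex.exp (Complex.I * x * y) := by
    rw [← sum_fiberwise_of_maps_to (t := s.image f) fun i hi => mem_image_of_mem f hi]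
    refine sum_congr rfl fun x _ => ?_
    rw [sum_comm, ← sum_fiberwise_of_maps_to (t := t.image g) fun j hj => mem_image_of_mem g hj]
    refine sum_congr rfl fun y _ => ?_
    rw [sum_mul_sum, sum_mul, sum_comm]
    refine sum_congr rfl fun i hi => ?_
    rw [sum_mul]
    refine sum_congr rfl fun j hj => ?_
    rw [(mem_filter.1 hi).2, (mem_filter.1 hj).2]
  rw [hgroup]
  refine (norm_sq_bilinear_exp_le (s.image f) (t.image g) δ₁ δ₂ X Y hδ₁ hδ₂ hX hY hXY ?_ ?_ ?_ ?_ ?_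
    _ _).trans ?_
  · simp only [forall_mem_image]
    exact hf
  · simp only [forall_mem_image]
    exact hg
  · simpa only [forall_mem_image] using hfX
  · simpa only [forall_mem_image] using hg0
  · simpa only [forall_mem_image] using hgY
  · gcongr
    · exact sum_image_norm_sq_sum_fiber_le s f η hη
    · exact sum_image_norm_sq_sum_fiber_le t g θ hθ

lemma exists_sum_one_div_mul_prod {ι : Type*} [Fintype ι] (n : ι → ℕ) (hn : ∀ i, n i ≠ 0) :
    ∃ A : ℤ, (∑ i, (1 : ℝ) / n i) * ∏ i, (n i : ℝ) = A := by
  classical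
  refine ⟨∑ i, ∏ j ∈ univ.erase i, (n j : ℤ), ?_⟩
  push_cast
  rw [sum_mul]
  refine sum_congr rfl fun i _ => ?_
  have : (n i : ℝ) ≠ 0 := by exact_mod_cast hn i
  rw [← mul_prod_erase univ (fun j => (n j : ℝ)) (mem_univ i)]
  field_simp

lemma one_div_pow_le_abs_sum_one_div_sub (k N : ℕ) (hN : 0 < N) (n m : Fin k → ℕ)
    (hn : n ∈ Fintype.piFinset fun _ : Fin k => Ico N (2 * N))
    (hm : m ∈ Fintype.piFinset fun _ : Fin k => Ico N (2 * N))
    (hne : ∑ i, (1 : ℝ) / n i ≠ ∑ i, (1 : ℝ) / m i) :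
    1 / (2 * N : ℝ) ^ (2 * k) ≤ |∑ i, (1 : ℝ) / n i - ∑ i, (1 : ℝ) / m i| := by
  have aux : ∀ n ∈ Fintype.piFinset fun _ : Fin k => Ico N (2 * N),
      (∀ i, n i ≠ 0) ∧ 0 < ∏ i, (n i : ℝ) ∧ ∏ i, (n i : ℝ) ≤ (2 * N : ℝ) ^ k := by
    intro n hn
    simp only [Fintype.mem_piFinset, mem_Ico] at hn
    refine ⟨fun i => by have := hn i; omega, prod_pos fun i _ => ?_, ?_⟩
    · have := hn i
      exact_mod_cast (by omega : 0 < n i)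
    · refine (prod_le_prod (fun i _ => Nat.cast_nonneg _) fun i _ =>
        (by exact_mod_cast (hn i).2.le : (n i : ℝ) ≤ 2 * N)).trans_eq ?_
      simp
  obtain ⟨hn0, hnp, hnle⟩ := aux n hn
  obtain ⟨hm0, hmp, hmle⟩ := aux m hm
  obtain ⟨A, hA⟩ := exists_sum_one_div_mul_prod n hn0
  obtain ⟨B, hB⟩ := exists_sum_one_div_mul_prod m hm0
  set P := ∏ i, (n i : ℝ)
  set Q := ∏ i, (m i : ℝ)
  set a := ∑ i, (1 : ℝ) / n i
  set b := ∑ i, (1 : ℝ) / m i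
  obtain ⟨D, hD⟩ : ∃ D : ℤ, (a - b) * (P * Q) = D := by
    obtain ⟨P', hP'⟩ : ∃ P' : ℤ, P = P' := ⟨∏ i, (n i : ℤ), by push_cast; rfl⟩
    obtain ⟨Q', hQ'⟩ : ∃ Q' : ℤ, Q = Q' := ⟨∏ i, (m i : ℤ), by push_cast; rfl⟩
    refine ⟨A * Q' - B * P', ?_⟩
    push_cast
    rw [← hA, ← hB, ← hP', ← hQ']
    ring
  have hD0 : D ≠ 0 := by
    rintro rfl
    rw [Int.cast_zero, mul_eq_zero] at hD
    rcases hD with hD | hD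
    · exact hne (sub_eq_zero.1 hD)
    · exact (mul_pos hnp hmp).ne' hD
  have h1 : (1 : ℝ) ≤ |a - b| * (P * Q) := by
    rw [← abs_of_pos (mul_pos hnp hmp), ← abs_mul, hD]
    exact_mod_cast Int.one_le_abs hD0
  have hN' : (0 : ℝ) < N := by exact_mod_cast hN
  rw [div_le_iff₀ (by positivity)]
  calc (1 : ℝ) ≤ |a - b| * (P * Q) := h1
    _ ≤ |a - b| * ((2 * N : ℝ) ^ k * (2 * N : ℝ) ^ k) := by gcongr
    _ = _ := by ring

lemma sum_one_div_le (k N : ℕ) (hN : 0 < N) (n : Fin k → ℕ)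
    (hn : n ∈ Fintype.piFinset fun _ : Fin k => Ico N (2 * N)) :
    ∑ i, (1 : ℝ) / n i ≤ k / N := by
  simp only [Fintype.mem_piFinset, mem_Ico] at hn
  have hN' : (0 : ℝ) < N := by exact_mod_cast hN
  calc ∑ i, (1 : ℝ) / n i ≤ ∑ _i : Fin k, (1 : ℝ) / N := by
        refine sum_le_sum fun i _ => ?_
        have : (N : ℝ) ≤ n i := by exact_mod_cast (hn i).1
        gcongr
    _ = _ := by simp [div_eq_mul_inv]

/-- Hölder's inequality in one variable, with the moment opened and absolute values absorbed
into bounded coefficients. -/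
theorem exists_norm_pow_le_of_moment {ι κ : Type*} (A : Finset ι) (B : Finset κ) (u : ι → ℝ)
    (w : κ → ℝ) (c : ι → ℂ) (k : ℕ) (hk : 0 < k) :
    ∃ θ : κ → ℂ, (∀ m, ‖θ m‖ ≤ 1) ∧
      ‖∑ m ∈ B, ∑ n ∈ A, c n * Complex.exp (Complex.I * u n * w m)‖ ^ k ≤
        (#B : ℝ) ^ (k - 1) * ‖∑ m ∈ B, ∑ p ∈ Fintype.piFinset fun _ : Fin k => A,
          θ m * (∏ i, c (p i)) * Complex.exp (Complex.I * (∑ i, u (p i) : ℝ) * w m)‖ := by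
  set S : κ → ℂ := fun m => ∑ n ∈ A, c n * Complex.exp (Complex.I * u n * w m) with hS
  have hpow : ∀ m, S m ^ k = ∑ p ∈ Fintype.piFinset fun _ : Fin k => A,
      (∏ i, c (p i)) * Complex.exp (Complex.I * (∑ i, u (p i) : ℝ) * w m) := by
    intro m
    have := prod_univ_sum (fun _ : Fin k => A)
      fun _ n => c n * Complex.exp (Complex.I * u n * w m)
    rw [prod_const, card_univ, Fintype.card_fin] at this
    simp only [hS]
    rw [this]
    refine sum_congr rfl fun p _ => ?_
    rw [prod_mul_distrib, ← Complex.exp_sum]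
    congr 2
    push_cast
    rw [mul_sum, sum_mul]
  refine ⟨fun m => (starRingEnd ℂ (S m ^ k)) / (‖S m ^ k‖ : ℂ), fun m => ?_, ?_⟩
  · rw [norm_div, RCLike.norm_conj, Complex.norm_real, norm_norm]
    exact div_self_le_one _
  have hθ : ∀ m, (starRingEnd ℂ (S m ^ k)) / (‖S m ^ k‖ : ℂ) * S m ^ k = ((‖S m‖ ^ k : ℝ) : ℂ) := by
    intro m
    rw [div_mul_eq_mul_div, Complex.conj_mul', sq, mul_self_div_self, norm_pow]
  have hsum : ∑ m ∈ B, ∑ p ∈ Fintype.piFinset fun _ : Fin k => A,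
      (starRingEnd ℂ (S m ^ k)) / (‖S m ^ k‖ : ℂ) * (∏ i, c (p i)) *
        Complex.exp (Complex.I * (∑ i, u (p i) : ℝ) * w m) =
      ((∑ m ∈ B, ‖S m‖ ^ k : ℝ) : ℂ) := by
    rw [Complex.ofReal_sum]
    refine sum_congr rfl fun m _ => ?_
    rw [← hθ m]
    conv_rhs => arg 2; rw [hpow m]
    rw [mul_sum]
    exact sum_congr rfl fun p _ => by ring
  rw [hsum, Complex.norm_real, Real.norm_of_nonneg (sum_nonneg fun _ _ => by positivity)]
  obtain ⟨k, rfl⟩ := Nat.exists_eq_succ_of_ne_zero hk.ne'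
  calc ‖∑ m ∈ B, S m‖ ^ (k + 1) ≤ (∑ m ∈ B, ‖S m‖) ^ (k + 1) := by
        gcongr; exact norm_sum_le _ _
    _ ≤ _ := by simpa using pow_sum_le_card_mul_sum_pow (s := B) (fun m _ => norm_nonneg (S m)) k

lemma sq_mul_add_pow_le (T N : ℝ) (hT : 0 < T) (hN : 0 < N) (k : ℕ) (hk : 0 < k) :
    (T * N + N ^ (2 * k)) ^ 2 ≤
      2 * T * N ^ 2 * N ^ (2 * k) * (T / N ^ (2 * k) + 1 / T * N ^ (2 * (k - 1))) := by
  obtain ⟨j, rfl⟩ := Nat.exists_eq_succ_of_ne_zero hk.ne'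
  have : 2 * T * N ^ 2 * N ^ (2 * (j + 1)) *
      (T / N ^ (2 * (j + 1)) + 1 / T * N ^ (2 * (j + 1 - 1))) =
      2 * ((T * N) ^ 2 + (N ^ (2 * (j + 1))) ^ 2) := by
    rw [Nat.add_sub_cancel, show 2 * (j + 1) = 2 * j + 2 by ring, pow_add]
    field_simp
  rw [Nat.succ_eq_add_one, this]
  nlinarith [sq_nonneg (T * N - N ^ (2 * (j + 1)))]

lemma large_sieve_factor_le (k1 k2 : ℕ) (N1 N2 T : ℝ) (hN1 : 0 < N1) (hN2 : 0 < N2) (hT : 0 < T) :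
    (T * (N1 * N2) * k1 / N1 + 1 / (1 / (2 * N2) ^ (2 * k2))) *
      (k2 / N2 + 1 / (T * (N1 * N2) * (1 / (2 * N1) ^ (2 * k1)))) ≤
      ((k1 + 4 ^ k2) * (k2 + 4 ^ k1)) *
        ((T * N2 + N2 ^ (2 * k2)) * (T * N1 + N1 ^ (2 * k1)) / (T * (N1 * N2))) := by
  have h4 : ∀ (N : ℝ) (k : ℕ), (2 * N) ^ (2 * k) = 4 ^ k * N ^ (2 * k) := fun N k => by
    rw [mul_pow, pow_mul]; norm_num
  have h1 : T * (N1 * N2) * k1 / N1 + 1 / (1 / (2 * N2) ^ (2 * k2)) ≤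
      (k1 + 4 ^ k2) * (T * N2 + N2 ^ (2 * k2)) := by
    rw [h4, one_div_one_div]
    have : T * (N1 * N2) * k1 / N1 = k1 * (T * N2) := by field_simp
    rw [this]
    have h1 : 0 ≤ (k1 : ℝ) * N2 ^ (2 * k2) := by positivity
    have h2 : 0 ≤ 4 ^ k2 * (T * N2) := by positivity
    linarith
  have h2 : k2 / N2 + 1 / (T * (N1 * N2) * (1 / (2 * N1) ^ (2 * k1))) ≤
      (k2 + 4 ^ k1) * (T * N1 + N1 ^ (2 * k1)) / (T * (N1 * N2)) := by
    rw [h4, le_div_iff₀ (by positivity)]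
    have : (k2 / N2 + 1 / (T * (N1 * N2) * (1 / (4 ^ k1 * N1 ^ (2 * k1))))) * (T * (N1 * N2)) =
        k2 * (T * N1) + 4 ^ k1 * N1 ^ (2 * k1) := by field_simp
    rw [this]
    have h1 : 0 ≤ (k2 : ℝ) * N1 ^ (2 * k1) := by positivity
    have h2 : 0 ≤ 4 ^ k1 * (T * N1) := by positivity
    linarith
  refine (mul_le_mul h1 h2 (by positivity) (by positivity)).trans_eq ?_
  ring

/-- The bilinear form over sums of reciprocals, bounded by the double large sieve and the count of
coincidences among such sums. -/
theorem exists_norm_bilinear_reciprocal_le (k1 k2 : ℕ) (hk1 : 0 < k1) (hk2 : 0 < k2) (ε : ℝ)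
    (hε : 0 < ε) :
    ∃ K : ℝ, 1 ≤ K ∧ ∀ (N1 N2 : ℕ), 0 < N1 → 0 < N2 → ∀ ξ : ℝ, (N1 : ℝ) * (N2 : ℝ) < |ξ| →
      ∀ (η : (Fin k1 → ℕ) → ℂ) (θ : (Fin k2 → ℕ) → ℂ), (∀ p, ‖η p‖ ≤ 1) → (∀ q, ‖θ q‖ ≤ 1) →
      ‖∑ p ∈ Fintype.piFinset fun _ : Fin k1 => Ico N1 (2 * N1),
          ∑ q ∈ Fintype.piFinset fun _ : Fin k2 => Ico N2 (2 * N2),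
            η p * θ q * Complex.exp (Complex.I * (∑ i, ξ / p i : ℝ) * (∑ i, 1 / q i : ℝ))‖ ^ 4 ≤
        K * (((|ξ| / ((N1 : ℝ) * (N2 : ℝ))) / (N1 : ℝ) ^ (2 * k1) +
                  ((N1 : ℝ) * (N2 : ℝ) / |ξ|) * (N1 : ℝ) ^ (2 * (k1 - 1))) *
                ((|ξ| / ((N1 : ℝ) * (N2 : ℝ))) / (N2 : ℝ) ^ (2 * k2) +
                  ((N1 : ℝ) * (N2 : ℝ) / |ξ|) * (N2 : ℝ) ^ (2 * (k2 - 1)))) *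
          ((N1 : ℝ) ^ (2 * k1) * ((N1 : ℝ) ^ ((k1 : ℝ) + ε)) ^ 2) *
          ((N2 : ℝ) ^ (2 * k2) * ((N2 : ℝ) ^ ((k2 : ℝ) + ε)) ^ 2) := by
  obtain ⟨C1, hC1, hJ1⟩ := exists_card_sum_inv_eq_le k1 ε hε
  obtain ⟨C2, hC2, hJ2⟩ := exists_card_sum_inv_eq_le k2 ε hε
  set E : ℝ := 256 * Real.exp 4 * √Real.pi with hE
  set D : ℝ := (k1 + 4 ^ k2) * (k2 + 4 ^ k1) with hD
  have hE1 : 1 ≤ E := by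
    have h1 : 1 ≤ Real.exp 4 := Real.one_le_exp (by norm_num)
    have h2 : 1 ≤ √Real.pi := Real.one_le_sqrt.2 (by linarith [Real.pi_gt_three])
    exact one_le_mul_of_one_le_of_one_le (by linarith) h2
  have hD1 : 1 ≤ D := by
    have h1 : (1 : ℝ) ≤ 4 ^ k2 := one_le_pow₀ (by norm_num)
    have h2 : (1 : ℝ) ≤ 4 ^ k1 := one_le_pow₀ (by norm_num)
    have h3 : (0 : ℝ) ≤ k1 := by positivity
    have h4 : (0 : ℝ) ≤ k2 := by positivity
    exact one_le_mul_of_one_le_of_one_le (by linarith) (by linarith)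
  refine ⟨4 * (E * D * C1 * C2) ^ 2, ?_, ?_⟩
  · have : 1 ≤ E * D * C1 * C2 :=
      one_le_mul_of_one_le_of_one_le (one_le_mul_of_one_le_of_one_le
        (one_le_mul_of_one_le_of_one_le hE1 hD1) hC1) hC2
    linarith [one_le_pow₀ (n := 2) this]
  intro N1 N2 hN1 hN2 ξ hξ η θ hη hθ
  have hn1 : (0 : ℝ) < N1 := by exact_mod_cast hN1
  have hn2 : (0 : ℝ) < N2 := by exact_mod_cast hN2
  have hk1' : (1 : ℝ) ≤ k1 := by exact_mod_cast hk1
  have hk2' : (1 : ℝ) ≤ k2 := by exact_mod_cast hk2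
  have hξ0 : 0 < |ξ| := (by positivity : 0 < (N1 : ℝ) * N2).trans hξ
  have hξne : ξ ≠ 0 := abs_pos.1 hξ0
  set T : ℝ := |ξ| / (N1 * N2) with hT
  have hT0 : 0 < T := by positivity
  have hξT : |ξ| = T * (N1 * N2) := by rw [hT]; field_simp
  have hinv : (N1 : ℝ) * N2 / |ξ| = 1 / T := by rw [hT, one_div_div]
  rw [hinv]
  have hfac : ∀ p : Fin k1 → ℕ, ∑ i, ξ / (p i : ℝ) = ξ * ∑ i, (1 : ℝ) / p i := fun p => by
    rw [mul_sum]
    exact sum_congr rfl fun i _ => by ring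
  have hbil := norm_sq_bilinear_exp_le_card
    (Fintype.piFinset fun _ : Fin k1 => Ico N1 (2 * N1))
    (Fintype.piFinset fun _ : Fin k2 => Ico N2 (2 * N2))
    (fun p => ∑ i, ξ / (p i : ℝ)) (fun q => ∑ i, 1 / (q i : ℝ)) η θ hη hθ
    (|ξ| * (1 / (2 * N1 : ℝ) ^ (2 * k1))) (1 / (2 * N2 : ℝ) ^ (2 * k2))
    (|ξ| * k1 / N1) (k2 / N2) (by positivity) (by positivity) (by positivity) (by positivity)
    (by
      have : |ξ| * k1 / N1 * (k2 / N2) = T * (k1 * k2) := by rw [hT]; field_simp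
      rw [this]
      have : 1 ≤ T := by rw [hT, one_le_div (by positivity)]; exact hξ.le
      exact one_le_mul_of_one_le_of_one_le this (one_le_mul_of_one_le_of_one_le hk1' hk2'))
    (fun p hp q hq hne => by
      simp only [hfac] at hne ⊢
      rw [← mul_sub, abs_mul]
      gcongr
      exact one_div_pow_le_abs_sum_one_div_sub k1 N1 hN1 p q hp hq fun h => hne (by rw [h]))
    (fun p hp q hq hne => one_div_pow_le_abs_sum_one_div_sub k2 N2 hN2 p q hp hq hne)
    (fun p hp => by
      simp only [hfac]
      rw [abs_mul, abs_of_nonneg (a := ∑ i, (1 : ℝ) / p i) (sum_nonneg fun _ _ => by positivity), mul_div_assoc]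
      gcongr
      exact sum_one_div_le k1 N1 hN1 p hp)
    (fun q _ => sum_nonneg fun _ _ => by positivity)
    (fun q hq => sum_one_div_le k2 N2 hN2 q hq)
  simp only [hfac, mul_right_inj' hξne] at hbil
  simp only [hfac]
  set Z := ‖∑ p ∈ Fintype.piFinset fun _ : Fin k1 => Ico N1 (2 * N1),
          ∑ q ∈ Fintype.piFinset fun _ : Fin k2 => Ico N2 (2 * N2),
            η p * θ q * Complex.exp (Complex.I * (ξ * ∑ i, (1 : ℝ) / p i : ℝ) *
              (∑ i, 1 / q i : ℝ))‖ with hZ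
  rw [hξT] at hbil
  have hsq : Z ^ 2 ≤ E * (D * ((T * N2 + N2 ^ (2 * k2)) * (T * N1 + N1 ^ (2 * k1)) /
      (T * (N1 * N2)))) * (C1 * (N1 : ℝ) ^ ((k1 : ℝ) + ε)) * (C2 * (N2 : ℝ) ^ ((k2 : ℝ) + ε)) := by
    have hE0 : 0 ≤ E := by linarith
    have hD0 : 0 ≤ D := by linarith
    have hfactor := large_sieve_factor_le k1 k2 N1 N2 T hn1 hn2 hT0
    refine hbil.trans (mul_le_mul (mul_le_mul (mul_le_mul_of_nonneg_left hfactor hE0)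
      (hJ1 N1 hN1) (Nat.cast_nonneg _) ?_) (hJ2 N2 hN2) (Nat.cast_nonneg _) ?_) <;> positivity
  have hq1 := sq_mul_add_pow_le T N1 hT0 hn1 k1 hk1
  have hq2 := sq_mul_add_pow_le T N2 hT0 hn2 k2 hk2
  set g1 := T / (N1 : ℝ) ^ (2 * k1) + 1 / T * (N1 : ℝ) ^ (2 * (k1 - 1)) with hg1
  set g2 := T / (N2 : ℝ) ^ (2 * k2) + 1 / T * (N2 : ℝ) ^ (2 * (k2 - 1)) with hg2
  calc Z ^ 4 = (Z ^ 2) ^ 2 := by ring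
    _ ≤ (E * (D * ((T * N2 + N2 ^ (2 * k2)) * (T * N1 + N1 ^ (2 * k1)) /
      (T * (N1 * N2)))) * (C1 * (N1 : ℝ) ^ ((k1 : ℝ) + ε)) *
        (C2 * (N2 : ℝ) ^ ((k2 : ℝ) + ε))) ^ 2 := by gcongr
    _ = (E * D * C1 * C2) ^ 2 / (T * (N1 * N2)) ^ 2 *
        ((T * N1 + N1 ^ (2 * k1)) ^ 2 * (T * N2 + N2 ^ (2 * k2)) ^ 2) *
        (((N1 : ℝ) ^ ((k1 : ℝ) + ε)) ^ 2 * ((N2 : ℝ) ^ ((k2 : ℝ) + ε)) ^ 2) := by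
        field_simp
    _ ≤ (E * D * C1 * C2) ^ 2 / (T * (N1 * N2)) ^ 2 *
        ((2 * T * N1 ^ 2 * N1 ^ (2 * k1) * g1) * (2 * T * N2 ^ 2 * N2 ^ (2 * k2) * g2)) *
        (((N1 : ℝ) ^ ((k1 : ℝ) + ε)) ^ 2 * ((N2 : ℝ) ^ ((k2 : ℝ) + ε)) ^ 2) := by gcongr
    _ = _ := by field_simp; ring

lemma pow_mul_pow_rpow_sq_eq (k l : ℕ) (hl : 0 < l) (N ε : ℝ) (hN : 0 < N) :
    (N ^ (k * (l - 1))) ^ 4 * (N ^ (2 * k) * (N ^ ((k : ℝ) + 2 * k * l * ε)) ^ 2) =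
      (N ^ (1 + ε)) ^ (4 * k * l) := by
  obtain ⟨j, rfl⟩ := Nat.exists_eq_succ_of_ne_zero hl.ne'
  simp only [← Real.rpow_natCast, ← Real.rpow_mul hN.le, ← Real.rpow_add hN]
  congr 1
  push_cast [Nat.succ_sub_one]
  ring

/-- Hölder's inequality in both variables of the exponential sum. -/
theorem exists_norm_sum_exp_pow_le (k1 k2 : ℕ) (hk1 : 0 < k1) (hk2 : 0 < k2) (N1 N2 : ℕ) (ξ : ℝ) :
    ∃ (η : (Fin k1 → ℕ) → ℂ) (θ : (Fin k2 → ℕ) → ℂ), (∀ p, ‖η p‖ ≤ 1) ∧ (∀ q, ‖θ q‖ ≤ 1) ∧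
      ‖∑ n1 ∈ Ico N1 (2 * N1), ∑ n2 ∈ Ico N2 (2 * N2),
        Complex.exp (Complex.I * ((ξ / ((n1 : ℝ) * (n2 : ℝ)) : ℝ) : ℂ))‖ ^ (k1 * k2) ≤
      (N1 : ℝ) ^ (k1 * (k2 - 1)) * (N2 : ℝ) ^ (k2 * (k1 - 1)) *
        ‖∑ p ∈ Fintype.piFinset fun _ : Fin k1 => Ico N1 (2 * N1),
          ∑ q ∈ Fintype.piFinset fun _ : Fin k2 => Ico N2 (2 * N2),
            η p * θ q * Complex.exp (Complex.I * (∑ i, ξ / p i : ℝ) * (∑ i, 1 / q i : ℝ))‖ := by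
  have hcard : ∀ N : ℕ, #(Ico N (2 * N)) = N := fun N => by rw [Nat.card_Ico]; omega
  obtain ⟨θ, hθ, h1⟩ := exists_norm_pow_le_of_moment (Ico N1 (2 * N1)) (Ico N2 (2 * N2))
    (fun n => ξ / (n : ℝ)) (fun m => 1 / (m : ℝ)) (fun _ => 1) k1 hk1
  obtain ⟨η, hη, h2⟩ := exists_norm_pow_le_of_moment (Ico N2 (2 * N2))
    (Fintype.piFinset fun _ : Fin k1 => Ico N1 (2 * N1))
    (fun m => 1 / (m : ℝ)) (fun p => ∑ i, ξ / (p i : ℝ)) θ k2 hk2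
  refine ⟨η, fun q => ∏ i, θ (q i), hη, fun q => ?_, ?_⟩
  · rw [norm_prod]
    exact prod_le_one (fun _ _ => norm_nonneg _) fun i _ => hθ _
  have e1 : ∑ n1 ∈ Ico N1 (2 * N1), ∑ n2 ∈ Ico N2 (2 * N2),
        Complex.exp (Complex.I * ((ξ / ((n1 : ℝ) * (n2 : ℝ)) : ℝ) : ℂ)) =
      ∑ m ∈ Ico N2 (2 * N2), ∑ n ∈ Ico N1 (2 * N1),
        1 * Complex.exp (Complex.I * (ξ / (n : ℝ) : ℝ) * (1 / (m : ℝ) : ℝ)) := by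
    rw [sum_comm]
    refine sum_congr rfl fun m _ => sum_congr rfl fun n _ => ?_
    rw [one_mul, mul_assoc, ← Complex.ofReal_mul, div_mul_div_comm, mul_one]
  have e2 : ∑ m ∈ Ico N2 (2 * N2), ∑ p ∈ Fintype.piFinset fun _ : Fin k1 => Ico N1 (2 * N1),
        θ m * (∏ _i : Fin k1, 1) * Complex.exp (Complex.I * (∑ i, ξ / (p i : ℝ) : ℝ) *
          (1 / (m : ℝ) : ℝ)) =
      ∑ p ∈ Fintype.piFinset fun _ : Fin k1 => Ico N1 (2 * N1), ∑ m ∈ Ico N2 (2 * N2),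
        θ m * Complex.exp (Complex.I * (1 / (m : ℝ) : ℝ) * (∑ i, ξ / (p i : ℝ) : ℝ)) := by
    rw [sum_comm]
    refine sum_congr rfl fun p _ => sum_congr rfl fun m _ => ?_
    rw [prod_const_one, mul_one]
    congr 2
    ring
  have e3 : ∀ p : Fin k1 → ℕ, ∀ q : Fin k2 → ℕ,
      Complex.exp (Complex.I * (∑ i, 1 / (q i : ℝ) : ℝ) * (∑ i, ξ / (p i : ℝ) : ℝ)) =
      Complex.exp (Complex.I * (∑ i, ξ / (p i : ℝ) : ℝ) * (∑ i, 1 / (q i : ℝ) : ℝ)) :=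
    fun p q => by congr 1; ring
  rw [← e1, e2, hcard] at h1
  simp only [e3] at h2
  rw [Fintype.card_piFinset_const, hcard] at h2
  rw [pow_mul]
  refine (pow_le_pow_left₀ (by positivity) h1 k2).trans ?_
  rw [mul_pow, ← pow_mul, mul_comm (k1 - 1) k2, mul_comm ((N1 : ℝ) ^ _), mul_assoc]
  refine mul_le_mul_of_nonneg_left (h2.trans_eq ?_) (by positivity)
  rw [Nat.cast_pow, ← pow_mul]

/-- the Archimedean bilinear Kloosterman-type bound
`|∑_{n_1∼N_1} ∑_{n_2∼N_2} e^{iξ/(n_1n_2)}| ≤ c·γ·(N_1N_2)^{1+ε}`. -/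
theorem stmt_15 (k1 k2 : ℕ) (hk1 : 0 < k1) (hk2 : 0 < k2) (ε : ℝ) (hε : 0 < ε) :
    ∃ c : ℝ, 0 < c ∧
      ∀ (N1 N2 : ℕ), 0 < N1 → 0 < N2 → ∀ ξ : ℝ, (N1 : ℝ) * (N2 : ℝ) < |ξ| →
        ‖∑ n1 ∈ Finset.Ico N1 (2 * N1), ∑ n2 ∈ Finset.Ico N2 (2 * N2),
            Complex.exp (Complex.I * ((ξ / ((n1 : ℝ) * (n2 : ℝ)) : ℝ) : ℂ))‖ ≤
          c * (((|ξ| / ((N1 : ℝ) * (N2 : ℝ))) / (N1 : ℝ) ^ (2 * k1) +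
                  ((N1 : ℝ) * (N2 : ℝ) / |ξ|) * (N1 : ℝ) ^ (2 * (k1 - 1))) *
                ((|ξ| / ((N1 : ℝ) * (N2 : ℝ))) / (N2 : ℝ) ^ (2 * k2) +
                  ((N1 : ℝ) * (N2 : ℝ) / |ξ|) * (N2 : ℝ) ^ (2 * (k2 - 1)))) ^
              ((1 : ℝ) / (4 * (k1 : ℝ) * (k2 : ℝ))) *
            ((N1 : ℝ) * (N2 : ℝ)) ^ ((1 : ℝ) + ε) := by
  obtain ⟨K, hK1, hK⟩ := exists_norm_bilinear_reciprocal_le k1 k2 hk1 hk2 (2 * k1 * k2 * ε)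
    (by positivity)
  refine ⟨K, by linarith, fun N1 N2 hN1 hN2 ξ hξ => ?_⟩
  have hn1 : (0 : ℝ) < N1 := by exact_mod_cast hN1
  have hn2 : (0 : ℝ) < N2 := by exact_mod_cast hN2
  have hM : 4 * k1 * k2 ≠ 0 := by positivity
  obtain ⟨η, θ, hη, hθ, hH⟩ := exists_norm_sum_exp_pow_le k1 k2 hk1 hk2 N1 N2 ξ
  have hB := hK N1 N2 hN1 hN2 ξ hξ η θ hη hθ
  set S := ‖∑ n1 ∈ Finset.Ico N1 (2 * N1), ∑ n2 ∈ Finset.Ico N2 (2 * N2),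
            Complex.exp (Complex.I * ((ξ / ((n1 : ℝ) * (n2 : ℝ)) : ℝ) : ℂ))‖
  set G := ((|ξ| / ((N1 : ℝ) * (N2 : ℝ))) / (N1 : ℝ) ^ (2 * k1) +
                  ((N1 : ℝ) * (N2 : ℝ) / |ξ|) * (N1 : ℝ) ^ (2 * (k1 - 1))) *
                ((|ξ| / ((N1 : ℝ) * (N2 : ℝ))) / (N2 : ℝ) ^ (2 * k2) +
                  ((N1 : ℝ) * (N2 : ℝ) / |ξ|) * (N2 : ℝ) ^ (2 * (k2 - 1)))
  set Z := ‖∑ p ∈ Fintype.piFinset fun _ : Fin k1 => Ico N1 (2 * N1),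
          ∑ q ∈ Fintype.piFinset fun _ : Fin k2 => Ico N2 (2 * N2),
            η p * θ q * Complex.exp (Complex.I * (∑ i, ξ / p i : ℝ) * (∑ i, 1 / q i : ℝ))‖
  have hG0 : 0 ≤ G := by positivity
  have hroot : (G ^ ((1 : ℝ) / (4 * k1 * k2))) ^ (4 * k1 * k2) = G := by
    rw [← Real.rpow_natCast, ← Real.rpow_mul hG0]
    push_cast
    rw [one_div_mul_cancel (by positivity), Real.rpow_one]
  have e1 := pow_mul_pow_rpow_sq_eq k1 k2 hk2 N1 ε hn1
  have e2 := pow_mul_pow_rpow_sq_eq k2 k1 hk1 N2 ε hn2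
  rw [show (2 : ℝ) * k2 * k1 * ε = 2 * k1 * k2 * ε by ring,
    show 4 * k2 * k1 = 4 * k1 * k2 by ring] at e2
  refine le_of_pow_le_pow_left₀ hM (by positivity) ?_
  calc S ^ (4 * k1 * k2) = (S ^ (k1 * k2)) ^ 4 := by rw [← pow_mul]; congr 1; ring
    _ ≤ ((N1 : ℝ) ^ (k1 * (k2 - 1)) * (N2 : ℝ) ^ (k2 * (k1 - 1)) * Z) ^ 4 := by gcongr
    _ = ((N1 : ℝ) ^ (k1 * (k2 - 1))) ^ 4 * ((N2 : ℝ) ^ (k2 * (k1 - 1))) ^ 4 * Z ^ 4 := by ring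
    _ ≤ ((N1 : ℝ) ^ (k1 * (k2 - 1))) ^ 4 * ((N2 : ℝ) ^ (k2 * (k1 - 1))) ^ 4 * _ :=
        mul_le_mul_of_nonneg_left hB (by positivity)
    _ = K * G * (((N1 : ℝ) ^ (1 + ε)) ^ (4 * k1 * k2) * ((N2 : ℝ) ^ (1 + ε)) ^ (4 * k1 * k2)) := by
        rw [← e1, ← e2]; ring
    _ ≤ K ^ (4 * k1 * k2) * G *
        (((N1 : ℝ) ^ (1 + ε)) ^ (4 * k1 * k2) * ((N2 : ℝ) ^ (1 + ε)) ^ (4 * k1 * k2)) := by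
        gcongr
        exact le_self_pow₀ hK1 hM
    _ = _ := by
        rw [mul_pow, mul_pow, hroot, Real.mul_rpow hn1.le hn2.le, mul_pow]
end

section
/- There exists an absolute constant C > 0 such that for every prime p ≥ 16, every integer N with 2 ≤ N < p, and every integer a with gcd(a,p) = 1, one has |∑_{n=1}^{N} e_p(a n*)| ≤ C·(log log p)³·(log p)/(log N)^{3/2}·N. -/
open Finset

/-- `e_p(z) = exp(2πi z/p)` for `z ∈ ZMod p`. -/
noncomputable def ep (p : ℕ) (z : ZMod p) : ℂ :=
  Complex.exp (2 * (Real.pi : ℂ) * Complex.I * (z.val : ℂ) / (p : ℂ))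

open ArithmeticFunction in
lemma sum_Icc_vonMangoldt_le (n : ℕ) : ∑ d ∈ Icc 1 n, vonMangoldt d ≤ 6 * n := by
  have h := Chebyshev.psi_le_const_mul_self (x := (n : ℝ)) (by positivity)
  rw [Chebyshev.psi, Nat.floor_natCast] at h
  have h4 : Real.log 4 ≤ 2 := by
    rw [show (4 : ℝ) = 2 ^ 2 by norm_num, Real.log_pow]
    have := Real.log_two_lt_d9
    push_cast; linarith
  have e : Icc 1 n = Ioc 0 n := by ext; simp; omega
  rw [e]
  refine h.trans ?_
  have : (0 : ℝ) ≤ n := by positivity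
  nlinarith

lemma sum_Icc_inv_eq_harmonic (n : ℕ) : ∑ d ∈ Icc 1 n, (1 : ℝ) / d = (harmonic n : ℝ) := by
  rw [harmonic_eq_sum_Icc]; push_cast; simp

lemma sum_Icc_inv_le (n : ℕ) : ∑ d ∈ Icc 1 n, (1 : ℝ) / d ≤ 1 + Real.log n := by
  rw [sum_Icc_inv_eq_harmonic]; exact harmonic_le_one_add_log n

lemma log_le_sum_Icc_inv (n : ℕ) : Real.log n ≤ ∑ d ∈ Icc 1 n, (1 : ℝ) / d := by
  rw [sum_Icc_inv_eq_harmonic]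
  rcases Nat.eq_zero_or_pos n with rfl | hn
  · simp
  refine le_trans (Real.log_le_log (by positivity) ?_) (log_add_one_le_harmonic n)
  push_cast; linarith

open ArithmeticFunction in
lemma sum_Icc_vonMangoldt_div_eq (n : ℕ) :
    ∑ d ∈ Icc 1 n, vonMangoldt d / d =
      (∑ d ∈ Icc 1 n, vonMangoldt d) / (n + 1) +
        ∑ m ∈ Icc 1 n, (∑ d ∈ Icc 1 m, vonMangoldt d) / (m * (m + 1)) := by
  induction n with
  | zero => simp
  | succ n ih =>
    rw [sum_Icc_succ_top (by omega), ih, sum_Icc_succ_top (by omega), sum_Icc_succ_top (by omega),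
      sum_Icc_succ_top (by omega)]
    push_cast
    field_simp
    ring

lemma half_lt_log_nat {u : ℕ} (hu : 2 ≤ u) : 1 / 2 < Real.log u := by
  have h1 := Real.log_two_gt_d9
  have : Real.log 2 ≤ Real.log u := Real.log_le_log (by norm_num) (by exact_mod_cast hu)
  linarith

open ArithmeticFunction in
lemma sum_Icc_vonMangoldt_div_le {u : ℕ} (hu : 2 ≤ u) :
    ∑ d ∈ Icc 1 u, vonMangoldt d / d ≤ 30 * Real.log u := by
  rw [sum_Icc_vonMangoldt_div_eq]
  have h1 : (∑ d ∈ Icc 1 u, vonMangoldt d) / (u + 1) ≤ 6 := by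
    rw [div_le_iff₀ (by positivity)]
    linarith [sum_Icc_vonMangoldt_le u]
  have h2 : ∑ m ∈ Icc 1 u, (∑ d ∈ Icc 1 m, vonMangoldt d) / (m * (m + 1)) ≤
      ∑ m ∈ Icc 1 u, 6 * ((1 : ℝ) / m) := by
    refine sum_le_sum fun m hm => ?_
    have hm1 : (1 : ℝ) ≤ m := by exact_mod_cast (mem_Icc.1 hm).1
    rw [div_le_iff₀ (by positivity)]
    have := sum_Icc_vonMangoldt_le m
    have e : 6 * ((1 : ℝ) / m) * (m * (m + 1)) = 6 * (m + 1) := by field_simp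
    rw [e]; linarith
  rw [← mul_sum] at h2
  have := sum_Icc_inv_le u
  have := half_lt_log_nat hu
  linarith

open scoped Classical in
/-- The integers in `[1, z]` all of whose prime factors are at most `u`. -/
noncomputable def smoothUpTo (u z : ℕ) : Finset ℕ := {e ∈ Icc 1 z | ∀ q : ℕ, q.Prime → q ∣ e → q ≤ u}

lemma mem_smoothUpTo {u z e : ℕ} :
    e ∈ smoothUpTo u z ↔ (1 ≤ e ∧ e ≤ z) ∧ ∀ q : ℕ, q.Prime → q ∣ e → q ≤ u := by
  simp [smoothUpTo]

lemma geom_tail_le {x : ℝ} (hx : 2 ≤ x) (z : ℕ) : ∑ a ∈ Icc 1 z, 1 / x ^ a ≤ 2 / x := by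
  have key : ∑ a ∈ Icc 1 z, 1 / x ^ a ≤ 2 / x - 2 / x * (1 / x ^ z) := by
    induction z with
    | zero => simp
    | succ z ih =>
      rw [sum_Icc_succ_top (by omega)]
      have h1 : 1 / x ^ (z + 1) = 1 / x ^ z * (1 / x) := by rw [pow_succ]; field_simp
      have h2 : 1 / x ≤ 1 / 2 := by gcongr
      have h3 : 0 ≤ 1 / x ^ z * (1 / x) := by positivity
      have h4 : 2 / x = 2 * (1 / x) := by ring
      rw [h1]
      rw [h4] at ih ⊢
      nlinarith [mul_le_mul_of_nonneg_left h2 h3]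
  have : 0 ≤ 2 / x * (1 / x ^ z) := by positivity
  linarith

open ArithmeticFunction in
lemma sum_smoothUpTo_vonMangoldt_div_le {u : ℕ} (hu : 2 ≤ u) (z : ℕ) :
    ∑ d ∈ smoothUpTo u z, vonMangoldt d / d ≤ 60 * Real.log u := by
  have hfil : ∑ d ∈ smoothUpTo u z, vonMangoldt d / d =
      ∑ d ∈ (smoothUpTo u z).filter IsPrimePow, vonMangoldt d / d := by
    rw [sum_filter]
    refine sum_congr rfl fun d _ => ?_
    split_ifs with h
    · rfl
    · rw [vonMangoldt_apply, if_neg h, zero_div]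
  rw [hfil]
  have h1 : ∑ d ∈ (smoothUpTo u z).filter IsPrimePow, vonMangoldt d / d ≤
      ∑ d ∈ ((Icc 1 u).filter Nat.Prime ×ˢ Icc 1 z).image (fun x => x.1 ^ x.2), vonMangoldt d / d := by
    refine sum_le_sum_of_subset_of_nonneg ?_ fun d _ _ => div_nonneg vonMangoldt_nonneg (by positivity)
    intro d hd
    rw [mem_filter, mem_smoothUpTo] at hd
    obtain ⟨⟨⟨hd1, hd2⟩, hs⟩, hpp⟩ := hd
    obtain ⟨q, k, hq, hk, rfl⟩ := (isPrimePow_nat_iff _).1 hpp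
    rw [mem_image]
    refine ⟨(q, k), ?_, rfl⟩
    simp only [mem_product, mem_filter, mem_Icc]
    refine ⟨⟨⟨hq.one_lt.le, hs q hq (dvd_pow_self q hk.ne')⟩, hq⟩, hk, ?_⟩
    exact (Nat.lt_pow_self hq.one_lt).le.trans hd2
  refine h1.trans ?_
  refine (sum_image_le_of_nonneg (fun d _ => div_nonneg vonMangoldt_nonneg (by positivity))).trans ?_
  rw [sum_product]
  calc ∑ q ∈ (Icc 1 u).filter Nat.Prime, ∑ a ∈ Icc 1 z, vonMangoldt (q ^ a) / ((q ^ a : ℕ) : ℝ)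
      ≤ ∑ q ∈ (Icc 1 u).filter Nat.Prime, 2 * (vonMangoldt q / q) := by
        refine sum_le_sum fun q hq => ?_
        have hq := (mem_filter.1 hq).2
        have : ∀ a ∈ Icc 1 z, vonMangoldt (q ^ a) / ((q ^ a : ℕ) : ℝ) =
            vonMangoldt q * (1 / (q : ℝ) ^ a) := by
          intro a ha
          rw [vonMangoldt_apply_pow (by have := (mem_Icc.1 ha).1; omega)]
          push_cast; ring
        rw [sum_congr rfl this, ← mul_sum]
        have h2 := geom_tail_le (x := q) (by exact_mod_cast hq.two_le) z
        calc _ ≤ vonMangoldt q * (2 / (q : ℝ)) := by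
              gcongr
          _ = _ := by ring
    _ ≤ ∑ q ∈ Icc 1 u, 2 * (vonMangoldt q / q) := by
        refine sum_le_sum_of_subset_of_nonneg (filter_subset _ _) fun d _ _ => ?_
        have := div_nonneg (vonMangoldt_nonneg (n := d)) (Nat.cast_nonneg (α := ℝ) d)
        linarith
    _ ≤ _ := by
        rw [← mul_sum]
        linarith [sum_Icc_vonMangoldt_div_le hu]

open ArithmeticFunction in
/-- If `S` is closed under divisors, then `∑ g(n) log n` is controlled by a product. -/
lemma sum_log_div_le {S : Finset ℕ} (hS : ∀ n ∈ S, n ≠ 0 ∧ ∀ d, d ∣ n → d ∈ S) :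
    ∑ n ∈ S, Real.log n * (1 / n) ≤
      (∑ d ∈ S, vonMangoldt d / d) * ∑ m ∈ S, (1 : ℝ) / m := by
  calc ∑ n ∈ S, Real.log n * (1 / n)
      = ∑ n ∈ S, ∑ x ∈ n.divisorsAntidiagonal, vonMangoldt x.1 / x.1 * (1 / x.2) := by
        refine sum_congr rfl fun n hn => ?_
        rw [← vonMangoldt_sum, ← Nat.sum_divisorsAntidiagonal (fun d _ => vonMangoldt d), sum_mul]
        refine sum_congr rfl fun x hx => ?_
        rw [Nat.mem_divisorsAntidiagonal] at hx
        rw [← hx.1]; push_cast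
        field_simp
    _ = ∑ y ∈ S.sigma fun n => n.divisorsAntidiagonal,
          vonMangoldt y.2.1 / y.2.1 * (1 / (y.2.2 : ℝ)) := by rw [sum_sigma]
    _ = ∑ x ∈ (S.sigma fun n => n.divisorsAntidiagonal).image Sigma.snd,
          vonMangoldt x.1 / x.1 * (1 / (x.2 : ℝ)) := by
        rw [sum_image]
        rintro ⟨a, x⟩ ha ⟨b, y⟩ hb (h : x = y)
        subst h
        simp only [coe_sigma, Set.mem_sigma_iff, mem_coe, Nat.mem_divisorsAntidiagonal] at ha hb
        obtain rfl : a = b := by rw [← ha.2.1, ← hb.2.1]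
        rfl
    _ ≤ ∑ x ∈ S ×ˢ S, vonMangoldt x.1 / x.1 * (1 / (x.2 : ℝ)) := by
        refine sum_le_sum_of_subset_of_nonneg ?_ fun x _ _ =>
          mul_nonneg (div_nonneg vonMangoldt_nonneg (by positivity)) (by positivity)
        intro x hx
        simp only [mem_image, mem_sigma, Nat.mem_divisorsAntidiagonal] at hx
        obtain ⟨⟨n, y⟩, ⟨hn, hy, -⟩, rfl⟩ := hx
        simp only at hn hy ⊢
        rw [mem_product]
        exact ⟨(hS n hn).2 _ ⟨_, hy.symm⟩, (hS n hn).2 _ ⟨_, by rw [← hy]; ring⟩⟩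
    _ = _ := by rw [sum_product, sum_mul_sum]

lemma sum_smoothUpTo_inv_le {u : ℕ} (hu : 2 ≤ u) (z : ℕ) :
    ∑ e ∈ smoothUpTo u z, (1 : ℝ) / e ≤ 250 * Real.log u := by
  set G := ∑ e ∈ smoothUpTo u z, (1 : ℝ) / e with hG
  have hu2 := half_lt_log_nat hu
  have h1 := sum_log_div_le (S := smoothUpTo u z) (by
    intro n hn
    rw [mem_smoothUpTo] at hn
    refine ⟨by omega, fun d hd => ?_⟩
    rw [mem_smoothUpTo]
    exact ⟨⟨Nat.pos_of_dvd_of_pos hd hn.1.1, (Nat.le_of_dvd hn.1.1 hd).trans hn.1.2⟩,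
      fun q hq hqd => hn.2 q hq (hqd.trans hd)⟩)
  have hG0 : 0 ≤ G := sum_nonneg fun _ _ => by positivity
  have h2 : ∑ n ∈ smoothUpTo u z, Real.log n * (1 / n) ≤ 60 * Real.log u * G :=
    h1.trans (mul_le_mul_of_nonneg_right (sum_smoothUpTo_vonMangoldt_div_le hu z) hG0)
  have h3 : ∀ e ∈ smoothUpTo u z, (120 * Real.log u) * ((1 : ℝ) / e) ≤
      Real.log e * (1 / e) + (if e ≤ u ^ 120 then (120 * Real.log u) * ((1 : ℝ) / e) else 0) := by
    intro e he
    rw [mem_smoothUpTo] at he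
    have he1 : (1 : ℝ) ≤ e := by exact_mod_cast he.1.1
    split_ifs with h
    · have := Real.log_nonneg he1
      have : 0 ≤ Real.log e * (1 / e) := by positivity
      linarith
    · push Not at h
      rw [add_zero]
      gcongr
      have : Real.log ((u : ℝ) ^ 120) ≤ Real.log e :=
        Real.log_le_log (by positivity) (by exact_mod_cast h.le)
      rw [Real.log_pow] at this
      exact_mod_cast this
  have h4 := sum_le_sum h3
  rw [← mul_sum, sum_add_distrib, ← sum_filter, ← mul_sum] at h4
  have h5 : ∑ e ∈ (smoothUpTo u z).filter (· ≤ u ^ 120), (1 : ℝ) / e ≤ 1 + 120 * Real.log u := by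
    have := sum_Icc_inv_le (u ^ 120)
    push_cast [Real.log_pow] at this
    refine le_trans (sum_le_sum_of_subset_of_nonneg ?_ fun _ _ _ => by positivity) this
    intro e he
    rw [mem_filter, mem_smoothUpTo] at he
    rw [mem_Icc]; exact ⟨he.1.1.1, he.2⟩
  have h6 : 60 * Real.log u * G ≤ 120 * Real.log u * (1 + 120 * Real.log u) := by
    have := mul_le_mul_of_nonneg_left h5 (show 0 ≤ 120 * Real.log u by linarith)
    linarith
  have h7 : G ≤ 2 * (1 + 120 * Real.log u) := by
    by_contra hcon
    push Not at hcon
    nlinarith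
  linarith

lemma exists_smooth_mul_rough {u v : ℕ} : ∀ n : ℕ, 1 ≤ n → n ≤ v →
    ∃ e d : ℕ, n = e * d ∧ (∀ q : ℕ, q.Prime → q ∣ e → q ≤ u) ∧
      (∀ q : ℕ, q.Prime → q ∣ d → u < q ∧ q ≤ v) := by
  intro n
  induction n using induction_on_primes with
  | zero => intro h; omega
  | one => intro _ _; refine ⟨1, 1, rfl, ?_, ?_⟩ <;>
            · intro q hq h; exact absurd (Nat.dvd_one.1 h) hq.one_lt.ne'
  | prime_mul p n hp ih =>
    intro h1 h2
    have hn : 1 ≤ n := by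
      rcases Nat.eq_zero_or_pos n with rfl | h
      · simp at h1
      · exact h
    obtain ⟨e, d, rfl, he, hd⟩ := ih hn ((Nat.le_mul_of_pos_left _ hp.pos).trans h2)
    have hpv : p ≤ v := (Nat.le_mul_of_pos_right _ hn).trans h2
    by_cases hpu : p ≤ u
    · refine ⟨p * e, d, by ring, fun q hq hqd => ?_, hd⟩
      rcases (hq.dvd_mul).1 hqd with h | h
      · rwa [(Nat.prime_dvd_prime_iff_eq hq hp).1 h]
      · exact he q hq h
    · refine ⟨e, p * d, by ring, he, fun q hq hqd => ?_⟩
      rcases (hq.dvd_mul).1 hqd with h | h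
      · rw [(Nat.prime_dvd_prime_iff_eq hq hp).1 h]; omega
      · exact hd q hq h

open scoped Classical in
/-- The integers in `[1, N]` without prime factors in `(u, v]`. -/
noncomputable def siftedUpTo (u v N : ℕ) : Finset ℕ :=
  {n ∈ Icc 1 N | ∀ q : ℕ, q.Prime → u < q → q ≤ v → ¬ q ∣ n}

lemma mem_siftedUpTo {u v N n : ℕ} : n ∈ siftedUpTo u v N ↔
    (1 ≤ n ∧ n ≤ N) ∧ ∀ q : ℕ, q.Prime → u < q → q ≤ v → ¬ q ∣ n := by
  simp [siftedUpTo]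

lemma dvd_of_mul_eq_mul_of_sifted {u v m m' d d' : ℕ}
    (hm' : ∀ q : ℕ, q.Prime → u < q → q ≤ v → ¬ q ∣ m')
    (hd : ∀ q : ℕ, q.Prime → q ∣ d → u < q ∧ q ≤ v) (h : m * d = m' * d') : d ∣ d' := by
  have hco : Nat.Coprime d m' := by
    refine Nat.coprime_of_dvd fun q hq hqd hqm => ?_
    exact hm' q hq (hd q hq hqd).1 (hd q hq hqd).2 hqm
  exact hco.dvd_of_dvd_mul_left (h ▸ Dvd.intro_left m rfl)

lemma sum_siftedUpTo_inv_le {u v N : ℕ} (hu : 2 ≤ u) (hv : 2 ≤ v) (hvN : v ≤ N) :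
    (∑ m ∈ siftedUpTo u v N, (1 : ℝ) / m) * Real.log v ≤ 1000 * Real.log u * Real.log N := by
  classical
  set F := ∑ m ∈ siftedUpTo u v N, (1 : ℝ) / m with hF
  set DD : Finset ℕ := {d ∈ Icc 1 v | ∀ q : ℕ, q.Prime → q ∣ d → u < q ∧ q ≤ v} with hDD
  set D := ∑ d ∈ DD, (1 : ℝ) / d with hD
  have hF0 : 0 ≤ F := sum_nonneg fun _ _ => by positivity
  have hD0 : 0 ≤ D := sum_nonneg fun _ _ => by positivity
  have h1 : F * D ≤ 1 + Real.log ((N * v : ℕ) : ℝ) := by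
    refine le_trans ?_ (sum_Icc_inv_le (N * v))
    rw [hF, hD, sum_mul_sum, ← sum_product']
    have e : ∀ x ∈ siftedUpTo u v N ×ˢ DD, (1 : ℝ) / x.1 * (1 / x.2) =
        (fun n : ℕ => (1 : ℝ) / n) (x.1 * x.2) := by
      intro x _; push_cast; field_simp
    rw [sum_congr rfl e, ← sum_image (f := fun n : ℕ => (1 : ℝ) / n)
      (g := fun x : ℕ × ℕ => x.1 * x.2)]
    · refine sum_le_sum_of_subset_of_nonneg ?_ fun _ _ _ => by positivity
      intro n hn
      simp only [mem_image, mem_product, mem_siftedUpTo, hDD, mem_filter, mem_Icc] at hn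
      obtain ⟨⟨m, d⟩, ⟨⟨hm, -⟩, hd, -⟩, rfl⟩ := hn
      rw [mem_Icc]
      exact ⟨Nat.mul_pos hm.1 hd.1, Nat.mul_le_mul hm.2 hd.2⟩
    · rintro ⟨m, d⟩ h ⟨m', d'⟩ h' (heq : m * d = m' * d')
      simp only [coe_product, Set.mem_prod, mem_coe, mem_siftedUpTo, hDD, mem_filter, mem_Icc] at h h'
      have hdd : d = d' := Nat.dvd_antisymm
        (dvd_of_mul_eq_mul_of_sifted h'.1.2 h.2.2 heq)
        (dvd_of_mul_eq_mul_of_sifted h.1.2 h'.2.2 heq.symm)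
      subst hdd
      have := Nat.eq_of_mul_eq_mul_right h.2.1.1 heq
      rw [this]
  have h2 : Real.log v ≤ 250 * Real.log u * D := by
    refine (log_le_sum_Icc_inv v).trans ?_
    refine le_trans ?_ (mul_le_mul_of_nonneg_right (sum_smoothUpTo_inv_le hu v) hD0)
    rw [hD, sum_mul_sum, ← sum_product']
    have e : ∀ x ∈ smoothUpTo u v ×ˢ DD, (1 : ℝ) / x.1 * (1 / x.2) =
        (fun n : ℕ => (1 : ℝ) / n) (x.1 * x.2) := by
      intro x _; push_cast; field_simp
    rw [sum_congr rfl e]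
    refine le_trans ?_ (sum_image_le_of_nonneg (f := fun n : ℕ => (1 : ℝ) / n)
      (g := fun x : ℕ × ℕ => x.1 * x.2) (fun _ _ => by positivity))
    refine sum_le_sum_of_subset_of_nonneg ?_ fun _ _ _ => by positivity
    intro n hn
    rw [mem_Icc] at hn
    obtain ⟨e, d, rfl, he, hd⟩ := exists_smooth_mul_rough (u := u) n hn.1 hn.2
    have he0 : 0 < e := Nat.pos_of_mul_pos_right hn.1
    have hd0 : 0 < d := Nat.pos_of_mul_pos_left hn.1
    rw [mem_image]
    refine ⟨(e, d), ?_, rfl⟩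
    simp only [mem_product, mem_smoothUpTo, hDD, mem_filter, mem_Icc]
    exact ⟨⟨⟨he0, (Nat.le_mul_of_pos_right _ hd0).trans hn.2⟩, he⟩,
      ⟨hd0, (Nat.le_mul_of_pos_left _ he0).trans hn.2⟩, hd⟩
  have hlu := half_lt_log_nat hu
  have hlN := half_lt_log_nat (hv.trans hvN)
  have hlvN : Real.log v ≤ Real.log N :=
    Real.log_le_log (by positivity) (by exact_mod_cast hvN)
  have h3 : 1 + Real.log ((N * v : ℕ) : ℝ) ≤ 4 * Real.log N := by
    push_cast
    rw [Real.log_mul (by norm_cast; omega) (by norm_cast; omega)]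
    linarith
  calc F * Real.log v ≤ F * (250 * Real.log u * D) := by gcongr
    _ = 250 * Real.log u * (F * D) := by ring
    _ ≤ 250 * Real.log u * (4 * Real.log N) :=
      mul_le_mul_of_nonneg_left (h1.trans h3) (by linarith)
    _ = _ := by ring

open ArithmeticFunction in
lemma card_siftedUpTo_le {u v N : ℕ} (hu : 2 ≤ u) (hv : 2 ≤ v) (hvN : v ≤ N) :
    ((siftedUpTo u v N).card : ℝ) ≤ 7000 * (Real.log u / Real.log v) * N := by
  set S := siftedUpTo u v N with hS
  set F := ∑ m ∈ S, (1 : ℝ) / m with hF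
  have hlN := half_lt_log_nat (hv.trans hvN)
  have hlv := half_lt_log_nat hv
  have h1 : ∑ n ∈ S, Real.log n ≤ 6 * N * F := by
    calc ∑ n ∈ S, Real.log n
        = ∑ n ∈ S, ∑ x ∈ n.divisorsAntidiagonal, vonMangoldt x.1 := by
          refine sum_congr rfl fun n hn => ?_
          rw [← vonMangoldt_sum, ← Nat.sum_divisorsAntidiagonal (fun d _ => vonMangoldt d)]
      _ = ∑ y ∈ S.sigma fun n => n.divisorsAntidiagonal, vonMangoldt y.2.1 := by rw [sum_sigma]
      _ = ∑ x ∈ (S.sigma fun n => n.divisorsAntidiagonal).image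
            (fun y => (⟨y.2.2, y.2.1⟩ : Σ _ : ℕ, ℕ)), vonMangoldt x.2 := by
          rw [sum_image]
          rintro ⟨a, x⟩ ha ⟨b, y⟩ hb h
          simp only [Sigma.mk.injEq, heq_eq_eq] at h
          simp only [coe_sigma, Set.mem_sigma_iff, mem_coe, Nat.mem_divisorsAntidiagonal] at ha hb
          obtain ⟨x1, x2⟩ := x
          obtain ⟨y1, y2⟩ := y
          obtain ⟨h1, h2⟩ := h
          simp only at h1 h2
          subst h1 h2
          obtain rfl : a = b := by rw [← ha.2.1, ← hb.2.1]
          rfl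
      _ ≤ ∑ x ∈ S.sigma fun m => Icc 1 (N / m), vonMangoldt x.2 := by
          refine sum_le_sum_of_subset_of_nonneg ?_ fun x _ _ => vonMangoldt_nonneg
          intro x hx
          simp only [mem_image, mem_sigma, Nat.mem_divisorsAntidiagonal] at hx
          obtain ⟨⟨n, d, m⟩, ⟨hn, hy, hn0⟩, rfl⟩ := hx
          simp only at hn hy hn0 ⊢
          subst hy
          have hd0 : 0 < d := Nat.pos_of_ne_zero fun h => hn0 (by simp [h])
          have hm0 : 0 < m := Nat.pos_of_ne_zero fun h => hn0 (by simp [h])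
          rw [hS, mem_siftedUpTo] at hn
          rw [mem_sigma, hS, mem_siftedUpTo, mem_Icc]
          refine ⟨⟨⟨hm0, (Nat.le_mul_of_pos_left _ hd0).trans hn.1.2⟩, fun q hq h1 h2 h3 =>
            hn.2 q hq h1 h2 (h3.mul_left d)⟩, hd0, ?_⟩
          exact (Nat.le_div_iff_mul_le hm0).2 hn.1.2
      _ ≤ ∑ m ∈ S, 6 * N * ((1 : ℝ) / m) := by
          rw [sum_sigma]
          refine sum_le_sum fun m _ => (sum_Icc_vonMangoldt_le _).trans ?_
          have : ((N / m : ℕ) : ℝ) ≤ N / m := Nat.cast_div_le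
          calc _ ≤ 6 * ((N : ℝ) / m) := by gcongr
            _ = _ := by ring
      _ = _ := by rw [← mul_sum]
  have h2 : (S.card : ℝ) * Real.log N ≤ 7 * N * F := by
    calc (S.card : ℝ) * Real.log N = ∑ n ∈ S, Real.log N := by simp
      _ ≤ ∑ n ∈ S, (Real.log n + N * (1 / n)) := by
          refine sum_le_sum fun n hn => ?_
          rw [hS, mem_siftedUpTo] at hn
          have hn1 : (0 : ℝ) < n := by exact_mod_cast hn.1.1
          have hN1 : (0 : ℝ) < N := by exact_mod_cast (show 0 < N by omega)
          have := Real.log_le_sub_one_of_pos (show (0 : ℝ) < N / n by positivity)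
          rw [Real.log_div hN1.ne' hn1.ne'] at this
          rw [mul_one_div]
          linarith
      _ = ∑ n ∈ S, Real.log n + N * F := by rw [sum_add_distrib, ← mul_sum]
      _ ≤ _ := by linarith
  have h3 := sum_siftedUpTo_inv_le (u := u) hu hv hvN
  rw [← hS, ← hF] at h3
  have h4 : (S.card : ℝ) * Real.log v * Real.log N ≤
      (7000 * Real.log u * N) * Real.log N := by
    calc (S.card : ℝ) * Real.log v * Real.log N = (S.card * Real.log N) * Real.log v := by ring
      _ ≤ (7 * N * F) * Real.log v := by gcongr
      _ = 7 * N * (F * Real.log v) := by ring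
      _ ≤ 7 * N * (1000 * Real.log u * Real.log N) := by gcongr
      _ = _ := by ring
  have h5 := le_of_mul_le_mul_right h4 (by linarith)
  calc (S.card : ℝ) ≤ (7000 * Real.log u * N) / Real.log v := by
        rw [le_div_iff₀ (by linarith)]; exact h5
    _ = _ := by ring

lemma card_multiples_le (N d : ℕ) : (({n ∈ Icc 1 N | d ∣ n} : Finset ℕ).card : ℝ) ≤ N / d := by
  have e : Icc 1 N = Ioc 0 N := by ext; simp; omega
  rw [e, Nat.Ioc_filter_dvd_card_eq_div]
  exact Nat.cast_div_le

lemma sum_card_divisors_le (N : ℕ) :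
    ∑ n ∈ Icc 1 N, (n.divisors.card : ℝ) ≤ N * (1 + Real.log N) := by
  have h1 : ∀ n ∈ Icc 1 N, (n.divisors.card : ℝ) = ∑ d ∈ Icc 1 N, if d ∣ n then (1 : ℝ) else 0 := by
    intro n hn
    rw [mem_Icc] at hn
    rw [← sum_filter, sum_const, nsmul_eq_mul, mul_one]
    congr 2
    ext d
    simp only [Nat.mem_divisors, mem_filter, mem_Icc]
    constructor
    · rintro ⟨h, h0⟩
      exact ⟨⟨Nat.pos_of_dvd_of_pos h hn.1, (Nat.le_of_dvd hn.1 h).trans hn.2⟩, h⟩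
    · rintro ⟨_, h⟩
      exact ⟨h, by omega⟩
  rw [sum_congr rfl h1, sum_comm]
  calc ∑ d ∈ Icc 1 N, ∑ n ∈ Icc 1 N, (if d ∣ n then (1 : ℝ) else 0)
      ≤ ∑ d ∈ Icc 1 N, N * ((1 : ℝ) / d) := by
        refine sum_le_sum fun d _ => ?_
        rw [← sum_filter, sum_const, nsmul_eq_mul, mul_one, mul_one_div]
        exact card_multiples_le N d
    _ ≤ _ := by
        rw [← mul_sum]
        exact mul_le_mul_of_nonneg_left (sum_Icc_inv_le N) (by positivity)

lemma two_pow_le_card_divisors {a n v w : ℕ} (ha : Squarefree a) (han : a ∣ n) (hn : n ≠ 0)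
    (hv : 2 ≤ v) (hs : ∀ q : ℕ, q.Prime → q ∣ a → q ≤ v) (hw : v ^ w ≤ a) :
    2 ^ w ≤ n.divisors.card := by
  have ha0 : a ≠ 0 := ha.ne_zero
  have h1 : a ≤ v ^ a.primeFactors.card := by
    conv_lhs => rw [← Nat.prod_primeFactors_of_squarefree ha]
    refine prod_le_pow_card _ _ _ fun q hq => ?_
    exact hs q (Nat.prime_of_mem_primeFactors hq) (Nat.dvd_of_mem_primeFactors hq)
  have h2 : w ≤ a.primeFactors.card := (Nat.pow_le_pow_iff_right (by omega)).1 (hw.trans h1)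
  calc 2 ^ w ≤ 2 ^ a.primeFactors.card := Nat.pow_le_pow_right (by norm_num) h2
    _ ≤ a.divisors.card := by
        rw [Nat.card_divisors ha0]
        refine pow_card_le_prod _ _ _ fun q hq => ?_
        have := (Nat.prime_of_mem_primeFactors hq).factorization_pos_of_dvd ha0
          (Nat.dvd_of_mem_primeFactors hq)
        omega
    _ ≤ n.divisors.card := card_le_card (Nat.divisors_subset_of_dvd hn han)

lemma card_smoothUpTo_le {v N T w : ℕ} (hv : 2 ≤ v) (hT : 1 ≤ T) (hTN : T ^ 6 ≤ N)
    (hw : v ^ (2 * w) ≤ N) :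
    ((smoothUpTo v N).card : ℝ) ≤ 2 * N / T + N * (1 + Real.log N) / 2 ^ w := by
  have hN1 : 1 ≤ N := (Nat.one_le_pow _ _ hT).trans hTN
  have hTN' : T ≤ N := (Nat.le_self_pow (by norm_num) T).trans hTN
  have hsub : smoothUpTo v N ⊆ (Icc 1 (N / T) ∪ (Ioc T N).biUnion fun b => {n ∈ Icc 1 N | b ^ 2 ∣ n}) ∪
      {n ∈ Icc 1 N | 2 ^ w ≤ n.divisors.card} := by
    intro n hn
    rw [mem_smoothUpTo] at hn
    obtain ⟨⟨hn1, hnN⟩, hs⟩ := hn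
    simp only [mem_union, mem_biUnion, mem_filter, mem_Icc, mem_Ioc]
    by_cases h1 : n * T ≤ N
    · left; left; exact ⟨hn1, (Nat.le_div_iff_mul_le (by omega)).2 h1⟩
    push Not at h1
    obtain ⟨a, b, ha0, hb0, hab, hsq⟩ := Nat.sq_mul_squarefree_of_pos (show 0 < n by omega)
    by_cases h2 : T < b
    · left; right
      have hbn : b ^ 2 ∣ n := Dvd.intro _ hab
      refine ⟨b, ⟨h2, ?_⟩, ⟨hn1, hnN⟩, hbn⟩
      exact ((Nat.le_self_pow (by norm_num) b).trans (Nat.le_of_dvd hn1 hbn)).trans hnN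
    · right
      push Not at h2
      have han : a ∣ n := Dvd.intro_left _ hab
      refine ⟨⟨hn1, hnN⟩, two_pow_le_card_divisors hsq han (by omega) hv
        (fun q hq hqa => hs q hq (hqa.trans han)) ?_⟩
      have h3 : N < a * T ^ 3 := by
        calc N < n * T := h1
          _ = b ^ 2 * a * T := by rw [hab]
          _ ≤ T ^ 2 * a * T := by gcongr
          _ = _ := by ring
      have h4 : N * N < a ^ 2 * N := by
        calc N * N < (a * T ^ 3) * (a * T ^ 3) := Nat.mul_lt_mul'' h3 h3
          _ = a ^ 2 * T ^ 6 := by ring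
          _ ≤ a ^ 2 * N := by gcongr
      have h5 : N < a ^ 2 := Nat.lt_of_mul_lt_mul_right h4
      have h6 : (v ^ w) ^ 2 ≤ a ^ 2 := by
        rw [← pow_mul, mul_comm w 2]; omega
      exact (Nat.pow_le_pow_iff_left (by norm_num)).1 h6
  have hT0 : (0 : ℝ) < T := by exact_mod_cast hT
  have c1 : ((Icc 1 (N / T)).card : ℝ) ≤ N / T := by
    simpa using (Nat.cast_div_le (α := ℝ) (m := N) (n := T))
  have c2 : (((Ioc T N).biUnion fun b => {n ∈ Icc 1 N | b ^ 2 ∣ n}).card : ℝ) ≤ N / T := by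
    calc (((Ioc T N).biUnion fun b => {n ∈ Icc 1 N | b ^ 2 ∣ n}).card : ℝ)
        ≤ ∑ b ∈ Ioc T N, (({n ∈ Icc 1 N | b ^ 2 ∣ n} : Finset ℕ).card : ℝ) := by
          exact_mod_cast card_biUnion_le
      _ ≤ ∑ b ∈ Ioc T N, N * ((b : ℝ) ^ 2)⁻¹ := by
          refine sum_le_sum fun b _ => (card_multiples_le N _).trans ?_
          push_cast; rw [div_eq_mul_inv]
      _ ≤ N * ((T : ℝ)⁻¹ - (N : ℝ)⁻¹) := by
          rw [← mul_sum]
          exact mul_le_mul_of_nonneg_left (sum_Ioc_inv_sq_le_sub (by omega) hTN') (by positivity)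
      _ ≤ N * (T : ℝ)⁻¹ := by
          gcongr
          have : (0 : ℝ) ≤ (N : ℝ)⁻¹ := by positivity
          linarith
      _ = _ := by rw [div_eq_mul_inv]
  have c3 : (({n ∈ Icc 1 N | 2 ^ w ≤ n.divisors.card} : Finset ℕ).card : ℝ) ≤
      N * (1 + Real.log N) / 2 ^ w := by
    rw [le_div_iff₀ (by positivity)]
    refine le_trans ?_ (sum_card_divisors_le N)
    calc _ = ∑ n ∈ Icc 1 N with 2 ^ w ≤ n.divisors.card, (2 : ℝ) ^ w := by simp
      _ ≤ ∑ n ∈ Icc 1 N with 2 ^ w ≤ n.divisors.card, (n.divisors.card : ℝ) := by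
          refine sum_le_sum fun n hn => ?_
          exact_mod_cast (mem_filter.1 hn).2
      _ ≤ _ := sum_le_sum_of_subset_of_nonneg (filter_subset _ _) fun _ _ _ => by positivity
  have hc := Nat.cast_le (α := ℝ).2 ((card_le_card hsub).trans
      ((card_union_le _ _).trans (Nat.add_le_add_right (card_union_le _ _) _)))
  push_cast at hc
  have : 2 * (N : ℝ) / T = N / T + N / T := by ring
  linarith

/-- The primes in `[2 ^ i, 2 ^ (i + 1))`. -/
def dyadicPrimes (i : ℕ) : Finset ℕ := {r ∈ Ico (2 ^ i) (2 ^ (i + 1)) | r.Prime}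

lemma sum_dyadicPrimes_inv_le {i : ℕ} (hi : 1 ≤ i) :
    ∑ r ∈ dyadicPrimes i, (1 : ℝ) / r ≤ 4 / i := by
  have hi0 : (0 : ℝ) < i := by exact_mod_cast hi
  have hl2 : 0 < Real.log 2 := Real.log_pos (by norm_num)
  have h1 : ((dyadicPrimes i).card : ℝ) * (i * Real.log 2) ≤ 4 * Real.log 2 * 2 ^ i := by
    have := Chebyshev.theta_le_log4_mul_x (x := (2 : ℝ) ^ (i + 1)) (by positivity)
    have hl4 : Real.log 4 = 2 * Real.log 2 := by
      rw [show (4 : ℝ) = 2 ^ 2 by norm_num, Real.log_pow]; norm_num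
    rw [hl4] at this
    calc ((dyadicPrimes i).card : ℝ) * (i * Real.log 2)
        = ∑ r ∈ dyadicPrimes i, i * Real.log 2 := by simp
      _ ≤ ∑ r ∈ dyadicPrimes i, Real.log r := by
          refine sum_le_sum fun r hr => ?_
          rw [← Real.log_pow]
          refine Real.log_le_log (by positivity) ?_
          exact_mod_cast (mem_Ico.1 (mem_filter.1 hr).1).1
      _ ≤ Chebyshev.theta ((2 : ℝ) ^ (i + 1)) := by
          rw [Chebyshev.theta]
          refine sum_le_sum_of_subset_of_nonneg ?_ fun r hr _ => ?_
          · intro r hr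
            have h := mem_filter.1 hr
            rw [mem_filter, mem_Ioc]
            refine ⟨⟨h.2.pos, Nat.le_floor ?_⟩, h.2⟩
            exact_mod_cast (mem_Ico.1 h.1).2.le
          · exact Real.log_natCast_nonneg r
      _ ≤ _ := this
      _ = _ := by ring
  have h2 : ((dyadicPrimes i).card : ℝ) * i ≤ 4 * 2 ^ i := by
    refine le_of_mul_le_mul_right ?_ hl2
    linarith
  calc ∑ r ∈ dyadicPrimes i, (1 : ℝ) / r ≤ ∑ r ∈ dyadicPrimes i, (1 : ℝ) / 2 ^ i := by
        refine sum_le_sum fun r hr => ?_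
        gcongr
        exact_mod_cast (mem_Ico.1 (mem_filter.1 hr).1).1
    _ = (dyadicPrimes i).card / 2 ^ i := by simp [div_eq_mul_inv]
    _ ≤ 4 / i := by
        rw [div_le_div_iff₀ (by positivity) hi0]
        exact h2

/-- The number of integers up to `N` with a prime factor in one of the dyadic blocks of `Bad`. -/
lemma card_dvd_dyadicPrimes_le {N i₀ : ℕ} (hi₀ : 1 ≤ i₀) (Bad : Finset ℕ)
    (hBad : ∀ i ∈ Bad, i₀ ≤ i) :
    (((Bad.biUnion dyadicPrimes).biUnion fun r => {n ∈ Icc 1 N | r ∣ n}).card : ℝ) ≤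
      4 * Bad.card / i₀ * N := by
  have hi0 : (0 : ℝ) < i₀ := by exact_mod_cast hi₀
  calc (((Bad.biUnion dyadicPrimes).biUnion fun r => {n ∈ Icc 1 N | r ∣ n}).card : ℝ)
      ≤ ∑ r ∈ Bad.biUnion dyadicPrimes, (({n ∈ Icc 1 N | r ∣ n} : Finset ℕ).card : ℝ) := by
        exact_mod_cast card_biUnion_le
    _ ≤ ∑ r ∈ Bad.biUnion dyadicPrimes, N * ((1 : ℝ) / r) := by
        refine sum_le_sum fun r _ => (card_multiples_le N _).trans ?_
        rw [mul_one_div]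
    _ = N * ∑ r ∈ Bad.biUnion dyadicPrimes, (1 : ℝ) / r := by rw [mul_sum]
    _ ≤ N * ∑ i ∈ Bad, 4 / (i₀ : ℝ) := by
        gcongr
        have hd : (Bad : Set ℕ).PairwiseDisjoint dyadicPrimes := by
          intro i _ j _ hij
          rw [Function.onFun, disjoint_left]
          intro r hr hr'
          have h1 := mem_Ico.1 (mem_filter.1 hr).1
          have h2 := mem_Ico.1 (mem_filter.1 hr').1
          have h3 := (Nat.pow_lt_pow_iff_right (by norm_num : 1 < 2)).1 (h1.1.trans_lt h2.2)
          have h4 := (Nat.pow_lt_pow_iff_right (by norm_num : 1 < 2)).1 (h2.1.trans_lt h1.2)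
          omega
        rw [sum_biUnion hd]
        refine sum_le_sum fun i hi => ?_
        have hii := hBad i hi
        refine (sum_dyadicPrimes_inv_le (by omega)).trans ?_
        gcongr
    _ = _ := by rw [sum_const, nsmul_eq_mul]; ring

lemma norm_stdAddChar {p : ℕ} [NeZero p] (x : ZMod p) : ‖ZMod.stdAddChar x‖ = 1 := by
  rw [ZMod.stdAddChar_apply]; exact Circle.norm_coe _

/-- A mean square bound for exponential sums whose frequencies have multiplicity at most `τ`. -/
lemma sum_norm_sq_stdAddChar_le {ι : Type*} {p : ℕ} [NeZero p] (S : Finset ι) (σ : ι → ZMod p)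
    (Θ : ι → ℂ) (hΘ : ∀ t ∈ S, ‖Θ t‖ ≤ 1) {τ : ℝ}
    (hτ : ∀ ν, ((S.filter fun t => σ t = ν).card : ℝ) ≤ τ) :
    ∑ μ : ZMod p, ‖∑ t ∈ S, Θ t * ZMod.stdAddChar (μ * σ t)‖ ^ 2 ≤ p * S.card * τ := by
  classical
  have key : ((∑ μ : ZMod p, ‖∑ t ∈ S, Θ t * ZMod.stdAddChar (μ * σ t)‖ ^ 2 : ℝ) : ℂ) =
      ∑ t ∈ S, ∑ t' ∈ S, Θ t * starRingEnd ℂ (Θ t') * (if σ t - σ t' = 0 then (p : ℂ) else 0) := by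
    push_cast
    have h1 : ∀ μ : ZMod p, ((‖∑ t ∈ S, Θ t * ZMod.stdAddChar (μ * σ t)‖ : ℂ)) ^ 2 =
        ∑ t ∈ S, ∑ t' ∈ S, Θ t * starRingEnd ℂ (Θ t') * ZMod.stdAddChar (μ * (σ t - σ t')) := by
      intro μ
      rw [← Complex.mul_conj', map_sum, sum_mul_sum]
      refine sum_congr rfl fun t _ => sum_congr rfl fun t' _ => ?_
      rw [map_mul (starRingEnd ℂ), mul_sub, sub_eq_add_neg, AddChar.map_add_eq_mul,
        AddChar.map_neg_eq_conj]
      ring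
    rw [sum_congr rfl fun μ _ => h1 μ, sum_comm]
    refine sum_congr rfl fun t _ => ?_
    rw [sum_comm]
    refine sum_congr rfl fun t' _ => ?_
    rw [← mul_sum, AddChar.sum_mulShift _ (ZMod.isPrimitive_stdAddChar p), ZMod.card]
    push_cast
    rfl
  have hnn : 0 ≤ ∑ μ : ZMod p, ‖∑ t ∈ S, Θ t * ZMod.stdAddChar (μ * σ t)‖ ^ 2 :=
    sum_nonneg fun _ _ => by positivity
  rw [← Real.norm_of_nonneg hnn, ← Complex.norm_real, key]
  calc _ ≤ ∑ t ∈ S, ∑ t' ∈ S, (if σ t' = σ t then (p : ℝ) else 0) := by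
        refine (norm_sum_le _ _).trans (sum_le_sum fun t ht => ?_)
        refine (norm_sum_le _ _).trans (sum_le_sum fun t' ht' => ?_)
        rw [norm_mul, norm_mul, RCLike.norm_conj]
        have : ‖(if σ t - σ t' = 0 then (p : ℂ) else 0)‖ = if σ t' = σ t then (p : ℝ) else 0 := by
          simp only [sub_eq_zero, eq_comm (a := σ t')]
          split_ifs <;> simp
        rw [this]
        have h0 : (0 : ℝ) ≤ if σ t' = σ t then (p : ℝ) else 0 := by split_ifs <;> positivity
        calc _ ≤ 1 * 1 * (if σ t' = σ t then (p : ℝ) else 0) := by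
              gcongr
              · exact hΘ t ht
              · exact hΘ t' ht'
          _ = _ := by ring
    _ ≤ ∑ t ∈ S, p * τ := by
        refine sum_le_sum fun t _ => ?_
        rw [← sum_filter, sum_const, nsmul_eq_mul, mul_comm]
        exact mul_le_mul_of_nonneg_left (hτ _) (by positivity)
    _ = _ := by rw [sum_const, nsmul_eq_mul]; ring

lemma pow_sum_le_card_pow_mul {ι : Type*} (s : Finset ι) (f : ι → ℝ) (hf : ∀ i ∈ s, 0 ≤ f i)
    {n : ℕ} (hn : 1 ≤ n) : (∑ i ∈ s, f i) ^ n ≤ (s.card : ℝ) ^ (n - 1) * ∑ i ∈ s, f i ^ n := by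
  obtain ⟨m, rfl⟩ : ∃ m, n = m + 1 := ⟨n - 1, by omega⟩
  exact pow_sum_le_card_mul_sum_pow hf m

lemma stdAddChar_sum {ι : Type*} {p : ℕ} [NeZero p] (s : Finset ι) (f : ι → ZMod p) :
    ZMod.stdAddChar (∑ i ∈ s, f i) = ∏ i ∈ s, ZMod.stdAddChar (f i) := by
  classical
  induction s using Finset.induction_on with
  | empty => simp
  | insert a s ha ih => rw [sum_insert ha, prod_insert ha, AddChar.map_add_eq_mul, ih]

/-- Multiplicity of the `k`-fold sums of `φ` over `A`. -/
def FiberBound {ι M : Type*} [AddCommMonoid M] [DecidableEq M] (A : Finset ι) (φ : ι → M)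
    (k : ℕ) (τ : ℝ) : Prop :=
  ∀ ν, (((Fintype.piFinset fun _ : Fin k => A).filter fun t => ∑ i, φ (t i) = ν).card : ℝ) ≤ τ

lemma pow_sum_stdAddChar {ι : Type*} {p : ℕ} [NeZero p] (A : Finset ι) (θ : ι → ℂ)
    (φ : ι → ZMod p) (μ : ZMod p) (k : ℕ) :
    (∑ a ∈ A, θ a * ZMod.stdAddChar (μ * φ a)) ^ k =
      ∑ t ∈ Fintype.piFinset fun _ : Fin k => A,
        (∏ i, θ (t i)) * ZMod.stdAddChar (μ * ∑ i, φ (t i)) := by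
  classical
  rw [sum_pow']
  refine sum_congr rfl fun t _ => ?_
  rw [prod_mul_distrib, mul_sum, stdAddChar_sum]

/-- Hölder's inequality for bilinear exponential sums. -/
lemma norm_bilinear_pow_le {α β : Type*} {p : ℕ} [NeZero p] (A : Finset α) (B : Finset β)
    (φ : α → ZMod p) (ψ : β → ZMod p) {k l : ℕ} (hk : 1 ≤ k) (hl : 1 ≤ l) {τA τB : ℝ}
    (hA : FiberBound A φ k τA) (hB : FiberBound B ψ l τB) :
    ‖∑ a ∈ A, ∑ b ∈ B, ZMod.stdAddChar (φ a * ψ b)‖ ^ (2 * k * l) ≤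
      p * (A.card : ℝ) ^ (2 * k * l - k) * (B.card : ℝ) ^ (2 * k * l - l) * τA * τB := by
  classical
  set T := Fintype.piFinset fun _ : Fin l => B with hT
  have hτB : 0 ≤ τB := le_trans (by positivity) (hB 0)
  have hTcard : (T.card : ℝ) = (B.card : ℝ) ^ l := by simp [hT, Fintype.card_piFinset]
  set z : α → ℂ := fun a => ∑ b ∈ B, ZMod.stdAddChar (φ a * ψ b) with hz
  have hθ : ∀ a, ∃ θ : ℂ, ‖θ‖ ≤ 1 ∧ ((‖z a‖ ^ l : ℝ) : ℂ) = θ * z a ^ l := by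
    intro a
    by_cases h : z a = 0
    · exact ⟨0, by simp, by simp [h]; omega⟩
    · have hn : ((‖z a‖ : ℂ)) ≠ 0 := by simpa using h
      refine ⟨(‖z a‖ : ℂ) ^ l / z a ^ l, ?_, ?_⟩
      · rw [norm_div, norm_pow, norm_pow]; simp; exact (div_self_le_one _)
      · push_cast; field_simp
  choose θ hθ1 hθ2 using hθ
  set F : ZMod p → ℂ := fun μ => ∑ a ∈ A, θ a * ZMod.stdAddChar (μ * φ a) with hF
  set W := ‖∑ a ∈ A, ∑ b ∈ B, ZMod.stdAddChar (φ a * ψ b)‖ with hW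
  have hW0 : 0 ≤ W := norm_nonneg _
  have s1 : W ^ l ≤ (A.card : ℝ) ^ (l - 1) * ∑ a ∈ A, ‖z a‖ ^ l :=
    (pow_le_pow_left₀ hW0 (norm_sum_le _ _) l).trans
      (pow_sum_le_card_pow_mul A _ (fun _ _ => norm_nonneg _) hl)
  have s2 : ∑ a ∈ A, ‖z a‖ ^ l ≤ ∑ t ∈ T, ‖F (∑ i, ψ (t i))‖ := by
    have e : ((∑ a ∈ A, ‖z a‖ ^ l : ℝ) : ℂ) = ∑ t ∈ T, F (∑ i, ψ (t i)) := by
      push_cast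
      rw [hF, sum_comm]
      refine sum_congr rfl fun a _ => ?_
      have := hθ2 a
      push_cast at this
      rw [this, hz, ← mul_sum]
      have h := pow_sum_stdAddChar B (fun _ => 1) ψ (φ a) l
      simp only [one_mul, prod_const_one] at h
      rw [h]
      congr 1
      exact sum_congr rfl fun t _ => by rw [mul_comm (φ a)]
    have hnn : 0 ≤ ∑ a ∈ A, ‖z a‖ ^ l := sum_nonneg fun _ _ => by positivity
    rw [← Real.norm_of_nonneg hnn, ← Complex.norm_real, e]
    exact norm_sum_le _ _
  have s3 : (∑ t ∈ T, ‖F (∑ i, ψ (t i))‖) ^ (2 * k) ≤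
      (T.card : ℝ) ^ (2 * k - 1) * ∑ t ∈ T, ‖F (∑ i, ψ (t i))‖ ^ (2 * k) :=
    pow_sum_le_card_pow_mul T _ (fun _ _ => norm_nonneg _) (by omega)
  have s4 : ∑ t ∈ T, ‖F (∑ i, ψ (t i))‖ ^ (2 * k) ≤ τB * ∑ μ : ZMod p, ‖F μ‖ ^ (2 * k) := by
    rw [← sum_fiberwise T (fun t => ∑ i, ψ (t i)), mul_sum]
    refine sum_le_sum fun μ _ => ?_
    have : ∀ t ∈ T.filter (fun t => ∑ i, ψ (t i) = μ),
        ‖F (∑ i, ψ (t i))‖ ^ (2 * k) = ‖F μ‖ ^ (2 * k) := by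
      intro t ht; rw [(mem_filter.1 ht).2]
    rw [sum_congr rfl this, sum_const, nsmul_eq_mul]
    exact mul_le_mul_of_nonneg_right (hB μ) (by positivity)
  have s5 : ∑ μ : ZMod p, ‖F μ‖ ^ (2 * k) ≤ p * (A.card : ℝ) ^ k * τA := by
    have h := sum_norm_sq_stdAddChar_le (Fintype.piFinset fun _ : Fin k => A)
      (fun t => ∑ i, φ (t i)) (fun t => ∏ i, θ (t i)) (fun t _ => by
        rw [norm_prod]; exact prod_le_one (fun _ _ => norm_nonneg _) fun i _ => hθ1 _) hA
    simp only [← pow_sum_stdAddChar, Fintype.card_piFinset, prod_const, card_univ,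
      Fintype.card_fin, norm_pow, ← pow_mul] at h
    rw [mul_comm k 2] at h
    exact_mod_cast h
  calc W ^ (2 * k * l) = (W ^ l) ^ (2 * k) := by rw [← pow_mul]; ring_nf
    _ ≤ ((A.card : ℝ) ^ (l - 1) * ∑ t ∈ T, ‖F (∑ i, ψ (t i))‖) ^ (2 * k) := by
        gcongr
        exact s1.trans (by gcongr)
    _ = ((A.card : ℝ) ^ (l - 1)) ^ (2 * k) * (∑ t ∈ T, ‖F (∑ i, ψ (t i))‖) ^ (2 * k) := mul_pow _ _ _
    _ ≤ ((A.card : ℝ) ^ (l - 1)) ^ (2 * k) *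
        ((T.card : ℝ) ^ (2 * k - 1) * (τB * (p * (A.card : ℝ) ^ k * τA))) := by
        gcongr
        refine s3.trans ?_
        gcongr
        refine s4.trans ?_
        gcongr
    _ = _ := by
        have e1 : 2 * k * l - k = (l - 1) * (2 * k) + k := by
          obtain ⟨m, rfl⟩ : ∃ m, l = m + 1 := ⟨l - 1, by omega⟩
          have : 2 * k * (m + 1) = m * (2 * k) + 2 * k := by ring
          rw [this, Nat.add_sub_cancel]; omega
        have e2 : 2 * k * l - l = l * (2 * k - 1) := by
          rw [Nat.mul_sub]; congr 1 <;> ring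
        rw [e1, e2, hTcard, pow_add, pow_mul, pow_mul]
        ring

lemma card_le_of_separated (S : Finset ℝ) {Z δ : ℝ} (hδ : 0 < δ)
    (hS : ∀ x ∈ S, 0 ≤ x ∧ x ≤ Z) (hsep : ∀ x ∈ S, ∀ y ∈ S, x ≠ y → δ ≤ |x - y|) (hZ : 0 ≤ Z) :
    (S.card : ℝ) ≤ 1 + Z / δ := by
  have hinj : Set.InjOn (fun x : ℝ => ⌊x / δ⌋₊) S := by
    intro x hx y hy hxy
    by_contra hne
    have h := hsep x hx y hy hne
    have hx0 : 0 ≤ x / δ := div_nonneg (hS x hx).1 hδ.le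
    have hy0 : 0 ≤ y / δ := div_nonneg (hS y hy).1 hδ.le
    have hxy' : ⌊x / δ⌋₊ = ⌊y / δ⌋₊ := hxy
    have h1 := Nat.floor_le hx0
    have h2 := Nat.lt_floor_add_one (x / δ)
    have h3 := Nat.floor_le hy0
    have h4 := Nat.lt_floor_add_one (y / δ)
    rw [hxy'] at h1 h2
    have h5 : |x / δ - y / δ| < 1 := by rw [abs_lt]; constructor <;> linarith
    rw [← sub_div, abs_div, abs_of_pos hδ, div_lt_one hδ] at h5
    linarith
  have hsub : S.image (fun x : ℝ => ⌊x / δ⌋₊) ⊆ range (⌊Z / δ⌋₊ + 1) := by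
    intro n hn
    obtain ⟨x, hx, rfl⟩ := mem_image.1 hn
    rw [mem_range, Nat.lt_succ_iff]
    exact Nat.floor_le_floor (div_le_div_of_nonneg_right (hS x hx).2 hδ.le)
  have h := card_le_card hsub
  rw [card_image_of_injOn hinj, card_range] at h
  have h' : (S.card : ℝ) ≤ ⌊Z / δ⌋₊ + 1 := by exact_mod_cast h
  linarith [Nat.floor_le (div_nonneg hZ hδ.le)]

/-- Equal sums of reciprocals of large primes have the same denominators with multiplicity. -/
lemma card_fiber_eq_of_sum_inv_eq {k : ℕ} {P : Finset ℕ} (hP : ∀ q ∈ P, q.Prime ∧ k < q)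
    {t t' : Fin k → ℕ} (ht : ∀ i, t i ∈ P) (ht' : ∀ i, t' i ∈ P)
    (h : ∑ i, (1 : ℝ) / t i = ∑ i, (1 : ℝ) / t' i) (q : ℕ) :
    (univ.filter fun i => t i = q).card = (univ.filter fun i => t' i = q).card := by
  by_cases hq : q ∈ P
  swap
  · rw [filter_false_of_mem, filter_false_of_mem]
    · intro i _ e; exact hq (e ▸ ht' i)
    · intro i _ e; exact hq (e ▸ ht i)
  have hqp := (hP q hq).1
  set M := ∏ x ∈ P.erase q, x with hM
  have key : ∀ s : Fin k → ℕ, (∀ i, s i ∈ P) → ∃ z : ℕ,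
      (M : ℝ) * q * ∑ i, (1 : ℝ) / s i = (univ.filter fun i => s i = q).card * M + q * z := by
    intro s hs
    refine ⟨∑ i ∈ univ.filter (fun i => ¬ s i = q), M / s i, ?_⟩
    rw [← sum_filter_add_sum_filter_not univ (fun i => s i = q), mul_add]
    congr 1
    · rw [sum_congr rfl (g := fun _ => (1 : ℝ) / q)
        (fun i hi => by rw [(mem_filter.1 hi).2]), sum_const, nsmul_eq_mul]
      have : (q : ℝ) ≠ 0 := by exact_mod_cast hqp.ne_zero
      field_simp
    · push_cast
      rw [mul_sum, mul_sum]
      refine sum_congr rfl fun i hi => ?_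
      have hd : s i ∣ M := dvd_prod_of_mem (fun x => x) (mem_erase.2 ⟨(mem_filter.1 hi).2, hs i⟩)
      have h0 : (s i : ℝ) ≠ 0 := by exact_mod_cast (hP _ (hs i)).1.ne_zero
      rw [Nat.cast_div hd h0]
      ring
  obtain ⟨z, hz⟩ := key t ht
  obtain ⟨z', hz'⟩ := key t' ht'
  rw [h, hz'] at hz
  set n := (univ.filter fun i => t i = q).card
  set n' := (univ.filter fun i => t' i = q).card
  have hn : n < q := lt_of_le_of_lt ((card_le_univ _).trans (by simp)) (hP q hq).2
  have hn' : n' < q := lt_of_le_of_lt ((card_le_univ _).trans (by simp)) (hP q hq).2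
  have e : n' * M + q * z' = n * M + q * z := by exact_mod_cast hz
  have hcop : Nat.Coprime q M := by
    refine Nat.Coprime.prod_right fun x hx => ?_
    exact (Nat.coprime_primes hqp (hP x (mem_of_mem_erase hx)).1).2 (ne_of_mem_erase hx).symm
  have hmod : n' * M ≡ n * M [MOD q] := by
    have : n' * M + q * z' ≡ n * M + q * z [MOD q] := by rw [e]
    simpa [Nat.ModEq] using this
  have := Nat.ModEq.cancel_right_of_coprime hcop hmod
  exact (Nat.ModEq.eq_of_lt_of_lt this hn' hn).symm

lemma exists_perm_of_card_fiber_eq {k : ℕ} {t t' : Fin k → ℕ}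
    (h : ∀ q, (univ.filter fun i => t i = q).card = (univ.filter fun i => t' i = q).card) :
    ∃ σ : Equiv.Perm (Fin k), t ∘ σ = t' := by
  have e : ∀ q, Nonempty ({i // t' i = q} ≃ {i // t i = q}) := fun q => by
    rw [← Fintype.card_eq, Fintype.card_subtype, Fintype.card_subtype, h q]
  refine ⟨Equiv.ofFiberEquiv (fun q => (e q).some), ?_⟩
  funext i
  exact Equiv.ofFiberEquiv_map _ i

lemma sum_inv_mul_prod {K : Type*} [Field K] {k : ℕ} (t : Fin k → K) (h : ∀ i, t i ≠ 0) :
    (∑ i, (t i)⁻¹) * ∏ i, t i = ∑ i, ∏ j ∈ univ.erase i, t j := by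
  rw [sum_mul]
  refine sum_congr rfl fun i _ => ?_
  rw [← mul_prod_erase univ t (mem_univ i), inv_mul_cancel_left₀ (h i)]

lemma separated_sum_inv {p : ℕ} [Fact p.Prime] {k : ℕ} {Z : ℝ} (hZ : 0 < Z) {t t' : Fin k → ℕ}
    (ht : ∀ i, 0 < t i ∧ t i < p ∧ (t i : ℝ) ≤ Z) (ht' : ∀ i, 0 < t' i ∧ t' i < p ∧ (t' i : ℝ) ≤ Z)
    (hmod : ∑ i, (t i : ZMod p)⁻¹ = ∑ i, (t' i : ZMod p)⁻¹)
    (hne : ∑ i, (1 : ℝ) / t i ≠ ∑ i, (1 : ℝ) / t' i) :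
    p / Z ^ (2 * k) ≤ |∑ i, (1 : ℝ) / t i - ∑ i, (1 : ℝ) / t' i| := by
  have hz : ∀ s : Fin k → ℕ, (∀ i, 0 < s i ∧ s i < p ∧ (s i : ℝ) ≤ Z) →
      ∀ i, (s i : ZMod p) ≠ 0 := by
    intro s hs i h
    rw [ZMod.natCast_eq_zero_iff] at h
    exact absurd (Nat.le_of_dvd (hs i).1 h) (not_le.2 (hs i).2.1)
  have hr : ∀ s : Fin k → ℕ, (∀ i, 0 < s i ∧ s i < p ∧ (s i : ℝ) ≤ Z) →
      ∀ i, (s i : ℝ) ≠ 0 := fun s hs i => by exact_mod_cast (hs i).1.ne'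
  set n : ℕ := ∑ i, ∏ j ∈ univ.erase i, t j with hn
  set n' : ℕ := ∑ i, ∏ j ∈ univ.erase i, t' j with hn'
  set D : ℕ := ∏ i, t i with hD
  set D' : ℕ := ∏ i, t' i with hD'
  have m1 := sum_inv_mul_prod (fun i => (t i : ZMod p)) (hz t ht)
  have m2 := sum_inv_mul_prod (fun i => (t' i : ZMod p)) (hz t' ht')
  have r1 := sum_inv_mul_prod (fun i => (t i : ℝ)) (hr t ht)
  have r2 := sum_inv_mul_prod (fun i => (t' i : ℝ)) (hr t' ht')
  have m1' : (∑ i, (t i : ZMod p)⁻¹) * (D : ZMod p) = n := by rw [hD, hn]; push_cast; exact m1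
  have m2' : (∑ i, (t' i : ZMod p)⁻¹) * (D' : ZMod p) = n' := by
    rw [hD', hn']; push_cast; exact m2
  have r1' : (∑ i, (1 : ℝ) / t i) * (D : ℝ) = n := by
    rw [hD, hn]; push_cast; simpa only [one_div] using r1
  have r2' : (∑ i, (1 : ℝ) / t' i) * (D' : ℝ) = n' := by
    rw [hD', hn']; push_cast; simpa only [one_div] using r2
  set ρ := ∑ i, (1 : ℝ) / t i
  set ρ' := ∑ i, (1 : ℝ) / t' i
  have hDpos : 0 < D := prod_pos fun i _ => (ht i).1
  have hDpos' : 0 < D' := prod_pos fun i _ => (ht' i).1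
  have hDr : (0 : ℝ) < D := by exact_mod_cast hDpos
  have hDr' : (0 : ℝ) < D' := by exact_mod_cast hDpos'
  have hDle : (D : ℝ) ≤ Z ^ k := by
    rw [hD]; push_cast
    calc _ ≤ ∏ _i : Fin k, Z := prod_le_prod (fun _ _ => by positivity) fun i _ => (ht i).2.2
      _ = _ := by simp
  have hDle' : (D' : ℝ) ≤ Z ^ k := by
    rw [hD']; push_cast
    calc _ ≤ ∏ _i : Fin k, Z := prod_le_prod (fun _ _ => by positivity) fun i _ => (ht' i).2.2
      _ = _ := by simp
  have hdvd : (p : ℤ) ∣ (n : ℤ) * D' - n' * D := by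
    rw [← ZMod.intCast_zmod_eq_zero_iff_dvd]
    push_cast
    rw [← m1', ← m2', hmod]; ring
  have hreal : (((n : ℤ) * D' - n' * D : ℤ) : ℝ) = (ρ - ρ') * (D * D') := by
    push_cast; rw [← r1', ← r2']; ring
  have hne0 : (n : ℤ) * D' - n' * D ≠ 0 := by
    intro h0
    rw [h0, Int.cast_zero] at hreal
    have := mul_eq_zero.1 hreal.symm
    rcases this with h | h
    · exact hne (sub_eq_zero.1 h)
    · exact absurd h (by positivity)
  have hle := Int.le_of_dvd (abs_pos.2 hne0) ((dvd_abs _ _).2 hdvd)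
  have hle' : (p : ℝ) ≤ |ρ - ρ'| * (D * D') := by
    have : (p : ℝ) ≤ |(((n : ℤ) * D' - n' * D : ℤ) : ℝ)| := by exact_mod_cast hle
    rwa [hreal, abs_mul, abs_of_pos (by positivity : (0 : ℝ) < D * D')] at this
  rw [div_le_iff₀ (by positivity), mul_comm 2 k, pow_mul, sq]
  refine hle'.trans ?_
  gcongr

lemma fiberBound_inv_primes {p : ℕ} [Fact p.Prime] {c : ZMod p} (hc : c ≠ 0) {P : Finset ℕ}
    {Y : ℝ} (hY : 1 ≤ Y) {k : ℕ}
    (hP : ∀ q ∈ P, q.Prime ∧ Y ≤ q ∧ (q : ℝ) ≤ 2 * Y ∧ q < p ∧ k < q) :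
    FiberBound P (fun q => c * (q : ZMod p)⁻¹) k
      (k.factorial * (1 + k / Y * (2 * Y) ^ (2 * k) / p)) := by
  intro ν
  have hp0 : (0 : ℝ) < p := by exact_mod_cast (Fact.out : p.Prime).pos
  set S := (Fintype.piFinset fun _ : Fin k => P).filter
    fun t => ∑ i, c * (t i : ZMod p)⁻¹ = ν with hS
  set ρ : (Fin k → ℕ) → ℝ := fun t => ∑ i, (1 : ℝ) / t i with hρ
  have hmem : ∀ t ∈ S, (∀ i, t i ∈ P) ∧ ∑ i, (t i : ZMod p)⁻¹ = c⁻¹ * ν := by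
    intro t ht
    rw [hS, mem_filter, Fintype.mem_piFinset] at ht
    refine ⟨ht.1, ?_⟩
    rw [← ht.2, ← mul_sum, inv_mul_cancel_left₀ hc]
  have h1 : S.card ≤ k.factorial * (S.image ρ).card := by
    refine card_le_mul_card_image S _ fun x hx => ?_
    obtain ⟨t, ht, rfl⟩ := mem_image.1 hx
    have hsub : (S.filter fun s => ρ s = ρ t) ⊆
        (univ : Finset (Equiv.Perm (Fin k))).image (fun σ : Equiv.Perm (Fin k) => t ∘ σ) := by
      intro s hs
      rw [mem_filter] at hs
      obtain ⟨σ, hσ⟩ := exists_perm_of_card_fiber_eq (card_fiber_eq_of_sum_inv_eq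
        (fun q hq => ⟨(hP q hq).1, (hP q hq).2.2.2.2⟩) (hmem t ht).1 (hmem s hs.1).1 hs.2.symm)
      exact mem_image.2 ⟨σ, mem_univ _, hσ⟩
    refine (card_le_card hsub).trans (card_image_le.trans ?_)
    rw [card_univ, Fintype.card_perm, Fintype.card_fin]
  have h2 : ((S.image ρ).card : ℝ) ≤ 1 + (k / Y) / (p / (2 * Y) ^ (2 * k)) := by
    refine card_le_of_separated _ (by positivity) ?_ ?_ (by positivity)
    · intro x hx
      obtain ⟨t, ht, rfl⟩ := mem_image.1 hx
      refine ⟨sum_nonneg fun _ _ => by positivity, ?_⟩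
      calc ρ t ≤ ∑ _i : Fin k, 1 / Y := sum_le_sum fun i _ =>
            one_div_le_one_div_of_le (by positivity) (hP _ ((hmem t ht).1 i)).2.1
        _ = k / Y := by simp [div_eq_mul_inv]
    · intro x hx y hy hxy
      obtain ⟨t, ht, rfl⟩ := mem_image.1 hx
      obtain ⟨s, hs, rfl⟩ := mem_image.1 hy
      have hh : ∀ t ∈ S, ∀ i, 0 < t i ∧ t i < p ∧ (t i : ℝ) ≤ 2 * Y := fun t ht i =>
        have := hP _ ((hmem t ht).1 i)
        ⟨this.1.pos, this.2.2.2.1, this.2.2.1⟩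
      exact separated_sum_inv (by positivity) (hh t ht) (hh s hs)
        ((hmem t ht).2.trans (hmem s hs).2.symm) hxy
  calc (S.card : ℝ) ≤ k.factorial * (S.image ρ).card := by exact_mod_cast h1
    _ ≤ k.factorial * (1 + (k / Y) / (p / (2 * Y) ^ (2 * k))) := by gcongr
    _ = _ := by congr 2; field_simp

lemma factorial_mul_one_add_le {p k : ℕ} (hp : 0 < p) (hk : 1 ≤ k) {X D : ℝ} (hX : 1 ≤ X)
    (h1 : Real.log p + D * k ≤ 2 * k * Real.log X)
    (h2 : 2 * (k - 1) * Real.log X + D * k ≤ Real.log p) :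
    k.factorial * (1 + k / X * (2 * X) ^ (2 * k) / p) ≤
      (4 * k) ^ k * (2 * X) ^ k * Real.exp (-(Real.log p + D * k) / 2) := by
  have hp' : (0 : ℝ) < p := by exact_mod_cast hp
  set x := Real.log X with hx
  set L := Real.log p with hL
  have eX : X = Real.exp x := (Real.exp_log (by linarith)).symm
  have ep : (p : ℝ) = Real.exp L := (Real.exp_log hp').symm
  set E := Real.exp (k * x - (L + D * k) / 2) with hE
  have e1 : (2 * X) ^ k * Real.exp (-(L + D * k) / 2) = 2 ^ k * E := by
    rw [mul_pow, eX, ← Real.exp_nat_mul, mul_assoc, ← Real.exp_add, hE]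
    congr 2; ring
  have e2 : k / X * (2 * X) ^ (2 * k) / p = k * 4 ^ k * Real.exp ((2 * k - 1) * x - L) := by
    rw [mul_pow, pow_mul, ep, eX, ← Real.exp_nat_mul, sub_mul, one_mul, Real.exp_sub, Real.exp_sub]
    push_cast
    norm_num
    field_simp
  have hE1 : 1 ≤ E := Real.one_le_exp (by linarith)
  have hE2 : Real.exp ((2 * k - 1) * x - L) ≤ E := Real.exp_le_exp.2 (by linarith)
  have hfac : (k.factorial : ℝ) ≤ (k : ℝ) ^ k := by exact_mod_cast Nat.factorial_le_pow k
  have hk2 : ((k : ℝ) + 1) ≤ 2 ^ k := by exact_mod_cast Nat.lt_two_pow_self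
  have h4 : (1 : ℝ) ≤ 4 ^ k := one_le_pow₀ (by norm_num)
  rw [mul_assoc, e1, e2]
  calc k.factorial * (1 + k * 4 ^ k * Real.exp ((2 * k - 1) * x - L))
      ≤ (k : ℝ) ^ k * (4 ^ k * E + k * 4 ^ k * E) := by
        gcongr
        calc (1 : ℝ) = 1 * 1 := by ring
          _ ≤ 4 ^ k * E := by gcongr
    _ = (k : ℝ) ^ k * (4 ^ k * ((k + 1) * E)) := by ring
    _ ≤ (k : ℝ) ^ k * (4 ^ k * (2 ^ k * E)) := by gcongr
    _ = _ := by rw [mul_pow]; ring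

/-- A saving of `(log p)⁻⁴` in bilinear Kloosterman sums over blocks of primes. -/
lemma norm_prime_block_le {p : ℕ} [Fact p.Prime] {c : ZMod p} (hc : c ≠ 0) {A B : Finset ℕ}
    {X Y D : ℝ} {k l : ℕ} (hk : 1 ≤ k) (hl : 1 ≤ l) (hX : 1 ≤ X) (hY : 1 ≤ Y)
    (hA : ∀ q ∈ A, q.Prime ∧ Y ≤ q ∧ (q : ℝ) ≤ 2 * Y ∧ q < p ∧ k < q)
    (hB : ∀ q ∈ B, q.Prime ∧ X ≤ q ∧ (q : ℝ) ≤ 2 * X ∧ q < p ∧ l < q)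
    (hk1 : Real.log p ≤ 2 * k * Real.log Y) (hk2 : 2 * (k - 1) * Real.log Y ≤ Real.log p)
    (hl1 : Real.log p + D * l ≤ 2 * l * Real.log X)
    (hl2 : 2 * (l - 1) * Real.log X + D * l ≤ Real.log p)
    (hL : 1 ≤ Real.log p) (hkL : 4 * k ≤ Real.log p ^ 2) (hlL : 4 * l ≤ Real.log p ^ 2)
    (hD : 24 * Real.log (Real.log p) * k ≤ D) :
    ‖∑ q ∈ A, ∑ r ∈ B, ZMod.stdAddChar (c * (q : ZMod p)⁻¹ * (r : ZMod p)⁻¹)‖ ≤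
      4 * (Y * X) / Real.log p ^ 4 := by
  set L := Real.log p with hLdef
  set lam := Real.log L with hlam
  have hlam0 : 0 ≤ lam := Real.log_nonneg hL
  have hp0 : 0 < p := (Fact.out : p.Prime).pos
  have hpexp : (p : ℝ) = Real.exp L := (Real.exp_log (by exact_mod_cast hp0)).symm
  have eL : L = Real.exp lam := (Real.exp_log (by linarith)).symm
  have hcard : ∀ (S : Finset ℕ) (Z : ℝ), 1 ≤ Z →
      (∀ q ∈ S, 1 ≤ q ∧ (q : ℝ) ≤ 2 * Z) → (S.card : ℝ) ≤ 2 * Z := by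
    intro S Z hZ h
    have hs : S ⊆ Icc 1 ⌊2 * Z⌋₊ := fun q hq =>
      mem_Icc.2 ⟨(h q hq).1, Nat.le_floor (h q hq).2⟩
    have := card_le_card hs
    rw [Nat.card_Icc, Nat.add_sub_cancel] at this
    exact (Nat.cast_le.2 this).trans (Nat.floor_le (by linarith))
  have cA := hcard A Y hY fun q hq => ⟨(hA q hq).1.one_le, (hA q hq).2.2.1⟩
  have cB := hcard B X hX fun q hq => ⟨(hB q hq).1.one_le, (hB q hq).2.2.1⟩
  have fA := fiberBound_inv_primes hc hY hA
  have fB := fiberBound_inv_primes (one_ne_zero (α := ZMod p)) hX hB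
  simp only [one_mul] at fB
  have tA := factorial_mul_one_add_le (D := 0) hp0 hk hY (by simpa using hk1) (by simpa using hk2)
  have tB := factorial_mul_one_add_le hp0 hl hX hl1 hl2
  rw [zero_mul, add_zero, ← hLdef] at tA
  rw [← hLdef] at tB
  set τA := k.factorial * (1 + k / Y * (2 * Y) ^ (2 * k) / p)
  set τB := l.factorial * (1 + l / X * (2 * X) ^ (2 * l) / p)
  have hτA : 0 ≤ τA := by positivity
  have hτB : 0 ≤ τB := by positivity
  have main := norm_bilinear_pow_le A B _ _ hk hl fA fB
  set W := ‖∑ q ∈ A, ∑ r ∈ B, ZMod.stdAddChar (c * (q : ZMod p)⁻¹ * (r : ZMod p)⁻¹)‖ with hW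
  generalize hα : (A.card : ℝ) = α at main cA
  generalize hβ : (B.card : ℝ) = β at main cB
  have hα0 : 0 ≤ α := hα ▸ Nat.cast_nonneg _
  have hβ0 : 0 ≤ β := hβ ▸ Nat.cast_nonneg _
  have hkl : k ≤ 2 * k * l := by nlinarith
  have hlk : l ≤ 2 * k * l := by nlinarith
  have hpow : ∀ (m : ℕ), 4 * (m : ℝ) ≤ L ^ 2 → (4 * (m : ℝ)) ^ m ≤ Real.exp (m * (2 * lam)) := by
    intro m hm
    rw [Real.exp_nat_mul]
    have : L ^ 2 = Real.exp (2 * lam) := by rw [eL, ← Real.exp_nat_mul]; norm_num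
    rw [← this]
    gcongr
  have hfin : W ^ (2 * k * l) ≤ (4 * (Y * X) / L ^ 4) ^ (2 * k * l) := by
    calc W ^ (2 * k * l)
        ≤ p * α ^ (2 * k * l - k) * β ^ (2 * k * l - l) * τA * τB := main
      _ ≤ Real.exp L * (2 * Y) ^ (2 * k * l - k) * (2 * X) ^ (2 * k * l - l) *
          (Real.exp (k * (2 * lam)) * (2 * Y) ^ k * Real.exp (-L / 2)) *
          (Real.exp (l * (2 * lam)) * (2 * X) ^ l * Real.exp (-(L + D * l) / 2)) := by
          have tA' := tA.trans (mul_le_mul_of_nonneg_right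
            (mul_le_mul_of_nonneg_right (hpow k hkL) (by positivity)) (Real.exp_nonneg _))
          have tB' := tB.trans (mul_le_mul_of_nonneg_right
            (mul_le_mul_of_nonneg_right (hpow l hlL) (by positivity)) (Real.exp_nonneg _))
          rw [hpexp]
          refine mul_le_mul (mul_le_mul ?_ tA' hτA (by positivity)) tB' hτB (by positivity)
          refine mul_le_mul (mul_le_mul_of_nonneg_left ?_ (Real.exp_nonneg _)) ?_
            (by positivity) (by positivity)
          · exact pow_le_pow_left₀ (by positivity) cA _
          · exact pow_le_pow_left₀ (by positivity) cB _
      _ = ((2 * Y) ^ (2 * k * l - k) * (2 * Y) ^ k) * ((2 * X) ^ (2 * k * l - l) * (2 * X) ^ l) *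
          (Real.exp L * Real.exp (k * (2 * lam)) * Real.exp (-L / 2) *
            Real.exp (l * (2 * lam)) * Real.exp (-(L + D * l) / 2)) := by ring
      _ = (2 * Y) ^ (2 * k * l) * (2 * X) ^ (2 * k * l) *
          Real.exp (2 * lam * (k + l) - D * l / 2) := by
          rw [← pow_add, ← pow_add, Nat.sub_add_cancel hkl, Nat.sub_add_cancel hlk]
          congr 1
          rw [← Real.exp_add, ← Real.exp_add, ← Real.exp_add, ← Real.exp_add]
          congr 1; ring
      _ ≤ (2 * Y) ^ (2 * k * l) * (2 * X) ^ (2 * k * l) *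
          Real.exp ((2 * k * l : ℕ) * (-(4 * lam))) := by
          gcongr
          push_cast
          have hk' : (1 : ℝ) ≤ k := by exact_mod_cast hk
          have hl' : (1 : ℝ) ≤ l := by exact_mod_cast hl
          have a1 : 24 * lam * k * l ≤ D * l := by gcongr
          have a2 : lam * k ≤ lam * k * l := le_mul_of_one_le_right (by positivity) hl'
          have a3 : lam * l ≤ lam * l * k := le_mul_of_one_le_right (by positivity) hk'
          linarith
      _ = _ := by
          rw [Real.exp_nat_mul, ← mul_pow, ← mul_pow]
          congr 1
          have : Real.exp (-(4 * lam)) = 1 / L ^ 4 := by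
            rw [Real.exp_neg, eL, ← Real.exp_nat_mul]; norm_num
          rw [this]; ring
  exact (pow_le_pow_iff_left₀ (norm_nonneg _) (by positivity) (by positivity)).1 hfin

lemma card_edge_le {N T : ℕ} (hT : 1 ≤ T) :
    (({n ∈ Icc 1 N | (N : ℝ) < n * Real.exp (1 / T)} : Finset ℕ).card : ℝ) ≤ N / T + 1 := by
  have hT' : (0 : ℝ) < T := by exact_mod_cast hT
  set x : ℝ := N * (1 - 1 / T) with hx
  have hle : (1 : ℝ) / T ≤ 1 := by rw [div_le_one hT']; exact_mod_cast hT
  have hx0 : 0 ≤ x := mul_nonneg (by positivity) (by linarith)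
  have hxN : x ≤ N := by
    have : (0 : ℝ) ≤ N * (1 / T) := by positivity
    rw [hx]; linarith
  have hsub : ({n ∈ Icc 1 N | (N : ℝ) < n * Real.exp (1 / T)} : Finset ℕ) ⊆ Ioc ⌊x⌋₊ N := by
    intro n hn
    rw [mem_filter, mem_Icc] at hn
    rw [mem_Ioc]
    refine ⟨(Nat.floor_lt hx0).2 ?_, hn.1.2⟩
    have h1 : (1 - 1 / T : ℝ) ≤ Real.exp (-(1 / T)) := by
      have := Real.add_one_le_exp (-(1 / T : ℝ)); linarith
    calc x ≤ N * Real.exp (-(1 / T)) := mul_le_mul_of_nonneg_left h1 (by positivity)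
      _ < n * Real.exp (1 / T) * Real.exp (-(1 / T)) :=
        mul_lt_mul_of_pos_right hn.2 (Real.exp_pos _)
      _ = n := by rw [mul_assoc, ← Real.exp_add]; simp
  have h := card_le_card hsub
  rw [Nat.card_Ioc] at h
  have hfl : ⌊x⌋₊ ≤ N := Nat.floor_le_of_le hxN
  have h' : (({n ∈ Icc 1 N | (N : ℝ) < n * Real.exp (1 / T)} : Finset ℕ).card : ℝ) ≤
      (N : ℝ) - ⌊x⌋₊ := by
    rw [← Nat.cast_sub hfl]; exact_mod_cast h
  have := Nat.lt_floor_add_one x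
  have e : x = N - N / T := by rw [hx]; ring
  linarith

open scoped Classical in
/-- The primes of `(u, v]` in the logarithmic class `c` that can occur as the least prime factor
of `m * q` in `(u, v]`. -/
noncomputable def leastPrimes (u v T m c : ℕ) : Finset ℕ :=
  {q ∈ Ioc u v | q.Prime ∧ (∀ q' : ℕ, q'.Prime → u < q' → q' < q → ¬ q' ∣ m) ∧
    ⌊(T : ℝ) * Real.log q⌋₊ = c}

open scoped Classical in
/-- The primes exceeding `v` in the dyadic block `i` that can occur as the largest prime factor of
`m * r`, with `m * q * r ≤ N` for all `q` in the logarithmic class `c`. -/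
noncomputable def largestPrimes (v N T m c i : ℕ) : Finset ℕ :=
  {r ∈ Ioc v N | r.Prime ∧ (∀ q' : ℕ, q'.Prime → q' ∣ m → q' ≤ r) ∧ Nat.log 2 r = i ∧
    (r : ℝ) * m * Real.exp ((c + 1) / T) ≤ N}

lemma mem_leastPrimes {u v T m c q : ℕ} : q ∈ leastPrimes u v T m c ↔ (u < q ∧ q ≤ v) ∧ q.Prime ∧
    (∀ q' : ℕ, q'.Prime → u < q' → q' < q → ¬ q' ∣ m) ∧ ⌊(T : ℝ) * Real.log q⌋₊ = c := by
  simp [leastPrimes]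

lemma mem_largestPrimes {v N T m c i r : ℕ} : r ∈ largestPrimes v N T m c i ↔ (v < r ∧ r ≤ N) ∧
    r.Prime ∧ (∀ q' : ℕ, q'.Prime → q' ∣ m → q' ≤ r) ∧ Nat.log 2 r = i ∧
    (r : ℝ) * m * Real.exp ((c + 1) / T) ≤ N := by
  simp [largestPrimes]

/-- Index set of the factorisations `m * q * r`. -/
noncomputable def factorTriples (u v N T : ℕ) (Bad : Finset ℕ) :
    Finset ((_ : ℕ × ℕ × ℕ) × (ℕ × ℕ)) :=
  (Icc 1 N ×ˢ range (⌊(T : ℝ) * Real.log N⌋₊ + 1) ×ˢ (range (Nat.log 2 N + 1) \ Bad)).sigma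
    fun x => leastPrimes u v T x.1 x.2.1 ×ˢ largestPrimes v N T x.1 x.2.1 x.2.2

lemma mem_factorTriples {u v N T : ℕ} {Bad : Finset ℕ} {m c i q r : ℕ} :
    (⟨(m, c, i), (q, r)⟩ : (_ : ℕ × ℕ × ℕ) × (ℕ × ℕ)) ∈ factorTriples u v N T Bad ↔
      ((1 ≤ m ∧ m ≤ N) ∧ c < ⌊(T : ℝ) * Real.log N⌋₊ + 1 ∧ (i < Nat.log 2 N + 1 ∧ i ∉ Bad)) ∧
      q ∈ leastPrimes u v T m c ∧ r ∈ largestPrimes v N T m c i := by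
  simp [factorTriples]

lemma factorTriples_injOn (u v N T : ℕ) (Bad : Finset ℕ) :
    Set.InjOn (fun t : (_ : ℕ × ℕ × ℕ) × (ℕ × ℕ) => t.1.1 * t.2.1 * t.2.2)
      (factorTriples u v N T Bad) := by
  have hr : ∀ {m c i q r m' c' i' q' r' : ℕ}, q ∈ leastPrimes u v T m c →
      r ∈ largestPrimes v N T m c i → q' ∈ leastPrimes u v T m' c' →
      r' ∈ largestPrimes v N T m' c' i' → m * q * r = m' * q' * r' → r' ≤ r ∧ q ≤ q' := by
    intro m c i q r m' c' i' q' r' hq hr hq' hr' e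
    rw [mem_leastPrimes] at hq hq'
    rw [mem_largestPrimes] at hr hr'
    have d1 : r' ∣ m * q * r := e ▸ dvd_mul_left _ _
    have d2 : q' ∣ m * q * r := e ▸ Dvd.dvd.mul_right (dvd_mul_left _ _) _
    rw [hr'.2.1.dvd_mul, hr'.2.1.dvd_mul, Nat.prime_dvd_prime_iff_eq hr'.2.1 hq.2.1,
      Nat.prime_dvd_prime_iff_eq hr'.2.1 hr.2.1] at d1
    rw [hq'.2.1.dvd_mul, hq'.2.1.dvd_mul, Nat.prime_dvd_prime_iff_eq hq'.2.1 hq.2.1,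
      Nat.prime_dvd_prime_iff_eq hq'.2.1 hr.2.1] at d2
    constructor
    · rcases d1 with (h | h) | h
      · exact hr.2.2.1 _ hr'.2.1 h
      · omega
      · omega
    · rcases d2 with (h | h) | h
      · by_contra hlt
        exact hq.2.2.1 _ hq'.2.1 hq'.1.1 (not_le.1 hlt) h
      · omega
      · omega
  rintro ⟨⟨m, c, i⟩, ⟨q, r⟩⟩ h ⟨⟨m', c', i'⟩, ⟨q', r'⟩⟩ h' e
  rw [mem_coe, mem_factorTriples] at h h'
  change m * q * r = m' * q' * r' at e
  have a1 := hr h.2.1 h.2.2 h'.2.1 h'.2.2 e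
  have a2 := hr h'.2.1 h'.2.2 h.2.1 h.2.2 e.symm
  obtain rfl : r = r' := le_antisymm a2.1 a1.1
  obtain rfl : q = q' := le_antisymm a1.2 a2.2
  have hq := mem_leastPrimes.1 h.2.1
  have hq' := mem_leastPrimes.1 h'.2.1
  have hr := mem_largestPrimes.1 h.2.2
  have hr' := mem_largestPrimes.1 h'.2.2
  obtain rfl : c = c' := hq.2.2.2.symm.trans hq'.2.2.2
  obtain rfl : i = i' := hr.2.2.2.1.symm.trans hr'.2.2.2.1
  have : m = m' := Nat.eq_of_mul_eq_mul_right hq.2.1.pos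
    (Nat.eq_of_mul_eq_mul_right hr.2.1.pos e)
  rw [this]

lemma factorTriples_maps {u v N T : ℕ} (hT : 1 ≤ T) {Bad : Finset ℕ}
    {t : (_ : ℕ × ℕ × ℕ) × (ℕ × ℕ)} (ht : t ∈ factorTriples u v N T Bad) :
    t.1.1 * t.2.1 * t.2.2 ∈ Icc 1 N := by
  obtain ⟨⟨m, c, i⟩, ⟨q, r⟩⟩ := t
  rw [mem_factorTriples, mem_leastPrimes, mem_largestPrimes] at ht
  obtain ⟨⟨hm, -, -⟩, ⟨-, hqp, -, hc⟩, ⟨-, hrp, -, -, hN⟩⟩ := ht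
  have hT' : (0 : ℝ) < T := by exact_mod_cast hT
  have hq0 : (0 : ℝ) < q := by exact_mod_cast hqp.pos
  rw [mem_Icc]
  refine ⟨Nat.mul_pos (Nat.mul_pos hm.1 hqp.pos) hrp.pos, ?_⟩
  have h1 : (q : ℝ) ≤ Real.exp ((c + 1) / T) := by
    rw [← Real.log_le_iff_le_exp hq0, le_div_iff₀ hT', mul_comm, ← hc]
    exact (Nat.lt_floor_add_one _).le
  have : ((m * q * r : ℕ) : ℝ) ≤ N := by
    push_cast
    calc (m : ℝ) * q * r = r * m * q := by ring
      _ ≤ r * m * Real.exp ((c + 1) / T) := by gcongr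
      _ ≤ N := hN
  exact_mod_cast this

lemma exists_factorTriple {u v N T n : ℕ} (hT : 1 ≤ T) {Bad : Finset ℕ} (hn : 1 ≤ n) (hnN : n ≤ N)
    (h1 : n ∉ siftedUpTo u v N) (h2 : n ∉ smoothUpTo v N)
    (h3 : n ∉ (Bad.biUnion dyadicPrimes).biUnion fun r => {n ∈ Icc 1 N | r ∣ n})
    (h4 : (n : ℝ) * Real.exp (1 / T) ≤ N) :
    ∃ t ∈ factorTriples u v N T Bad, t.1.1 * t.2.1 * t.2.2 = n := by
  classical
  have hT' : (0 : ℝ) < T := by exact_mod_cast hT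
  have hq : ∃ q : ℕ, q.Prime ∧ u < q ∧ q ≤ v ∧ q ∣ n := by
    by_contra hcon
    push Not at hcon
    exact h1 (mem_siftedUpTo.2 ⟨⟨hn, hnN⟩, hcon⟩)
  have hr : ({r ∈ n.primeFactors | v < r}).Nonempty := by
    by_contra hcon
    rw [not_nonempty_iff_eq_empty] at hcon
    refine h2 (mem_smoothUpTo.2 ⟨⟨hn, hnN⟩, fun q hqp hqn => ?_⟩)
    by_contra hlt
    have : q ∈ ({r ∈ n.primeFactors | v < r}) :=
      mem_filter.2 ⟨Nat.mem_primeFactors.2 ⟨hqp, hqn, by omega⟩, not_le.1 hlt⟩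
    rw [hcon] at this
    exact absurd this (notMem_empty q)
  set q := Nat.find hq with hqdef
  obtain ⟨hqp, huq, hqv, hqn⟩ := Nat.find_spec hq
  have hqmin : ∀ q' : ℕ, q'.Prime → u < q' → q' < q → ¬ q' ∣ n := fun q' hp' hu hlt hd =>
    Nat.find_min hq hlt ⟨hp', hu, by omega, hd⟩
  set r := ({r ∈ n.primeFactors | v < r}).max' hr with hrdef
  have hrm := max'_mem _ hr
  rw [← hrdef, mem_filter, Nat.mem_primeFactors] at hrm
  obtain ⟨⟨hrp, hrn, -⟩, hvr⟩ := hrm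
  have hrmax : ∀ q' : ℕ, q'.Prime → q' ∣ n → q' ≤ r := by
    intro q' hp' hd
    by_cases hv : v < q'
    · exact le_max' _ _ (mem_filter.2 ⟨Nat.mem_primeFactors.2 ⟨hp', hd, by omega⟩, hv⟩)
    · omega
  have hcop : Nat.Coprime q r := (Nat.coprime_primes hqp hrp).2 (by omega)
  obtain ⟨m, hm⟩ := hcop.mul_dvd_of_dvd_of_dvd hqn hrn
  have hmn : m ∣ n := ⟨q * r, by rw [hm]; ring⟩
  have hm0 : 1 ≤ m := Nat.pos_of_ne_zero (by rintro rfl; omega)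
  have hrN : r ≤ N := (Nat.le_of_dvd hn hrn).trans hnN
  have hqN : q ≤ N := (Nat.le_of_dvd hn hqn).trans hnN
  have hq0 : (0 : ℝ) < q := by exact_mod_cast hqp.pos
  refine ⟨⟨(m, ⌊(T : ℝ) * Real.log q⌋₊, Nat.log 2 r), (q, r)⟩, ?_, ?_⟩
  · rw [mem_factorTriples, mem_leastPrimes, mem_largestPrimes]
    refine ⟨⟨⟨hm0, (Nat.le_of_dvd hn hmn).trans hnN⟩, ?_, ?_, ?_⟩, ⟨⟨huq, hqv⟩, hqp, ?_, rfl⟩,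
      ⟨hvr, hrN⟩, hrp, fun q' hp' hd => hrmax q' hp' (hd.trans hmn), rfl, ?_⟩
    · rw [Nat.lt_succ_iff]
      apply Nat.floor_le_floor
      gcongr
    · rw [Nat.lt_succ_iff]; exact Nat.log_mono_right hrN
    · intro hb
      refine h3 (mem_biUnion.2 ⟨r, mem_biUnion.2 ⟨_, hb, ?_⟩,
        mem_filter.2 ⟨mem_Icc.2 ⟨hn, hnN⟩, hrn⟩⟩)
      rw [dyadicPrimes, mem_filter, mem_Ico]
      exact ⟨⟨Nat.pow_log_le_self 2 hrp.ne_zero, Nat.lt_pow_succ_log_self (by norm_num) r⟩, hrp⟩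
    · exact fun q' hp' hu hlt hd => hqmin q' hp' hu hlt (hd.trans hmn)
    · have hfl : (⌊(T : ℝ) * Real.log q⌋₊ : ℝ) ≤ T * Real.log q :=
        Nat.floor_le (mul_nonneg hT'.le (Real.log_natCast_nonneg q))
      have hexp : Real.exp ((⌊(T : ℝ) * Real.log q⌋₊ + 1) / T) ≤ q * Real.exp (1 / T) := by
        calc _ ≤ Real.exp (Real.log q + 1 / T) := by
              apply Real.exp_le_exp.2
              rw [add_div]
              gcongr
              rw [div_le_iff₀ hT']; linarith
          _ = _ := by rw [Real.exp_add, Real.exp_log hq0]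
      calc (r : ℝ) * m * Real.exp ((⌊(T : ℝ) * Real.log q⌋₊ + 1) / T)
          ≤ r * m * (q * Real.exp (1 / T)) := by gcongr
        _ = ((q * r * m : ℕ) : ℝ) * Real.exp (1 / T) := by push_cast; ring
        _ ≤ N := by rw [← hm]; exact h4
  · change m * q * r = n
    rw [hm]; ring

lemma ep_eq_stdAddChar {p : ℕ} [NeZero p] (z : ZMod p) :
    Complex.exp (2 * (Real.pi : ℂ) * Complex.I * (z.val : ℂ) / (p : ℂ)) = ZMod.stdAddChar z := by
  have h := ZMod.stdAddChar_coe (N := p) (z.val : ℤ)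
  push_cast at h
  rw [ZMod.natCast_zmod_val] at h
  exact h.symm

lemma natCast_ne_zero_of_lt {p n : ℕ} (h1 : 1 ≤ n) (h2 : n < p) : (n : ZMod p) ≠ 0 := by
  rw [Ne, ZMod.natCast_eq_zero_iff]
  exact fun h => absurd (Nat.le_of_dvd h1 h) (not_le.2 h2)

lemma sum_Icc_ite_mul_le (N : ℕ) {Z : ℝ} (hZ : 0 < Z) :
    ∑ m ∈ Icc 1 N, (if (m : ℝ) * Z ≤ N then Z else 0) ≤ N := by
  rw [← sum_filter, sum_const, nsmul_eq_mul]
  have hsub : ({m ∈ Icc 1 N | (m : ℝ) * Z ≤ N} : Finset ℕ) ⊆ Icc 1 ⌊(N : ℝ) / Z⌋₊ := by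
    intro m hm
    rw [mem_filter, mem_Icc] at hm
    exact mem_Icc.2 ⟨hm.1.1, Nat.le_floor ((le_div_iff₀ hZ).2 hm.2)⟩
  have h := card_le_card hsub
  rw [Nat.card_Icc, Nat.add_sub_cancel] at h
  have h' := (Nat.cast_le (α := ℝ).2 h).trans (Nat.floor_le (by positivity))
  exact (le_div_iff₀ hZ).1 h'

lemma norm_sum_factorTriples_le {p : ℕ} [Fact p.Prime] {a : ZMod p} (ha : a ≠ 0) {u v N T : ℕ}
    (hNp : N < p) {Bad : Finset ℕ} {Δ : ℝ} (hΔ : 0 ≤ Δ)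
    (H : ∀ c i : ℕ, i ≤ Nat.log 2 N → i ∉ Bad → ∀ b : ZMod p, b ≠ 0 → ∀ A B : Finset ℕ,
      (∀ q ∈ A, q.Prime ∧ u < q ∧ q ≤ v ∧ ⌊(T : ℝ) * Real.log q⌋₊ = c) →
      (∀ r ∈ B, r.Prime ∧ v < r ∧ r ≤ N ∧ Nat.log 2 r = i) → A.Nonempty → B.Nonempty →
      ‖∑ q ∈ A, ∑ r ∈ B, ZMod.stdAddChar (b * (q : ZMod p)⁻¹ * (r : ZMod p)⁻¹)‖ ≤
        4 * (Real.exp (c / T) * 2 ^ i) * Δ) :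
    ‖∑ t ∈ factorTriples u v N T Bad,
      ZMod.stdAddChar (a * ((t.1.1 * t.2.1 * t.2.2 : ℕ) : ZMod p)⁻¹)‖ ≤
      (T * Real.log N + 1) * (Nat.log 2 N + 1) * (4 * N * Δ) := by
  rw [factorTriples, sum_sigma]
  refine (norm_sum_le _ _).trans ?_
  have hx : ∀ m ∈ Icc 1 N, ∀ c : ℕ, ∀ i ∈ range (Nat.log 2 N + 1) \ Bad,
      ‖∑ s ∈ leastPrimes u v T m c ×ˢ largestPrimes v N T m c i,
        ZMod.stdAddChar (a * ((m * s.1 * s.2 : ℕ) : ZMod p)⁻¹)‖ ≤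
      (if (m : ℝ) * (Real.exp (c / T) * 2 ^ i) ≤ N then (Real.exp (c / T) * 2 ^ i) else 0) *
        (4 * Δ) := by
    intro m hm c i hi
    rw [mem_Icc] at hm
    rw [mem_sdiff, mem_range, Nat.lt_succ_iff] at hi
    rw [sum_product]
    rcases (leastPrimes u v T m c).eq_empty_or_nonempty with hA | hA
    · rw [hA, sum_empty, norm_zero]; split_ifs <;> positivity
    rcases (largestPrimes v N T m c i).eq_empty_or_nonempty with hB | hB
    · rw [hB]; simp only [sum_empty, sum_const_zero, norm_zero]; split_ifs <;> positivity
    have hcond : (m : ℝ) * (Real.exp (c / T) * 2 ^ i) ≤ N := by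
      obtain ⟨r, hr⟩ := hB
      rw [mem_largestPrimes] at hr
      obtain ⟨-, hrp, -, rfl, hN⟩ := hr
      have h2 : (2 : ℝ) ^ Nat.log 2 r ≤ r := by exact_mod_cast Nat.pow_log_le_self 2 hrp.ne_zero
      calc (m : ℝ) * (Real.exp (c / T) * 2 ^ Nat.log 2 r)
          = 2 ^ Nat.log 2 r * m * Real.exp (c / T) := by ring
        _ ≤ r * m * Real.exp ((c + 1) / T) := by gcongr; linarith
        _ ≤ N := hN
    rw [if_pos hcond]
    have h := H c i hi.1 hi.2 (a * (m : ZMod p)⁻¹)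
      (mul_ne_zero ha (inv_ne_zero (natCast_ne_zero_of_lt hm.1 (by omega)))) _ _
      (fun q hq => by
        rw [mem_leastPrimes] at hq
        exact ⟨hq.2.1, hq.1.1, hq.1.2, hq.2.2.2⟩)
      (fun r hr => by
        rw [mem_largestPrimes] at hr
        exact ⟨hr.2.1, hr.1.1, hr.1.2, hr.2.2.2.1⟩) hA hB
    refine (le_of_eq ?_).trans (h.trans (le_of_eq (by ring)))
    congr 1
    refine sum_congr rfl fun q _ => sum_congr rfl fun r _ => ?_
    congr 1
    push_cast
    rw [mul_inv, mul_inv]; ring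
  rw [sum_product]
  calc _ ≤ ∑ m ∈ Icc 1 N, ∑ y ∈ range (⌊(T : ℝ) * Real.log N⌋₊ + 1) ×ˢ
        (range (Nat.log 2 N + 1) \ Bad),
        (if (m : ℝ) * (Real.exp (y.1 / T) * 2 ^ y.2) ≤ N then
          (Real.exp (y.1 / T) * 2 ^ y.2) else 0) * (4 * Δ) :=
        sum_le_sum fun m hm => sum_le_sum fun y hy => hx m hm y.1 y.2 (mem_product.1 hy).2
    _ = ∑ y ∈ range (⌊(T : ℝ) * Real.log N⌋₊ + 1) ×ˢ (range (Nat.log 2 N + 1) \ Bad),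
        (∑ m ∈ Icc 1 N, if (m : ℝ) * (Real.exp (y.1 / T) * 2 ^ y.2) ≤ N then
          (Real.exp (y.1 / T) * 2 ^ y.2) else 0) * (4 * Δ) := by
        rw [sum_comm]
        exact sum_congr rfl fun y _ => (sum_mul _ _ _).symm
    _ ≤ ∑ y ∈ range (⌊(T : ℝ) * Real.log N⌋₊ + 1) ×ˢ (range (Nat.log 2 N + 1) \ Bad),
        (N : ℝ) * (4 * Δ) := by
        refine sum_le_sum fun y _ => ?_
        exact mul_le_mul_of_nonneg_right (sum_Icc_ite_mul_le N (by positivity)) (by positivity)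
    _ ≤ _ := by
        rw [sum_const, nsmul_eq_mul, card_product, card_range]
        have h1 : ((range (Nat.log 2 N + 1) \ Bad).card : ℝ) ≤ Nat.log 2 N + 1 := by
          have := card_le_card (sdiff_subset (s := range (Nat.log 2 N + 1)) (t := Bad))
          rw [card_range] at this
          exact_mod_cast this
        have h2 : ((⌊(T : ℝ) * Real.log N⌋₊ : ℕ) : ℝ) ≤ T * Real.log N :=
          Nat.floor_le (mul_nonneg (by positivity) (Real.log_natCast_nonneg N))
        have h3 : (0 : ℝ) ≤ T * Real.log N :=
          mul_nonneg (by positivity) (Real.log_natCast_nonneg N)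
        rw [Nat.cast_mul, Nat.cast_add, Nat.cast_one]
        calc _ ≤ (T * Real.log N + 1) * (Nat.log 2 N + 1) * ((N : ℝ) * (4 * Δ)) := by
              refine mul_le_mul_of_nonneg_right (mul_le_mul ?_ h1 ?_ ?_) (by positivity)
              · linarith
              · exact Nat.cast_nonneg _
              · linarith
          _ = _ := by ring

/-- Reduction of the Kloosterman sum to bilinear sums over primes. -/
lemma norm_sum_Icc_stdAddChar_le {p : ℕ} [Fact p.Prime] {a : ZMod p} (ha : a ≠ 0) {u v N T : ℕ}
    (hT : 1 ≤ T) (hNp : N < p) {Bad : Finset ℕ} {Δ : ℝ} (hΔ : 0 ≤ Δ)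
    (H : ∀ c i : ℕ, i ≤ Nat.log 2 N → i ∉ Bad → ∀ b : ZMod p, b ≠ 0 → ∀ A B : Finset ℕ,
      (∀ q ∈ A, q.Prime ∧ u < q ∧ q ≤ v ∧ ⌊(T : ℝ) * Real.log q⌋₊ = c) →
      (∀ r ∈ B, r.Prime ∧ v < r ∧ r ≤ N ∧ Nat.log 2 r = i) → A.Nonempty → B.Nonempty →
      ‖∑ q ∈ A, ∑ r ∈ B, ZMod.stdAddChar (b * (q : ZMod p)⁻¹ * (r : ZMod p)⁻¹)‖ ≤
        4 * (Real.exp (c / T) * 2 ^ i) * Δ) :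
    ‖∑ n ∈ Icc 1 N, ZMod.stdAddChar (a * (n : ZMod p)⁻¹)‖ ≤
      (siftedUpTo u v N).card + (smoothUpTo v N).card +
      ((Bad.biUnion dyadicPrimes).biUnion fun r => {n ∈ Icc 1 N | r ∣ n}).card + (N / T + 1) +
      (T * Real.log N + 1) * (Nat.log 2 N + 1) * (4 * N * Δ) := by
  classical
  set E3 := (Bad.biUnion dyadicPrimes).biUnion fun r => {n ∈ Icc 1 N | r ∣ n}
  set E4 : Finset ℕ := {n ∈ Icc 1 N | (N : ℝ) < n * Real.exp (1 / T)} with hE4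
  set f : (_ : ℕ × ℕ × ℕ) × (ℕ × ℕ) → ℕ := fun t => t.1.1 * t.2.1 * t.2.2 with hf
  set I := (factorTriples u v N T Bad).image f with hI
  have hsub : I ⊆ Icc 1 N := by
    intro n hn
    obtain ⟨t, ht, rfl⟩ := mem_image.1 hn
    exact factorTriples_maps hT ht
  have hcov : Icc 1 N \ I ⊆ siftedUpTo u v N ∪ smoothUpTo v N ∪ E3 ∪ E4 := by
    intro n hn
    by_contra hcon
    rw [mem_sdiff, mem_Icc] at hn
    simp only [mem_union, not_or] at hcon
    obtain ⟨⟨⟨h1, h2⟩, h3⟩, h4⟩ := hcon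
    refine hn.2 (mem_image.2 (exists_factorTriple hT hn.1.1 hn.1.2 h1 h2 h3 ?_))
    by_contra hlt
    exact h4 (mem_filter.2 ⟨mem_Icc.2 hn.1, not_le.1 hlt⟩)
  have hcard : ((Icc 1 N \ I).card : ℝ) ≤
      (siftedUpTo u v N).card + (smoothUpTo v N).card + E3.card + E4.card := by
    have h1 := card_le_card hcov
    have h2 := card_union_le (siftedUpTo u v N ∪ smoothUpTo v N ∪ E3) E4
    have h3 := card_union_le (siftedUpTo u v N ∪ smoothUpTo v N) E3
    have h4 := card_union_le (siftedUpTo u v N) (smoothUpTo v N)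
    have : (Icc 1 N \ I).card ≤
      (siftedUpTo u v N).card + (smoothUpTo v N).card + E3.card + E4.card := by omega
    exact_mod_cast this
  have hedge : (E4.card : ℝ) ≤ N / T + 1 := card_edge_le hT
  have hmain := norm_sum_factorTriples_le ha hNp hΔ H
  rw [← sum_sdiff hsub, hI, sum_image (factorTriples_injOn u v N T Bad), ← hI]
  refine (norm_add_le _ _).trans (add_le_add ?_ hmain)
  refine (norm_sum_le _ _).trans ?_
  rw [sum_congr rfl fun n _ => norm_stdAddChar _, sum_const, nsmul_eq_mul, mul_one]
  linarith

/-- Block sizes `e ^ x` admitting an exponent `l` for which `p` is well inside the interval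
`[e ^ (2 * (l - 1) * x), e ^ (2 * l * x)]`; here `L = log p`. -/
def GoodBlock (L D x : ℝ) : Prop :=
  ∃ l : ℕ, 1 ≤ l ∧ 4 * (l : ℝ) ≤ L ^ 2 ∧ L + D * l ≤ 2 * l * x ∧ 2 * (l - 1) * x + D * l ≤ L

lemma norm_good_block_le {p : ℕ} [Fact p.Prime] {b : ZMod p} (hb : b ≠ 0) {A B : Finset ℕ}
    {N T v c i : ℕ} {s : ℝ} (hNp : N < p) (hT : 2 ≤ T) (hvN : v ≤ N)
    (hlam : 1 ≤ Real.log (Real.log p)) (hs : 48 * Real.log (Real.log p) ≤ s)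
    (hsL : s ^ 2 ≤ Real.log p) (hv : Real.log p ^ 2 ≤ v)
    (hi : GoodBlock (Real.log p) (48 * Real.log (Real.log p) * s) (i * Real.log 2))
    (hA : ∀ q ∈ A, q.Prime ∧ 2 ^ ⌈Real.log p / s⌉₊ < q ∧ q ≤ v ∧ ⌊(T : ℝ) * Real.log q⌋₊ = c)
    (hB : ∀ r ∈ B, r.Prime ∧ v < r ∧ r ≤ N ∧ Nat.log 2 r = i) (hA0 : A.Nonempty) :
    ‖∑ q ∈ A, ∑ r ∈ B, ZMod.stdAddChar (b * (q : ZMod p)⁻¹ * (r : ZMod p)⁻¹)‖ ≤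
        4 * (Real.exp (c / T) * 2 ^ i) * (1 / Real.log p ^ 4) := by
  set L := Real.log p with hL
  set lam := Real.log L with hlamdef
  obtain ⟨l, hl1, hlL, hl2, hl3⟩ := hi
  have hs0 : 48 ≤ s := by linarith
  have hL0 : 2304 ≤ L := by nlinarith
  have hT' : (2 : ℝ) ≤ T := by exact_mod_cast hT
  have hκ : 0.69 < Real.log 2 := by have := Real.log_two_gt_d9; linarith
  set h := ⌈L / s⌉₊ with hh
  have hLs : s ≤ L / s := by rw [le_div_iff₀ (by linarith)]; nlinarith
  have hhle : L / s ≤ h := Nat.le_ceil _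
  have hT1 : 1 / (T : ℝ) ≤ 1 / 2 := one_div_le_one_div_of_le (by norm_num) hT'
  have hclass : ∀ q ∈ A, Real.exp (c / T) ≤ q ∧ (q : ℝ) ≤ 2 * Real.exp (c / T) := by
    intro q hq
    obtain ⟨hqp, -, -, hc⟩ := hA q hq
    have hq0 : (0 : ℝ) < q := by exact_mod_cast hqp.pos
    have hlog : 0 ≤ Real.log q := Real.log_natCast_nonneg q
    have h1 : (c : ℝ) ≤ T * Real.log q := hc ▸ Nat.floor_le (by positivity)
    have h2 : (T : ℝ) * Real.log q < c + 1 := hc ▸ Nat.lt_floor_add_one _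
    constructor
    · rw [← Real.le_log_iff_exp_le hq0, div_le_iff₀ (by linarith)]; linarith
    · rw [← Real.exp_log (by norm_num : (0 : ℝ) < 2), ← Real.exp_add, ← Real.log_le_iff_le_exp hq0]
      have : Real.log q ≤ (c + 1) / T := by rw [le_div_iff₀ (by linarith)]; linarith
      rw [add_div] at this
      linarith
  have hy : L / s / 2 ≤ c / T := by
    obtain ⟨q, hq⟩ := hA0
    obtain ⟨hqp, huq, -, hc⟩ := hA q hq
    have h2 : (T : ℝ) * Real.log q < c + 1 := hc ▸ Nat.lt_floor_add_one _
    have h3 : (h : ℝ) * Real.log 2 ≤ Real.log q := by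
      rw [← Real.log_pow]
      apply Real.log_le_log (by positivity)
      exact_mod_cast huq.le
    have h4 : Real.log q ≤ c / T + 1 / T := by
      rw [← add_div, le_div_iff₀ (by linarith)]; linarith
    nlinarith
  set y : ℝ := c / T with hydef
  have hy0 : 0 < y := by linarith
  set k := ⌈L / (2 * y)⌉₊ with hk
  have hk0 : 1 ≤ k := Nat.one_le_ceil_iff.2 (by positivity)
  have hk1 : L ≤ 2 * k * y := by
    have := Nat.le_ceil (L / (2 * y))
    rw [div_le_iff₀ (by positivity)] at this
    linarith
  have hk1' : (k : ℝ) < L / (2 * y) + 1 := Nat.ceil_lt_add_one (by positivity)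
  have hk2 : 2 * ((k : ℝ) - 1) * y ≤ L := by
    have h1 : (k : ℝ) - 1 ≤ L / (2 * y) := by linarith
    rw [le_div_iff₀ (by positivity)] at h1
    linarith
  have hks : (k : ℝ) ≤ 2 * s := by
    have : L / (2 * y) ≤ s := by
      rw [div_le_iff₀ (by positivity)]
      have h5 : L / s * s = L := div_mul_cancel₀ _ (by linarith)
      nlinarith
    linarith
  have hkq : ∀ q ∈ A, k < q := by
    intro q hq
    have h1 : (k : ℝ) ≤ 2 * h := by linarith
    have h2 : k ≤ 2 * h := by exact_mod_cast h1
    have h3 : 2 * h ≤ 2 ^ h := by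
      rcases Nat.eq_zero_or_pos h with h0 | h0
      · simp [h0]
      · obtain ⟨m, hm⟩ : ∃ m, h = m + 1 := ⟨h - 1, by omega⟩
        rw [hm, pow_succ]
        have := Nat.lt_two_pow_self (n := m)
        omega
    have := (hA q hq).2.1
    omega
  have hlv : ∀ r ∈ B, l < r := by
    intro r hr
    have h1 : (l : ℝ) ≤ v := by nlinarith
    have h2 : l ≤ v := by exact_mod_cast h1
    have := (hB r hr).2.1
    omega
  have h2i : Real.log ((2 : ℝ) ^ i) = i * Real.log 2 := Real.log_pow _ _
  have := norm_prime_block_le (p := p) hb (A := A) (B := B) (X := 2 ^ i) (Y := Real.exp y)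
    (D := 48 * lam * s) hk0 hl1 (one_le_pow₀ (by norm_num)) (Real.one_le_exp hy0.le)
    (fun q hq => ⟨(hA q hq).1, (hclass q hq).1, (hclass q hq).2, by
      have := (hA q hq).2.2.1; omega, hkq q hq⟩)
    (fun r hr => by
      obtain ⟨hrp, hvr, hrN, rfl⟩ := hB r hr
      refine ⟨hrp, ?_, ?_, by omega, hlv r hr⟩
      · exact_mod_cast Nat.pow_log_le_self 2 hrp.ne_zero
      · have := (Nat.lt_pow_succ_log_self (by norm_num : 1 < 2) r).le
        rw [pow_succ, mul_comm] at this
        exact_mod_cast this)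
    (by rw [Real.log_exp]; exact hk1) (by rw [Real.log_exp]; exact hk2)
    (by rw [h2i]; exact hl2) (by rw [h2i]; exact hl3) (by linarith) (by nlinarith) hlL
    (by nlinarith)
  refine this.trans (le_of_eq (by ring))

/-- Few dyadic blocks fail to be good. -/
lemma card_bad_blocks_le {L D : ℝ} {i₀ J : ℕ} (hi₀ : 1 ≤ i₀) (hL : 5 ≤ L) (hD : 1 ≤ D)
    (hDL : D ≤ L) (hi₀L : (i₀ : ℝ) ≤ L) (Bad : Finset ℕ)
    (hBad : ∀ i ∈ Bad, i₀ ≤ i ∧ i ≤ J ∧ ¬ GoodBlock L D (i * Real.log 2)) :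
    (Bad.card : ℝ) ≤ 8 * D * L / i₀ := by
  have hκ : 0.69 < Real.log 2 := by have := Real.log_two_gt_d9; linarith
  have hi₀' : (1 : ℝ) ≤ i₀ := by exact_mod_cast hi₀
  set l₁ := ⌈L / (2 * (i₀ * Real.log 2))⌉₊ with hl₁
  have hl₁le : (l₁ : ℝ) ≤ 2 * L / i₀ := by
    have h1 : (l₁ : ℝ) < L / (2 * (i₀ * Real.log 2)) + 1 := Nat.ceil_lt_add_one (by positivity)
    have h2 : L / (2 * (i₀ * Real.log 2)) ≤ L / i₀ := by
      gcongr
      nlinarith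
    have h3 : 1 ≤ L / i₀ := by rw [le_div_iff₀ (by linarith)]; linarith
    rw [mul_div_assoc]; linarith
  set U : ℕ → Finset ℕ := fun j => {i ∈ range (J + 1) | |L - 2 * j * (i * Real.log 2)| < 2 * D * j}
    with hU
  have hcov : Bad ⊆ (Icc 1 l₁).biUnion U := by
    intro i hi
    obtain ⟨h0, hJ, hng⟩ := hBad i hi
    by_contra hcon
    apply hng
    have hj : ∀ j ∈ Icc 1 l₁, 2 * D * j ≤ |L - 2 * j * (i * Real.log 2)| := by
      intro j hj
      by_contra hlt
      exact hcon (mem_biUnion.2 ⟨j, hj, mem_filter.2 ⟨mem_range.2 (by omega), not_le.1 hlt⟩⟩)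
    have hi0 : (i₀ : ℝ) ≤ i := by exact_mod_cast h0
    set x := (i : ℝ) * Real.log 2 with hx
    have hx0 : (i₀ : ℝ) * Real.log 2 ≤ x := by rw [hx]; gcongr
    have hxp : 0.69 < x := by nlinarith
    set l := ⌈L / (2 * x)⌉₊ with hl
    have hl1 : 1 ≤ l := Nat.one_le_ceil_iff.2 (by positivity)
    have hll₁ : l ≤ l₁ := by
      apply Nat.ceil_le_ceil
      gcongr
    have hlup : L ≤ 2 * l * x := by
      have := Nat.le_ceil (L / (2 * x))
      rw [div_le_iff₀ (by positivity)] at this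
      linarith
    have hlt : (l : ℝ) < L / (2 * x) + 1 := Nat.ceil_lt_add_one (by positivity)
    have hlo : 2 * ((l : ℝ) - 1) * x ≤ L := by
      have h1 : (l : ℝ) - 1 ≤ L / (2 * x) := by linarith
      rw [le_div_iff₀ (by positivity)] at h1
      linarith
    have hlL : (l : ℝ) ≤ L + 1 := by
      have : L / (2 * x) ≤ L := div_le_self (by linarith) (by linarith)
      linarith
    refine ⟨l, hl1, by nlinarith, ?_, ?_⟩
    · have h1 := hj l (mem_Icc.2 ⟨hl1, hll₁⟩)
      rw [abs_of_nonpos (by linarith)] at h1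
      have : 0 ≤ D * l := by positivity
      linarith
    · rcases hl1.eq_or_lt with h1 | h1
      · rw [← h1]; push_cast; linarith
      · have hc : ((l - 1 : ℕ) : ℝ) = l - 1 := by rw [Nat.cast_sub hl1]; simp
        have h2 := hj (l - 1) (mem_Icc.2 ⟨by omega, by omega⟩)
        rw [hc, abs_of_nonneg (by linarith)] at h2
        have h3 : (2 : ℝ) ≤ l := by exact_mod_cast h1
        nlinarith
  have hUcard : ∀ j ∈ Icc 1 l₁, ((U j).card : ℝ) ≤ 4 * D := by
    intro j hj
    have hj1 : (1 : ℝ) ≤ j := by exact_mod_cast (mem_Icc.1 hj).1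
    set z : ℝ := L / (2 * j * Real.log 2) with hz
    set w : ℝ := D / Real.log 2 with hw
    have hz1 : z * (2 * j * Real.log 2) = L := div_mul_cancel₀ _ (by positivity)
    have hw1 : w * Real.log 2 = D := div_mul_cancel₀ _ (by positivity)
    have hbnd : ∀ i ∈ U j, z - w < i ∧ (i : ℝ) < z + w := by
      intro i hi
      have h1 := (mem_filter.1 hi).2
      rw [abs_lt] at h1
      have e : L - 2 * j * (i * Real.log 2) = (2 * j * Real.log 2) * (z - i) := by
        rw [mul_sub, mul_comm _ z, hz1]; ring
      have e2 : 2 * D * j = (2 * j * Real.log 2) * w := by rw [← hw1]; ring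
      rw [e, e2, ← mul_neg] at h1
      have hpos : 0 < 2 * (j : ℝ) * Real.log 2 := by positivity
      have h2 := lt_of_mul_lt_mul_left h1.1 hpos.le
      have h3 := lt_of_mul_lt_mul_left h1.2 hpos.le
      constructor <;> linarith
    have hwD : 2 * w + 1 ≤ 4 * D := by
      have : w ≤ 1.5 * D := by rw [hw, div_le_iff₀ (by positivity)]; nlinarith
      linarith
    refine le_trans ?_ hwD
    have hz0 : 0 ≤ z := by positivity
    have hw0 : 0 ≤ w := by positivity
    have hsub : (U j).image (fun i : ℕ => (i : ℤ)) ⊆ Ioc ⌊z - w⌋ ⌊z + w⌋ := by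
      intro n hn
      obtain ⟨i, hi, rfl⟩ := mem_image.1 hn
      obtain ⟨h1, h2⟩ := hbnd i hi
      rw [mem_Ioc, Int.floor_lt, Int.le_floor]
      exact ⟨by exact_mod_cast h1, by exact_mod_cast h2.le⟩
    have h := card_le_card hsub
    rw [card_image_of_injective _ Nat.cast_injective, Int.card_Ioc] at h
    have h0 : ⌊z - w⌋ ≤ ⌊z + w⌋ := Int.floor_le_floor (by linarith)
    have h' : ((U j).card : ℝ) ≤ (⌊z + w⌋ - ⌊z - w⌋ : ℤ) := by
      have : ((U j).card : ℤ) ≤ ⌊z + w⌋ - ⌊z - w⌋ := by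
        rw [← Int.toNat_of_nonneg (sub_nonneg.2 h0)]; exact_mod_cast h
      exact_mod_cast this
    push_cast at h'
    linarith [Int.floor_le (z + w), Int.lt_floor_add_one (z - w)]
  calc (Bad.card : ℝ) ≤ (((Icc 1 l₁).biUnion U).card : ℕ) := by exact_mod_cast card_le_card hcov
    _ ≤ ∑ j ∈ Icc 1 l₁, ((U j).card : ℝ) := by exact_mod_cast card_biUnion_le
    _ ≤ ∑ j ∈ Icc 1 l₁, 4 * D := sum_le_sum hUcard
    _ = l₁ * (4 * D) := by simp
    _ ≤ (2 * L / i₀) * (4 * D) := by gcongr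
    _ = _ := by ring

set_option maxHeartbeats 1000000 in
lemma norm_kloosterman_le_of_large {p : ℕ} [Fact p.Prime] {a : ZMod p} (ha : a ≠ 0) {N : ℕ}
    {s : ℝ} (hNp : N < p) (hN : 2 ≤ N) (hlam : 1 ≤ Real.log (Real.log p))
    (hs : 48 * Real.log (Real.log p) ≤ s) (hsN : s ^ 2 = Real.log N) :
    ‖∑ n ∈ Icc 1 N, ZMod.stdAddChar (a * (n : ZMod p)⁻¹)‖ ≤
      1000000 * (Real.log (Real.log p) ^ 3 * Real.log p / s ^ 3) * N := by
  classical
  have hκ : 0.69 < Real.log 2 := by have := Real.log_two_gt_d9; linarith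
  have hκ' : Real.log 2 < 0.7 := by have := Real.log_two_lt_d9; linarith
  have hN0 : (0 : ℝ) < N := by exact_mod_cast (by omega : 0 < N)
  have hNL : Real.log N ≤ Real.log p := Real.log_le_log hN0 (by exact_mod_cast hNp.le)
  set L := Real.log p with hL
  set lam := Real.log L with hlamdef
  have hs0 : 48 ≤ s := by linarith
  have hsL : s ^ 2 ≤ L := hsN ▸ hNL
  have hL0 : 2304 ≤ L := by nlinarith
  have hs2 : 2304 * lam ≤ s ^ 2 := by nlinarith
  have hLN : L ≤ N := by
    rw [← Real.log_le_log_iff (by linarith) hN0, ← hsN]; linarith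
  set y := s ^ 2 / (12 * lam) with hy
  have hy2 : y * (12 * lam) = s ^ 2 := div_mul_cancel₀ _ (by positivity)
  have hy1 : 192 * lam ≤ y := by rw [hy, le_div_iff₀ (by positivity)]; nlinarith
  have hyL : 12 * y ≤ L := by nlinarith
  set i₀ := ⌈y⌉₊ with hi₀
  have hi₀le : y ≤ i₀ := Nat.le_ceil _
  have hi₀lt : (i₀ : ℝ) < y + 1 := Nat.ceil_lt_add_one (by linarith)
  have hi₀1 : 1 ≤ i₀ := Nat.one_le_ceil_iff.2 (by linarith)
  set v := 2 ^ i₀ with hv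
  have hlogv : Real.log v = i₀ * Real.log 2 := by rw [hv]; push_cast; exact Real.log_pow _ _
  have hv2 : 2 ≤ v := by
    calc 2 = 2 ^ 1 := rfl
      _ ≤ 2 ^ i₀ := Nat.pow_le_pow_right (by norm_num) hi₀1
  have hv0 : (0 : ℝ) < v := by exact_mod_cast (by omega : 0 < v)
  set w := ⌈3 * lam⌉₊ with hw
  have hwle : 3 * lam ≤ w := Nat.le_ceil _
  have hwlt : (w : ℝ) < 3 * lam + 1 := Nat.ceil_lt_add_one (by linarith)
  have hvw : v ^ (2 * w) ≤ N := by
    have : (v : ℝ) ^ (2 * w) ≤ N := by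
      rw [← Real.log_le_log_iff (by positivity) hN0, Real.log_pow, hlogv, ← hsN, ← hy2]
      push_cast
      have h1 : (i₀ : ℝ) * Real.log 2 ≤ 1.1 * y * 0.7 := by gcongr; linarith
      have h2 : (w : ℝ) ≤ 4 * lam := by linarith
      calc 2 * (w : ℝ) * (i₀ * Real.log 2) ≤ 2 * (4 * lam) * (1.1 * y * 0.7) := by gcongr
        _ ≤ y * (12 * lam) := by nlinarith [mul_nonneg (by linarith : 0 ≤ y) (by linarith : 0 ≤ lam)]
    exact_mod_cast this
  have hvN : v ≤ N := by
    refine le_trans ?_ hvw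
    apply Nat.le_self_pow
    have : 0 < w := Nat.ceil_pos.2 (by linarith)
    omega
  have hLv : L ^ 2 ≤ v := by
    rw [← Real.log_le_log_iff (by positivity) hv0, Real.log_pow, hlogv]
    push_cast
    nlinarith
  set h := ⌈L / s⌉₊ with hh
  have hLs : s ≤ L / s := by rw [le_div_iff₀ (by linarith)]; nlinarith
  have hhlt : (h : ℝ) < L / s + 1 := Nat.ceil_lt_add_one (by positivity)
  have hh1 : 1 ≤ h := Nat.one_le_ceil_iff.2 (by positivity)
  have hu2 : 2 ≤ 2 ^ h := by
    calc 2 = 2 ^ 1 := rfl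
      _ ≤ 2 ^ h := Nat.pow_le_pow_right (by norm_num) hh1
  set T := ⌈L⌉₊ with hT
  have hTle : L ≤ T := Nat.le_ceil _
  have hTlt : (T : ℝ) < L + 1 := Nat.ceil_lt_add_one (by linarith)
  have hT0 : (0 : ℝ) < T := by linarith
  have hT2 : 2 ≤ T := by
    have : (2 : ℝ) ≤ T := by linarith
    exact_mod_cast this
  have hT6 : T ^ 6 ≤ N := by
    have : (T : ℝ) ^ 6 ≤ N := by
      rw [← Real.log_le_log_iff (by positivity) hN0, Real.log_pow, ← hsN]
      have h1 : Real.log T ≤ lam + Real.log 2 := by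
        rw [hlamdef, ← Real.log_mul (by linarith) (by norm_num)]
        exact Real.log_le_log hT0 (by linarith)
      push_cast
      linarith
    exact_mod_cast this
  set Q := lam ^ 3 * L / s ^ 3 with hQ
  have hlam3 : lam ≤ lam ^ 3 := by nlinarith [sq_nonneg (lam - 1), mul_self_nonneg lam]
  have hlam31 : 1 ≤ lam ^ 3 := by linarith
  have hQL : 1 / L ≤ Q := by
    rw [hQ, div_le_div_iff₀ (by linarith) (by positivity)]
    have h1 : s ^ 3 ≤ L * L := by
      calc s ^ 3 = s ^ 2 * s := by ring
        _ ≤ L * L := mul_le_mul hsL (by nlinarith) (by linarith) (by linarith)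
    nlinarith [mul_nonneg (sub_nonneg.2 hlam31) (mul_nonneg (by linarith : 0 ≤ L) (by linarith : 0 ≤ L))]
  have hQ0 : 0 ≤ Q := le_trans (by positivity) hQL
  have b1 : ((siftedUpTo (2 ^ h) v N).card : ℝ) ≤ 7000 * (24 * Q) * N := by
    refine (card_siftedUpTo_le hu2 hv2 hvN).trans ?_
    gcongr
    rw [hlogv]
    push_cast
    rw [Real.log_pow, mul_div_mul_right _ _ (by positivity), div_le_iff₀ (by linarith)]
    have h1 : (h : ℝ) ≤ 2 * (L / s) := by linarith
    have h2 : 2 * (L / s) = 24 * (lam * L / s ^ 3) * y := by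
      rw [hy]; field_simp; ring
    rw [h2] at h1
    refine h1.trans ?_
    have h3 : lam * L / s ^ 3 ≤ Q := by rw [hQ]; gcongr
    gcongr
  have b2 : ((smoothUpTo v N).card : ℝ) ≤ 4 * Q * N := by
    refine (card_smoothUpTo_le hv2 (by omega) hT6 hvw).trans ?_
    have h1 : 2 * (N : ℝ) / T ≤ 2 * N * Q := by
      rw [div_eq_mul_one_div]
      gcongr
      exact (one_div_le_one_div_of_le (by linarith) hTle).trans hQL
    have h2 : L ^ 2 ≤ 2 ^ w := by
      rw [← Real.log_le_log_iff (by positivity) (by positivity), Real.log_pow, Real.log_pow]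
      push_cast
      nlinarith
    have h3 : (N : ℝ) * (1 + Real.log N) / 2 ^ w ≤ 2 * N * Q := by
      calc (N : ℝ) * (1 + Real.log N) / 2 ^ w ≤ N * (2 * L) / L ^ 2 := by gcongr; linarith
        _ = 2 * N * (1 / L) := by field_simp
        _ ≤ 2 * N * Q := by gcongr
    linarith
  set D := 48 * lam * s with hD
  set J := Nat.log 2 N with hJ
  set Bad : Finset ℕ := {i ∈ Icc i₀ J | ¬ GoodBlock L D ((i : ℝ) * Real.log 2)} with hBad
  have b3 : (((Bad.biUnion dyadicPrimes).biUnion fun r => {n ∈ Icc 1 N | r ∣ n}).card : ℝ) ≤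
      221184 * Q * N := by
    refine (card_dvd_dyadicPrimes_le hi₀1 Bad fun i hi => (mem_Icc.1 (mem_filter.1 hi).1).1).trans ?_
    gcongr
    have hc := card_bad_blocks_le (L := L) (D := D) (J := J) hi₀1 (by linarith) (by nlinarith)
      (by nlinarith) (by linarith) Bad (fun i hi => by
        rw [hBad, mem_filter, mem_Icc] at hi
        exact ⟨hi.1.1, hi.1.2, hi.2⟩)
    calc 4 * (Bad.card : ℝ) / i₀ ≤ 4 * (8 * D * L / i₀) / i₀ := by gcongr
      _ ≤ 4 * (8 * D * L / y) / y := by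
        have : 0 < y := by linarith
        gcongr
      _ = 221184 * Q := by rw [hD, hQ, hy]; field_simp; ring
  have b4 : (N : ℝ) / T + 1 ≤ 2 * Q * N := by
    have h1 : (N : ℝ) / T ≤ N * Q := by
      rw [div_eq_mul_one_div]
      gcongr
      exact (one_div_le_one_div_of_le (by linarith) hTle).trans hQL
    have h2 : 1 ≤ N * Q := by
      calc (1 : ℝ) ≤ N * (1 / L) := by rw [mul_one_div, le_div_iff₀ (by linarith)]; linarith
        _ ≤ N * Q := by gcongr
    linarith
  have b5 : ((T : ℝ) * Real.log N + 1) * (Nat.log 2 N + 1) * (4 * N * (1 / L ^ 4)) ≤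
      24 * Q * N := by
    have h0 : 0 ≤ Real.log N := Real.log_natCast_nonneg N
    have h1 : (T : ℝ) * Real.log N + 1 ≤ 3 * L ^ 2 := by
      have : (T : ℝ) * Real.log N ≤ 2 * L * L := by gcongr; linarith
      nlinarith
    have h2 : (Nat.log 2 N : ℝ) + 1 ≤ 2 * L := by
      have : (Nat.log 2 N : ℝ) * Real.log 2 ≤ Real.log N := by
        rw [← Real.log_pow]
        apply Real.log_le_log (by positivity)
        exact_mod_cast Nat.pow_log_le_self 2 (by omega : N ≠ 0)
      nlinarith
    calc _ ≤ 3 * L ^ 2 * (2 * L) * (4 * N * (1 / L ^ 4)) := by gcongr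
      _ = 24 * (1 / L) * N := by field_simp; ring
      _ ≤ 24 * Q * N := by gcongr
  have main := norm_sum_Icc_stdAddChar_le (u := 2 ^ h) (v := v) (T := T) (Bad := Bad)
    (Δ := 1 / L ^ 4) ha (by omega) hNp (by positivity)
    (fun c i hiJ hiB b hb A B hA hB hA0 hB0 => by
      refine norm_good_block_le (N := N) (v := v) (s := s) hb hNp hT2 hvN hlam hs hsL hLv ?_ hA hB hA0
      by_contra hng
      obtain ⟨r, hr⟩ := hB0
      obtain ⟨hrp, hvr, -, hri⟩ := hB r hr
      have : i₀ ≤ i := by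
        rw [← hri]
        exact Nat.le_log_of_pow_le (by norm_num) hvr.le
      exact hiB (mem_filter.2 ⟨mem_Icc.2 ⟨this, hiJ⟩, hng⟩))
  have hQN : 0 ≤ Q * N := by positivity
  linarith

lemma one_le_log_log {p : ℕ} (hp : 16 ≤ p) : 1 ≤ Real.log (Real.log p) := by
  have h16 : Real.log 16 = 4 * Real.log 2 := by
    rw [show (16 : ℝ) = 2 ^ 4 by norm_num, Real.log_pow]; norm_num
  have h1 : Real.log 16 ≤ Real.log p := Real.log_le_log (by norm_num) (by exact_mod_cast hp)
  have h2 := Real.log_two_gt_d9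
  have h3 := Real.exp_one_lt_d9
  rw [Real.le_log_iff_exp_le (by linarith)]
  linarith

/-- there is an absolute constant `C > 0` such that for every prime `p ≥ 16`,
every `2 ≤ N < p` and every integer `a` coprime to `p`,
`|∑_{n=1}^N e_p(a n*)| ≤ C·(log log p)³·(log p)/(log N)^{3/2}·N`. -/
theorem stmt_17 :
    ∃ C : ℝ, 0 < C ∧
      ∀ p : ℕ, p.Prime → 16 ≤ p → ∀ N : ℕ, 2 ≤ N → N < p →
        ∀ a : ℤ, Int.gcd a p = 1 →
          ‖∑ n ∈ Finset.Icc 1 N, ep p ((a : ZMod p) * (n : ZMod p)⁻¹)‖ ≤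
            C * Real.log (Real.log p) ^ 3 * Real.log p / Real.log N ^ ((3 : ℝ) / 2) *
              (N : ℝ) := by
  refine ⟨1000000, by norm_num, fun p hp hp16 N hN hNp a hap => ?_⟩
  have : Fact p.Prime := ⟨hp⟩
  have ha : (a : ZMod p) ≠ 0 := by
    intro h
    rw [ZMod.intCast_zmod_eq_zero_iff_dvd] at h
    have h2 : (p : ℤ) ∣ Int.gcd a p := Int.dvd_coe_gcd h dvd_rfl
    rw [hap] at h2
    exact hp.one_lt.ne' (by exact_mod_cast Int.eq_one_of_dvd_one (by positivity) h2)
  have hlam := one_le_log_log hp16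
  have hN0 : (0 : ℝ) < N := by exact_mod_cast (by omega : 0 < N)
  have hlogN : 0 < Real.log N := Real.log_pos (by exact_mod_cast hN)
  set s := √(Real.log N) with hs
  have hs0 : 0 < s := Real.sqrt_pos.2 hlogN
  have hsN : s ^ 2 = Real.log N := Real.sq_sqrt hlogN.le
  have hpow : Real.log N ^ ((3 : ℝ) / 2) = s ^ 3 := by
    rw [← hsN, ← Real.rpow_natCast s 2, ← Real.rpow_mul hs0.le, ← Real.rpow_natCast s 3]
    norm_num
  have hsum : ∑ n ∈ Icc 1 N, ep p ((a : ZMod p) * (n : ZMod p)⁻¹) =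
      ∑ n ∈ Icc 1 N, ZMod.stdAddChar ((a : ZMod p) * (n : ZMod p)⁻¹) :=
    sum_congr rfl fun n _ => ep_eq_stdAddChar _
  have hC : 1000000 * Real.log (Real.log p) ^ 3 * Real.log p / s ^ 3 * (N : ℝ) =
      1000000 * (Real.log (Real.log p) ^ 3 * Real.log p / s ^ 3) * N := by ring
  rw [hsum, hpow, hC]
  rcases le_or_gt (48 * Real.log (Real.log p)) s with h | h
  · exact norm_kloosterman_le_of_large ha hNp hN hlam h hsN
  · have htriv : ‖∑ n ∈ Icc 1 N, ZMod.stdAddChar ((a : ZMod p) * (n : ZMod p)⁻¹)‖ ≤ N := by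
      refine (norm_sum_le _ _).trans ?_
      rw [sum_congr rfl fun n _ => norm_stdAddChar _]
      simp
    refine htriv.trans (le_mul_of_one_le_left hN0.le ?_)
    have hL : s ^ 2 ≤ Real.log p :=
      hsN ▸ Real.log_le_log hN0 (by exact_mod_cast hNp.le)
    set lam := Real.log (Real.log p)
    have h1 : 1 ≤ 48 * (lam ^ 3 * Real.log p / s ^ 3) := by
      rw [← mul_div_assoc, one_le_div (by positivity)]
      have h3 : s ≤ 48 * lam ^ 3 := by nlinarith [sq_nonneg (lam - 1), mul_self_nonneg lam]
      calc s ^ 3 = s * s ^ 2 := by ring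
        _ ≤ 48 * lam ^ 3 * Real.log p := by gcongr
        _ = _ := by ring
    linarith
end
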